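/- arXiv:2301.13070 — 2 statements merged into one kernel-verified Lean document; each statement's English description precedes it below -/
import Mathlib

section
/- Let H be an N-body Hamiltonian H = −½Δ + Σ_{1≤i<j≤N} w(r_i−r_j) + Σ_{i=1}^N v(r_i) on H_N = ⋀_{i=1}^N L²(ℝ³), with v, w ∈ L²(ℝ³)+L^∞(ℝ³) real-valued, such that the ground-state energy E₀ of H is a simple isolated eigenvalue and the ground-state density is bounded. Let χ₀ be the density-density response function of H, χ^RPA the solution of the RPA Dyson equation, Ω = inf σ_ess(H) − E₀, and let P(χ̂₀), P(χ̂^RPA) denote the sets of poles of the meromorphic extensions of the Fourier transforms χ̂₀ and χ̂^RPA on D_Ω = ℂ \ ((−∞,−Ω] ∪ [Ω,∞)). Then the poles of χ̂^RPA are forward shifted with respect to those of χ̂₀: for every 0 < ω < Ω, Σ_{ω̃ ∈ P(χ̂^RPA), |ω̃|<ω} rank_{ω̃}(χ̂^RPA) ≤ Σ_{ω̃ ∈ P(χ̂₀), |ω̃|<ω} rank_{ω̃}(χ̂₀). -/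
/-!
STATEMENT 3: Forward shift of the poles of the RPA density-density response function with
respect to those of the reference response function.
-/

open MeasureTheory ENNReal NNReal Complex
noncomputable section

/-- Euclidean space `ℝ³`. -/
abbrev R3 : Type := EuclideanSpace ℝ (Fin 3)

/-- The Lebesgue space `L^p(ℝ³; ℂ)`. -/
abbrev Lsp (p : ℝ≥0∞) : Type := Lp ℂ p (volume : Measure R3)

/-- The Banach space `L¹(ℝ³) ∩ L²(ℝ³)` (with the max norm), realized as the submodule of
`L¹ × L²` of pairs whose two components agree almost everywhere. -/
def interSub : Submodule ℂ (Lsp 1 × Lsp 2) where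
  carrier := {f | (f.1 : R3 → ℂ) =ᵐ[volume] (f.2 : R3 → ℂ)}
  add_mem' := by
    intro a b ha hb
    simp only [Set.mem_setOf_eq] at *
    have h1 := Lp.coeFn_add a.1 b.1
    have h2 := Lp.coeFn_add a.2 b.2
    filter_upwards [h1, h2, ha, hb] with x e1 e2 e3 e4
    show ((a.1 + b.1 : Lsp 1) : R3 → ℂ) x = ((a.2 + b.2 : Lsp 2) : R3 → ℂ) x
    rw [e1, e2]
    simp [e3, e4]
  zero_mem' := by
    simp only [Set.mem_setOf_eq]
    have h1 := Lp.coeFn_zero ℂ 1 (volume : Measure R3)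
    have h2 := Lp.coeFn_zero ℂ 2 (volume : Measure R3)
    filter_upwards [h1, h2] with x e1 e2
    show ((0 : Lsp 1) : R3 → ℂ) x = ((0 : Lsp 2) : R3 → ℂ) x
    rw [e1, e2]
  smul_mem' := by
    intro c a ha
    simp only [Set.mem_setOf_eq] at *
    have h1 := Lp.coeFn_smul c a.1
    have h2 := Lp.coeFn_smul c a.2
    filter_upwards [h1, h2, ha] with x e1 e2 e3
    show ((c • a.1 : Lsp 1) : R3 → ℂ) x = ((c • a.2 : Lsp 2) : R3 → ℂ) x
    rw [e1, e2]
    simp [e3]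

/-- The Banach space `L¹(ℝ³) ∩ L²(ℝ³)`. -/
abbrev L1capL2 : Type := ↥interSub

/-- The subspace of `L² × L^∞` of pairs summing to `0` a.e. (the "diagonal"). -/
def diagSub₀ : Submodule ℂ (Lsp 2 × Lsp ∞) where
  carrier := {f | (fun x => (f.1 : R3 → ℂ) x + (f.2 : R3 → ℂ) x) =ᵐ[volume] 0}
  add_mem' := by
    intro a b ha hb
    simp only [Set.mem_setOf_eq] at *
    have h1 := Lp.coeFn_add a.1 b.1
    have h2 := Lp.coeFn_add a.2 b.2
    filter_upwards [h1, h2, ha, hb] with x e1 e2 e3 e4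
    show ((a.1 + b.1 : Lsp 2) : R3 → ℂ) x + ((a.2 + b.2 : Lsp ∞) : R3 → ℂ) x = 0
    rw [e1, e2]
    have e3' : (a.1 : R3 → ℂ) x + (a.2 : R3 → ℂ) x = 0 := e3
    have e4' : (b.1 : R3 → ℂ) x + (b.2 : R3 → ℂ) x = 0 := e4
    simp only [Pi.add_apply]
    linear_combination e3' + e4'
  zero_mem' := by
    simp only [Set.mem_setOf_eq]
    have h1 := Lp.coeFn_zero ℂ 2 (volume : Measure R3)
    have h2 := Lp.coeFn_zero ℂ ∞ (volume : Measure R3)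
    filter_upwards [h1, h2] with x e1 e2
    show ((0 : Lsp 2) : R3 → ℂ) x + ((0 : Lsp ∞) : R3 → ℂ) x = 0
    rw [e1, e2]; simp
  smul_mem' := by
    intro c a ha
    simp only [Set.mem_setOf_eq] at *
    have h1 := Lp.coeFn_smul c a.1
    have h2 := Lp.coeFn_smul c a.2
    filter_upwards [h1, h2, ha] with x e1 e2 e3
    show ((c • a.1 : Lsp 2) : R3 → ℂ) x + ((c • a.2 : Lsp ∞) : R3 → ℂ) x = 0
    rw [e1, e2]
    have e3' : (a.1 : R3 → ℂ) x + (a.2 : R3 → ℂ) x = 0 := e3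
    simp only [Pi.smul_apply, smul_eq_mul]
    linear_combination c * e3'

/-- The closure of the diagonal (equal to it, since the diagonal is closed). -/
abbrev diagSub : Submodule ℂ (Lsp 2 × Lsp ∞) := diagSub₀.topologicalClosure

instance : IsClosed (diagSub : Set (Lsp 2 × Lsp ∞)) := diagSub₀.isClosed_topologicalClosure

/-- The Banach space `L²(ℝ³) + L^∞(ℝ³)` (with the quotient norm), realized as the quotient of
`L² × L^∞` by the diagonal. -/
abbrev L2plusLinf : Type := (Lsp 2 × Lsp ∞) ⧸ diagSub

/-- The (isometric) inclusion `L¹ ∩ L² ↪ L¹ × L²`. -/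
abbrev inclι : L1capL2 →L[ℂ] (Lsp 1 × Lsp 2) := interSub.subtypeL

/-- `F_H` is the Hartree operator, i.e. convolution against `1/|·|` on `ℝ³`; it is bounded
from `L¹ ∩ L²` to `L² + L^∞` by the Hardy–Littlewood–Sobolev inequality. -/
def IsHartree (FH : L1capL2 →L[ℂ] L2plusLinf) : Prop :=
  ∀ f : L1capL2, ∃ g : Lsp 2 × Lsp ∞,
    (Submodule.Quotient.mk g : L2plusLinf) = FH f ∧
    (fun x => (g.1 : R3 → ℂ) x + (g.2 : R3 → ℂ) x) =ᵐ[volume]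
      (fun x => ∫ y : R3, ((‖x - y‖ : ℂ))⁻¹ * ((f.1.1 : R3 → ℂ) y))

/-- Strong continuity of an operator-valued map on `ℝ₊`. -/
def SCont {E F : Type*} [SeminormedAddCommGroup E] [NormedSpace ℂ E]
    [SeminormedAddCommGroup F] [NormedSpace ℂ F] (χ : ℝ≥0 → (E →L[ℂ] F)) : Prop :=
  ∀ f : E, Continuous fun t => χ t f

/-- The RPA Dyson equation `χ(t) = χ₀(t) + ∫₀ᵗ χ₀(t−s) F_H χ(s) ds` for all `t ≥ 0`
(the integral being a Bochner integral, stated strongly). -/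
def SolvesDyson (FH : L1capL2 →L[ℂ] L2plusLinf)
    (χ₀ χ : ℝ≥0 → (L2plusLinf →L[ℂ] L1capL2)) : Prop :=
  ∀ (t : ℝ≥0) (f : L2plusLinf),
    IntervalIntegrable
      (fun s : ℝ => inclι (χ₀ (t - Real.toNNReal s) (FH (χ (Real.toNNReal s) f))))
      volume 0 (t : ℝ) ∧
    inclι (χ t f) = inclι (χ₀ t f) +
      ∫ s in (0:ℝ)..(t:ℝ), inclι (χ₀ (t - Real.toNNReal s) (FH (χ (Real.toNNReal s) f)))

/-! ### Meromorphic families of operators (Definition 2.7) -/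

section Merom

variable {E F : Type*} [NormedAddCommGroup E] [NormedSpace ℂ E]
  [NormedAddCommGroup F] [NormedSpace ℂ F]

/-- A finite-rank (bounded) operator. -/
def FiniteRankOp (A : E →L[ℂ] F) : Prop := FiniteDimensional ℂ ↥(LinearMap.range (A : E →ₗ[ℂ] F))

/-- `K` is a meromorphic family of operators near `z₀`: near `z₀` it equals a holomorphic
family plus finitely many finite-rank principal parts `K₋ⱼ/(z−z₀)ʲ`. -/
def MeromAt (K : ℂ → (E →L[ℂ] F)) (z₀ : ℂ) : Prop :=
  ∃ (k : ℕ) (c : ℕ → (E →L[ℂ] F)) (K₀ : ℂ → (E →L[ℂ] F)) (U : Set ℂ),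
    IsOpen U ∧ z₀ ∈ U ∧ AnalyticOnNhd ℂ K₀ U ∧ (∀ j, FiniteRankOp (c j)) ∧
    ∀ z ∈ U, z ≠ z₀ → K z = K₀ z + ∑ j ∈ Finset.range k, ((z - z₀) ^ (j + 1))⁻¹ • c j

/-- `K` is a meromorphic family of operators on the open set `D`. -/
def MeromOn (K : ℂ → (E →L[ℂ] F)) (D : Set ℂ) : Prop := ∀ z₀ ∈ D, MeromAt K z₀

/-- `K` has a simple pole at `z₀` with (finite-rank, nonzero) residue `R`. -/
def SimplePoleAt (K : ℂ → (E →L[ℂ] F)) (z₀ : ℂ) (R : E →L[ℂ] F) : Prop :=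
  R ≠ 0 ∧ FiniteRankOp R ∧
  ∃ (K₀ : ℂ → (E →L[ℂ] F)) (U : Set ℂ), IsOpen U ∧ z₀ ∈ U ∧ AnalyticOnNhd ℂ K₀ U ∧
    ∀ z ∈ U, z ≠ z₀ → K z = K₀ z + (z - z₀)⁻¹ • R

/-- `K` has a (simple) pole at `z₀`. -/
def IsPoleAt (K : ℂ → (E →L[ℂ] F)) (z₀ : ℂ) : Prop := ∃ R, SimplePoleAt K z₀ R

open scoped Classical in
/-- The rank of a (simple) pole of `K` at `z₀`: the rank of the residue there
(`0` if there is no simple pole at `z₀`). -/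
noncomputable def poleRank (K : ℂ → (E →L[ℂ] F)) (z₀ : ℂ) : ℕ :=
  if h : ∃ R, SimplePoleAt K z₀ R then Module.finrank ℂ ↥(LinearMap.range (h.choose : E →ₗ[ℂ] F)) else 0

end Merom

/-- The domain `D_Ω = ℂ \ ((−∞,−Ω] ∪ [Ω,∞))`. -/
def DOmega (Ω : ℝ) : Set ℂ := {z : ℂ | z.im ≠ 0 ∨ |z.re| < Ω}
/-! ### Self-adjoint Hamiltonians, encoded through their projection-valued spectral measure -/

open scoped InnerProductSpace

/-- The spectral data of a self-adjoint Hamiltonian `H`: the projection-valued spectral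
measure `A ↦ P^H(A)` together with the diagonal spectral measures
`x ↦ μ_x = ⟪x, P^H(·) x⟫ = ‖P^H(·)x‖²`. -/
structure SpectralData (𝓗 : Type*) [NormedAddCommGroup 𝓗] [InnerProductSpace ℂ 𝓗] where
  proj : Set ℝ → (𝓗 →L[ℂ] 𝓗)
  diag : 𝓗 → MeasureTheory.Measure ℝ
  proj_symm : ∀ A : Set ℝ, MeasurableSet A → ∀ x y : 𝓗, ⟪proj A x, y⟫_ℂ = ⟪x, proj A y⟫_ℂ
  proj_comp : ∀ A B : Set ℝ, MeasurableSet A → MeasurableSet B →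
    proj A ∘L proj B = proj (A ∩ B)
  proj_univ : proj Set.univ = ContinuousLinearMap.id ℂ 𝓗
  diag_apply : ∀ (x : 𝓗) (A : Set ℝ), MeasurableSet A →
    diag x A = (‖proj A x‖₊ : ℝ≥0∞) ^ 2

variable {𝓗 : Type*} [NormedAddCommGroup 𝓗] [InnerProductSpace ℂ 𝓗]

/-- The spectrum `σ(H)` (the support of the spectral measure). -/
def SpectralData.spec (P : SpectralData 𝓗) : Set ℝ :=
  {a | ∀ ε > 0, P.proj (Set.Ioo (a - ε) (a + ε)) ≠ 0}

/-- The essential spectrum `σ_ess(H)` (the points at which every spectral window has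
infinite rank). -/
def SpectralData.essSpec (P : SpectralData 𝓗) : Set ℝ :=
  {a | ∀ ε > 0, ¬ FiniteDimensional ℂ ↥(LinearMap.range (P.proj (Set.Ioo (a - ε) (a + ε)) : 𝓗 →ₗ[ℂ] 𝓗))}

/-- Assumption 1: `E₀` is the ground-state energy of `H`, a simple isolated eigenvalue with
normalized ground state `Ψ₀`. -/
structure IsGroundState (P : SpectralData 𝓗) (E₀ : ℝ) (Ψ₀ : 𝓗) : Prop where
  unit : ‖Ψ₀‖ = 1
  bottom : P.proj (Set.Iio E₀) = 0
  eig : P.proj {E₀} Ψ₀ = Ψ₀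
  simple : LinearMap.range (P.proj {E₀} : 𝓗 →ₗ[ℂ] 𝓗) = Submodule.span ℂ {Ψ₀}
  isolated : ∃ ε > 0, P.proj (Set.Ioo (E₀ - ε) (E₀ + ε)) = P.proj {E₀}
/-- `K` is the Fourier transform `z ↦ ∫₀^∞ χ(t) e^{izt} dt` of the operator-valued function
`χ`, for `Im z > D` (stated strongly, through the isometric inclusion
`ι : L¹∩L² → L¹ × L²`). -/
def IsFourierTransformOf (χ : ℝ≥0 → (L2plusLinf →L[ℂ] L1capL2))
    (K : ℂ → (L2plusLinf →L[ℂ] L1capL2)) (D : ℝ) : Prop :=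
  ∀ z : ℂ, D < z.im → ∀ f : L2plusLinf,
    MeasureTheory.IntegrableOn
      (fun t : ℝ => Complex.exp (Complex.I * z * t) • inclι (χ (Real.toNNReal t) f))
      (Set.Ioi 0) volume ∧
    inclι (K z f) =
      ∫ t in Set.Ioi (0:ℝ), Complex.exp (Complex.I * z * t) • inclι (χ (Real.toNNReal t) f)
/-- `K` is a meromorphic family on `D_Ω` all of whose singularities are simple poles located
in the real interval `(−Ω, Ω)`. -/
def MeromWithSimpleRealPoles (K : ℂ → (L2plusLinf →L[ℂ] L1capL2)) (Ω : ℝ) : Prop :=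
  MeromOn K (DOmega Ω) ∧
  ∀ z₀ ∈ DOmega Ω, ¬ AnalyticAt ℂ K z₀ → IsPoleAt K z₀ ∧ z₀.im = 0 ∧ |z₀.re| < Ω

namespace RPAShift

/-! ### Quadratic resolvents `(1 - z²Q)⁻¹` of positive operators -/

section Resolvent

/-- The quadratic resolvent `(1 - z²Q)⁻¹`. -/
def resolv (Q : 𝓗 →L[ℂ] 𝓗) (z : ℂ) : 𝓗 →L[ℂ] 𝓗 := Ring.inverse (1 - z ^ 2 • Q)

/-- The kernel of `1 - w²Q`. -/
def eigK (Q : 𝓗 →L[ℂ] 𝓗) (w : ℝ) : Submodule ℂ 𝓗 :=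
  LinearMap.ker ((1 - (w : ℂ) ^ 2 • Q : 𝓗 →L[ℂ] 𝓗) : 𝓗 →ₗ[ℂ] 𝓗)

lemma mem_eigK {Q : 𝓗 →L[ℂ] 𝓗} {w : ℝ} {x : 𝓗} : x ∈ eigK Q w ↔ (w : ℂ) ^ 2 • Q x = x := by
  rw [eigK, LinearMap.mem_ker, ContinuousLinearMap.coe_coe, sub_apply, sub_eq_zero, eq_comm]
  rfl

lemma eigK_neg (Q : 𝓗 →L[ℂ] 𝓗) (w : ℝ) : eigK Q (-w) = eigK Q w := by
  ext x; simp [mem_eigK]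

lemma norm_inner_pencil_ge {Q : 𝓗 →L[ℂ] 𝓗} (hQ : Q.IsPositive) (w : ℝ) :
    ∃ c > 0, ∀ ε : ℝ, 0 < ε → ∀ x : 𝓗, ‖x‖ ^ 2 * (c * (ε / (1 + ε ^ 2))) ≤
      ‖⟪(1 - ((w : ℂ) + ε * I) ^ 2 • Q) x, x⟫_ℂ‖ := by
  have key : ∀ (ζ : ℂ) (x : 𝓗), ∃ a : ℝ, 0 ≤ a ∧
      ⟪(1 - ζ • Q) x, x⟫_ℂ = (‖x‖ ^ 2 : ℝ) - (starRingEnd ℂ) ζ * a := by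
    intro ζ x
    have h := hQ.inner_nonneg_left x
    refine ⟨(⟪Q x, x⟫_ℂ).re, (Complex.nonneg_iff.1 h).1, ?_⟩
    have h2 : ⟪Q x, x⟫_ℂ = ((⟪Q x, x⟫_ℂ).re : ℂ) :=
      Complex.ext rfl (by simpa using (Complex.nonneg_iff.1 h).2.symm)
    simp only [sub_apply, one_apply_eq_self, smul_apply, inner_sub_left, inner_smul_left]
    rw [← h2, inner_self_eq_norm_sq_to_K]
    simp
  by_cases hw : w = 0
  · refine ⟨1, one_pos, fun ε hε x => ?_⟩
    obtain ⟨a, ha, h⟩ := key (((w : ℂ) + ε * I) ^ 2) x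
    rw [h, hw]
    have h3 : ((‖x‖ ^ 2 : ℝ) : ℂ) - (starRingEnd ℂ) (((0 : ℝ) + (ε : ℂ) * I) ^ 2) * a =
        ((‖x‖ ^ 2 + ε ^ 2 * a : ℝ) : ℂ) := by
      simp [mul_pow]
    rw [h3, Complex.norm_real, Real.norm_of_nonneg (by positivity)]
    have h4 : ε / (1 + ε ^ 2) ≤ 1 := by
      rw [div_le_one (by positivity)]; nlinarith [sq_nonneg (ε - 1)]
    have h5 : ‖x‖ ^ 2 * (1 * (ε / (1 + ε ^ 2))) ≤ ‖x‖ ^ 2 * 1 := by gcongr; linarith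
    have : 0 ≤ ε ^ 2 * a := by positivity
    linarith
  · refine ⟨2 * |w| / (w ^ 2 + 1), by positivity, fun ε hε x => ?_⟩
    obtain ⟨a, ha, h⟩ := key (((w : ℂ) + ε * I) ^ 2) x
    rw [h]
    set ζ : ℂ := ((w : ℂ) + ε * I) ^ 2 with hζ
    have him : ζ.im = 2 * w * ε := by simp [hζ, pow_two]; ring
    have hnorm : ‖ζ‖ = w ^ 2 + ε ^ 2 := by
      rw [hζ, norm_pow, ← Complex.normSq_eq_norm_sq, Complex.normSq_add_mul_I]
    have hpos : 0 < w ^ 2 + ε ^ 2 := by positivity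
    have h1 : ‖ζ‖ * ‖((‖x‖ ^ 2 : ℝ) : ℂ) - (starRingEnd ℂ) ζ * a‖ ≥ |2 * w * ε| * ‖x‖ ^ 2 := by
      rw [← norm_mul, mul_sub, ← mul_assoc, Complex.mul_conj]
      refine le_trans (le_of_eq ?_) (Complex.abs_im_le_norm _)
      rw [← Complex.ofReal_mul (Complex.normSq ζ) a]
      simp only [sub_im, mul_im, ofReal_re, ofReal_im, him]
      rw [← abs_of_nonneg (sq_nonneg ‖x‖), ← abs_mul]; simp
    rw [hnorm, abs_mul, abs_mul, abs_of_pos hε, abs_two] at h1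
    have h2 : (w ^ 2 + ε ^ 2) ≤ (w ^ 2 + 1) * (1 + ε ^ 2) := by
      nlinarith [mul_nonneg (sq_nonneg w) (sq_nonneg ε)]
    have h3 : ‖x‖ ^ 2 * (2 * |w| / (w ^ 2 + 1) * (ε / (1 + ε ^ 2))) =
       (2 * |w| * ε * ‖x‖ ^ 2) / ((w ^ 2 + 1) * (1 + ε ^ 2)) := by field_simp
    rw [h3, div_le_iff₀ (by positivity)]
    calc _ ≤ _ := h1
      _ ≤ _ := by rw [mul_comm]; gcongr

variable [CompleteSpace 𝓗]

instance (Q : 𝓗 →L[ℂ] 𝓗) (w : ℝ) : CompleteSpace (eigK Q w) :=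
  (ContinuousLinearMap.isClosed_ker (1 - (w : ℂ) ^ 2 • Q : 𝓗 →L[ℂ] 𝓗)).completeSpace_coe

lemma isUnit_pencil {Q : 𝓗 →L[ℂ] 𝓗} (hQ : Q.IsPositive) {z : ℂ} (hz : 0 < z.im) :
    IsUnit (1 - z ^ 2 • Q) := by
  obtain ⟨c, hc, h⟩ := norm_inner_pencil_ge hQ z.re
  have h1 := h z.im hz
  rw [Complex.re_add_im] at h1
  have hc' : 0 < c * (z.im / (1 + z.im ^ 2)) := by positivity
  exact ContinuousLinearMap.isUnit_of_forall_le_norm_inner_map _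
    (c := ⟨c * (z.im / (1 + z.im ^ 2)), hc'.le⟩) hc' h1

lemma pencil_resolv {Q : 𝓗 →L[ℂ] 𝓗} (hQ : Q.IsPositive) {z : ℂ} (hz : 0 < z.im) (x : 𝓗) :
    (1 - z ^ 2 • Q) (resolv Q z x) = x :=
  congrArg (fun T : 𝓗 →L[ℂ] 𝓗 => T x) (Ring.mul_inverse_cancel _ (isUnit_pencil hQ hz))

lemma resolv_pencil {Q : 𝓗 →L[ℂ] 𝓗} (hQ : Q.IsPositive) {z : ℂ} (hz : 0 < z.im) (x : 𝓗) :
    resolv Q z ((1 - z ^ 2 • Q) x) = x :=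
  congrArg (fun T : 𝓗 →L[ℂ] 𝓗 => T x) (Ring.inverse_mul_cancel _ (isUnit_pencil hQ hz))

lemma analyticAt_resolv {Q : 𝓗 →L[ℂ] 𝓗} (hQ : Q.IsPositive) {z : ℂ} (hz : 0 < z.im) :
    AnalyticAt ℂ (resolv Q) z := by
  have h1 : AnalyticAt ℂ (fun z : ℂ => (1 - z ^ 2 • Q : 𝓗 →L[ℂ] 𝓗)) z := by fun_prop
  obtain ⟨u, hu⟩ := isUnit_pencil hQ hz
  have h2 := analyticAt_inverse (𝕜 := ℂ) u
  rw [hu] at h2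
  change AnalyticAt ℂ Ring.inverse ((fun z : ℂ => (1 - z ^ 2 • Q : 𝓗 →L[ℂ] 𝓗)) z) at h2
  exact AnalyticAt.comp (f := fun z : ℂ => (1 - z ^ 2 • Q : 𝓗 →L[ℂ] 𝓗)) h2 h1

/-- Off the real axis, `ε (1 - (w + iε)²Q)⁻¹` is bounded uniformly in `ε`. -/
lemma norm_resolv_le {Q : 𝓗 →L[ℂ] 𝓗} (hQ : Q.IsPositive) (w : ℝ) :
    ∃ C : ℝ, 0 ≤ C ∧ ∀ ε : ℝ, 0 < ε → ε ≤ 1 → ∀ x : 𝓗,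
      ‖((ε : ℂ) * I) • resolv Q (w + ε * I) x‖ ≤ C * ‖x‖ := by
  obtain ⟨c, hc, h⟩ := norm_inner_pencil_ge hQ w
  refine ⟨2 / c, by positivity, fun ε hε hε1 x => ?_⟩
  have hz : 0 < ((w : ℂ) + ε * I).im := by simpa using hε
  set y := resolv Q (w + ε * I) x with hy
  have h1 := h ε hε y
  rw [pencil_resolv hQ hz] at h1
  have h2 : ‖y‖ ^ 2 * (c * (ε / (1 + ε ^ 2))) ≤ ‖x‖ * ‖y‖ := h1.trans (norm_inner_le_norm _ _)
  rw [norm_smul, norm_mul, Complex.norm_I, mul_one, Complex.norm_real, Real.norm_of_nonneg hε.le]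
  rcases eq_or_ne y 0 with h0 | h0
  · rw [h0]; simp; positivity
  have hy0 : 0 < ‖y‖ := norm_pos_iff.2 h0
  have h3 : ‖y‖ * (c * (ε / (1 + ε ^ 2))) ≤ ‖x‖ := by
    refine le_of_mul_le_mul_left ?_ hy0
    nlinarith
  have h4 : ε / 2 ≤ ε / (1 + ε ^ 2) := by gcongr; nlinarith
  have h5 : ‖y‖ * (c * (ε / 2)) ≤ ‖x‖ := le_trans (by gcongr) h3
  calc ε * ‖y‖ = 2 / c * (‖y‖ * (c * (ε / 2))) := by field_simp
    _ ≤ _ := by gcongr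

/-- Strong limit of the rescaled quadratic resolvent at a real point. -/
lemma tendsto_resolv {Q : 𝓗 →L[ℂ] 𝓗} (hQ : Q.IsPositive) (w : ℝ) (x : 𝓗) :
    Filter.Tendsto (fun ε : ℝ => ((ε : ℂ) * I) • resolv Q (w + ε * I) x) (nhdsWithin 0 (Set.Ioi 0))
      (nhds ((-(w : ℂ) / 2) • (eigK Q w).starProjection x)) := by
  obtain ⟨C, hC, hb⟩ := norm_resolv_le hQ w
  have hsmall : ∀ᶠ ε : ℝ in nhdsWithin 0 (Set.Ioi 0), 0 < ε ∧ ε ≤ 1 := by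
    filter_upwards [Ioo_mem_nhdsGT (zero_lt_one' ℝ)] with ε h using ⟨h.1, h.2.le⟩
  have hid : Filter.Tendsto (fun ε : ℝ => (ε : ℂ)) (nhdsWithin 0 (Set.Ioi 0)) (nhds 0) := by
    have := (Complex.continuous_ofReal.tendsto (0 : ℝ)).mono_left
        (nhdsWithin_le_nhds (s := Set.Ioi 0))
    simpa using this
  -- vectors in the kernel
  have hker : ∀ k ∈ eigK Q w, Filter.Tendsto
      (fun ε : ℝ => ((ε : ℂ) * I) • resolv Q (w + ε * I) k) (nhdsWithin 0 (Set.Ioi 0))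
      (nhds ((-(w : ℂ) / 2) • k)) := by
    intro k hk
    rw [mem_eigK] at hk
    rcases eq_or_ne w 0 with hw | hw
    · have : k = 0 := by simpa [hw] using hk.symm
      simp [this]
    have hw' : (w : ℂ) ≠ 0 := by exact_mod_cast hw
    have h1 : Filter.Tendsto (fun ε : ℝ => (-(w : ℂ) ^ 2 / (2 * w + ε * I)) • k)
        (nhdsWithin 0 (Set.Ioi 0)) (nhds ((-(w : ℂ) ^ 2 / (2 * w + 0 * I)) • k)) := by
      refine Filter.Tendsto.smul_const (Filter.Tendsto.div tendsto_const_nhds ?_ (by simpa)) k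
      exact tendsto_const_nhds.add (hid.mul_const I)
    have h2 : (-(w : ℂ) ^ 2 / (2 * w + 0 * I)) = -(w : ℂ) / 2 := by field_simp; ring
    rw [h2] at h1
    refine h1.congr' ?_
    filter_upwards [hsmall] with ε hε
    have hz : 0 < ((w : ℂ) + ε * I).im := by simpa using hε.1
    have hε0 : (ε : ℂ) ≠ 0 := by exact_mod_cast hε.1.ne'
    have hne : (2 * (w : ℂ) + ε * I) ≠ 0 := by
      intro h0
      have := congrArg Complex.im h0
      simp at this; exact hε.1.ne' this
    have h3 : resolv Q (w + ε * I) k = (-(w : ℂ) ^ 2 / ((2 * w + ε * I) * (ε * I))) • k := by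
      have h4 : (1 - ((w : ℂ) + ε * I) ^ 2 • Q) ((-(w : ℂ) ^ 2 / ((2 * w + ε * I) * (ε * I))) • k) =
          k := by
        have hQk : Q k = ((w : ℂ) ^ 2)⁻¹ • k := by
          rw [eq_inv_smul_iff₀ (by positivity)]; exact hk
        have hI : I ≠ 0 := Complex.I_ne_zero
        simp only [sub_apply, one_apply_eq_self, smul_apply, map_smul, hQk, smul_smul]
        rw [(by rw [sub_smul, one_smul] : k - (((w : ℂ) + ε * I) ^ 2 * ((w : ℂ) ^ 2)⁻¹) • k =
          (1 - ((w : ℂ) + ε * I) ^ 2 * ((w : ℂ) ^ 2)⁻¹) • k), smul_smul]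
        have h6 : 1 - ((w : ℂ) + ε * I) ^ 2 * ((w : ℂ) ^ 2)⁻¹ =
            -((2 * w + ε * I) * (ε * I)) / (w : ℂ) ^ 2 := by
          field_simp
          ring
        convert one_smul ℂ k using 2
        rw [h6, div_mul_div_comm, div_eq_one_iff_eq
          (mul_ne_zero (mul_ne_zero hne (mul_ne_zero hε0 hI)) (by positivity))]
        ring
      rw [← h4, resolv_pencil hQ hz, h4]
    rw [h3, smul_smul]
    congr 1
    have hI : I ≠ 0 := Complex.I_ne_zero
    field_simp
  -- vectors in the range
  have hran : ∀ v : 𝓗, Filter.Tendsto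
      (fun ε : ℝ => ((ε : ℂ) * I) • resolv Q (w + ε * I) ((1 - (w : ℂ) ^ 2 • Q) v))
      (nhdsWithin 0 (Set.Ioi 0)) (nhds 0) := by
    intro v
    have h1 : Filter.Tendsto (fun ε : ℝ => ε * ‖v‖ + ‖((w : ℂ) + ε * I) ^ 2 - (w : ℂ) ^ 2‖ *
        (C * ‖Q v‖)) (nhdsWithin 0 (Set.Ioi 0)) (nhds 0) := by
      have : Continuous (fun ε : ℝ => ε * ‖v‖ + ‖((w : ℂ) + ε * I) ^ 2 - (w : ℂ) ^ 2‖ *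
        (C * ‖Q v‖)) := by fun_prop
      have h := (this.tendsto 0).mono_left (nhdsWithin_le_nhds (s := Set.Ioi 0))
      simpa using h
    refine squeeze_zero_norm' ?_ h1
    filter_upwards [hsmall] with ε hε
    have hz : 0 < ((w : ℂ) + ε * I).im := by simpa using hε.1
    have h2 : (1 - (w : ℂ) ^ 2 • Q) v = (1 - ((w : ℂ) + ε * I) ^ 2 • Q) v +
        (((w : ℂ) + ε * I) ^ 2 - (w : ℂ) ^ 2) • Q v := by
      simp only [sub_apply, one_apply_eq_self, smul_apply, sub_smul]; abel
    rw [h2, map_add, resolv_pencil hQ hz, smul_add, map_smul, smul_comm _ _ (resolv Q _ _)]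
    refine (norm_add_le _ _).trans (add_le_add ?_ ?_)
    · rw [norm_smul, norm_mul, Complex.norm_I, mul_one, Complex.norm_real,
        Real.norm_of_nonneg hε.1.le]
    · rw [norm_smul]
      gcongr
      exact hb ε hε.1 hε.2 _
  -- vectors in the closure of the range
  have hcl : ∀ y ∈ (eigK Q w)ᗮ, Filter.Tendsto
      (fun ε : ℝ => ((ε : ℂ) * I) • resolv Q (w + ε * I) y)
      (nhdsWithin 0 (Set.Ioi 0)) (nhds 0) := by
    intro y hy
    have hsa : IsSelfAdjoint (1 - (w : ℂ) ^ 2 • Q) := by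
      refine (IsSelfAdjoint.one _).sub ?_
      refine IsSelfAdjoint.smul ?_ hQ.isSelfAdjoint
      simp [IsSelfAdjoint]
    rw [eigK, ContinuousLinearMap.orthogonal_ker, hsa.adjoint_eq] at hy
    rw [Metric.tendsto_nhds]
    intro δ hδ
    obtain ⟨u, ⟨v, hv⟩, hu⟩ := Metric.mem_closure_iff.1 hy (δ / (2 * (C + 1))) (by positivity)
    have h1 := (Metric.tendsto_nhds.1 (hran v)) (δ / 2) (by positivity)
    filter_upwards [hsmall, h1] with ε hε h2
    rw [dist_zero_right] at h2 ⊢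
    have hv' : (1 - (w : ℂ) ^ 2 • Q) v = u := hv
    rw [hv'] at h2
    have h3 := hb ε hε.1 hε.2 (y - u)
    rw [map_sub, smul_sub] at h3
    rw [dist_eq_norm] at hu
    have h4 : C * ‖y - u‖ ≤ δ / 2 := by
      have : (C + 1) * ‖y - u‖ ≤ δ / 2 := by
        rw [lt_div_iff₀ (by positivity)] at hu; linarith
      nlinarith [norm_nonneg (y - u)]
    have h5 := norm_add_le ((((ε : ℂ) * I) • resolv Q (w + ε * I) y) -
      ((ε : ℂ) * I) • resolv Q (w + ε * I) u) (((ε : ℂ) * I) • resolv Q (w + ε * I) u)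
    rw [sub_add_cancel] at h5
    linarith
  have hsplit : x = (eigK Q w).starProjection x + (x - (eigK Q w).starProjection x) := by abel
  have h1 := (hker _ ((eigK Q w).starProjection_apply_mem x)).add
    (hcl _ ((eigK Q w).sub_starProjection_mem_orthogonal x))
  rw [add_zero] at h1
  refine h1.congr fun ε => ?_
  rw [← smul_add, ← map_add, ← hsplit]

end Resolvent

end RPAShift

namespace RPAShift

/-! ### Residues of quadratic resolvents -/

section Residue

variable [CompleteSpace 𝓗] {E F : Type*} [NormedAddCommGroup E] [NormedSpace ℂ E]
  [NormedAddCommGroup F] [NormedSpace ℂ F]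

/-- The part of `ker (1 - w²Q)` which is reached from `E` through `W`. -/
def visSpace (Q : 𝓗 →L[ℂ] 𝓗) (W : E →L[ℂ] 𝓗) (w : ℝ) : Submodule ℂ 𝓗 :=
  LinearMap.range (((eigK Q w).starProjection ∘L W : E →L[ℂ] 𝓗) : E →ₗ[ℂ] 𝓗)

lemma visSpace_neg (Q : 𝓗 →L[ℂ] 𝓗) (W : E →L[ℂ] 𝓗) (w : ℝ) :
    visSpace Q W (-w) = visSpace Q W w := by
  have h : ∀ K K' : Submodule ℂ 𝓗, K = K' → ∀ [CompleteSpace K] [CompleteSpace K'],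
      K.starProjection = K'.starProjection := by rintro K _ rfl _ _; rfl
  rw [visSpace, visSpace, h _ _ (eigK_neg Q w)]

/-- The response function `z ↦ -2 W'(1 - z²Q)⁻¹W` on the upper half-plane. -/
def IsResponse (K : ℂ → (E →L[ℂ] F)) (W' : 𝓗 →L[ℂ] F) (Q : 𝓗 →L[ℂ] 𝓗) (W : E →L[ℂ] 𝓗) : Prop :=
  ∀ z : ℂ, 0 < z.im → K z = (-2 : ℂ) • (W' ∘L resolv Q z ∘L W)

variable {K : ℂ → (E →L[ℂ] F)} {W' : 𝓗 →L[ℂ] F} {Q : 𝓗 →L[ℂ] 𝓗} {W : E →L[ℂ] 𝓗}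

lemma residue_eq (hQ : Q.IsPositive) (hK : IsResponse K W' Q W) {w : ℝ} {R : E →L[ℂ] F}
    {K₀ : ℂ → (E →L[ℂ] F)} (hK₀ : ContinuousAt K₀ w)
    (h : ∀ᶠ z in nhdsWithin (w : ℂ) {(w : ℂ)}ᶜ, K z = K₀ z + (z - w)⁻¹ • R) :
    R = (w : ℂ) • (W' ∘L (eigK Q w).starProjection ∘L W) := by
  have hline : Filter.Tendsto (fun ε : ℝ => (w : ℂ) + ε * I) (nhdsWithin 0 (Set.Ioi 0))
      (nhds (w : ℂ)) := by
    have hc : Continuous (fun ε : ℝ => (w : ℂ) + ε * I) := by fun_prop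
    have := (hc.tendsto 0).mono_left (nhdsWithin_le_nhds (s := Set.Ioi 0))
    simpa using this
  have hline' : Filter.Tendsto (fun ε : ℝ => (w : ℂ) + ε * I) (nhdsWithin 0 (Set.Ioi 0))
      (nhdsWithin (w : ℂ) {(w : ℂ)}ᶜ) := by
    refine tendsto_nhdsWithin_iff.2 ⟨hline, ?_⟩
    filter_upwards [self_mem_nhdsWithin] with ε hε
    simp [(Set.mem_Ioi.1 hε).ne']
  ext f
  have h1 : Filter.Tendsto (fun ε : ℝ => ((ε : ℂ) * I) • K (w + ε * I) f)
      (nhdsWithin 0 (Set.Ioi 0)) (nhds (R f)) := by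
    have h2 : Filter.Tendsto (fun ε : ℝ => ((ε : ℂ) * I) • K₀ (w + ε * I) f + R f)
        (nhdsWithin 0 (Set.Ioi 0)) (nhds (((0 : ℝ) * I) • K₀ w f + R f)) := by
      refine Filter.Tendsto.add (Filter.Tendsto.smul ?_ ?_) tendsto_const_nhds
      · have hc : Continuous (fun ε : ℝ => (ε : ℂ) * I) := by fun_prop
        exact (hc.tendsto 0).mono_left nhdsWithin_le_nhds
      · exact ((ContinuousLinearMap.apply ℂ F f).continuous.tendsto _).comp (hK₀.tendsto.comp hline)
    simp only [Complex.ofReal_zero, zero_mul, zero_smul, zero_add] at h2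
    refine h2.congr' ?_
    filter_upwards [hline'.eventually h, self_mem_nhdsWithin] with ε hε hpos
    have hne : (ε : ℂ) * I ≠ 0 :=
      mul_ne_zero (by exact_mod_cast (Set.mem_Ioi.1 hpos).ne') Complex.I_ne_zero
    rw [hε, add_sub_cancel_left, add_apply, smul_apply, smul_add, smul_smul, mul_inv_cancel₀ hne,
      one_smul]
  have h3 : Filter.Tendsto (fun ε : ℝ => ((ε : ℂ) * I) • K (w + ε * I) f)
      (nhdsWithin 0 (Set.Ioi 0))
      (nhds ((-2 : ℂ) • W' ((-(w : ℂ) / 2) • (eigK Q w).starProjection (W f)))) := by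
    refine (((W'.continuous.tendsto _).comp (tendsto_resolv hQ w (W f))).const_smul (-2 : ℂ)).congr'
      ?_
    filter_upwards [self_mem_nhdsWithin] with ε hpos
    have hz : 0 < ((w : ℂ) + ε * I).im := by simpa using hpos
    rw [hK _ hz]
    simp only [Function.comp, map_smul, smul_apply, ContinuousLinearMap.comp_apply]
    rw [smul_comm]
  have h4 := tendsto_nhds_unique h1 h3
  rw [h4, map_smul, smul_smul]
  simp only [smul_apply, ContinuousLinearMap.comp_apply]
  congr 1
  ring

lemma finrank_range_eq_visSpace (hvis : ∀ x, W' x = 0 → ∀ f, ⟪W f, x⟫_ℂ = 0) {w : ℝ} (hw : w ≠ 0) :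
    Module.finrank ℂ ↥(LinearMap.range
      (((w : ℂ) • (W' ∘L (eigK Q w).starProjection ∘L W) : E →L[ℂ] F) : E →ₗ[ℂ] F)) =
      Module.finrank ℂ (visSpace Q W w) ∧
    (FiniteRankOp ((w : ℂ) • (W' ∘L (eigK Q w).starProjection ∘L W) : E →L[ℂ] F) →
      FiniteDimensional ℂ (visSpace Q W w)) := by
  have hw' : (w : ℂ) ≠ 0 := by exact_mod_cast hw
  set T : 𝓗 →ₗ[ℂ] F := (((w : ℂ) • W' : 𝓗 →L[ℂ] F) : 𝓗 →ₗ[ℂ] F) with hT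
  have hmap : LinearMap.range
      (((w : ℂ) • (W' ∘L (eigK Q w).starProjection ∘L W) : E →L[ℂ] F) : E →ₗ[ℂ] F) =
      (visSpace Q W w).map T := by
    rw [visSpace, ← LinearMap.range_comp]
    rfl
  have hinj : Set.InjOn T (visSpace Q W w) := by
    refine LinearMap.injOn_of_disjoint_ker (s := visSpace Q W w) (p := visSpace Q W w) le_rfl ?_
    rw [Submodule.disjoint_def]
    rintro x ⟨f, rfl⟩ hx
    have h0 : (w : ℂ) • W' ((eigK Q w).starProjection (W f)) = 0 := hx
    have h1 := hvis _ ((smul_eq_zero_iff_right hw').1 h0) f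
    have h2 := (eigK Q w).inner_starProjection_left_eq_right (W f) ((eigK Q w).starProjection (W f))
    rw [Submodule.starProjection_eq_self_iff.2 ((eigK Q w).starProjection_apply_mem _), h1] at h2
    exact inner_self_eq_zero.1 h2
  have e : visSpace Q W w ≃ₗ[ℂ] (visSpace Q W w).map T :=
    (LinearEquiv.ofInjective (T.domRestrict (visSpace Q W w)) fun a b hab =>
      Subtype.ext (hinj a.2 b.2 hab)).trans
      (LinearEquiv.ofEq _ _ (by rw [LinearMap.domRestrict, LinearMap.range_comp,
        Submodule.range_subtype]))
  refine ⟨?_, fun h => ?_⟩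
  · rw [hmap, e.finrank_eq]
  · have h' : FiniteDimensional ℂ ((visSpace Q W w).map T) := by
      rw [← hmap]; exact h
    exact Module.Finite.equiv e.symm

lemma simplePoleAt_residue_eq (hQ : Q.IsPositive) (hK : IsResponse K W' Q W) {w : ℝ}
    {R : E →L[ℂ] F} (h : SimplePoleAt K w R) :
    R = (w : ℂ) • (W' ∘L (eigK Q w).starProjection ∘L W) := by
  obtain ⟨-, -, K₀, U, hU, hwU, hK₀, h⟩ := h
  refine residue_eq hQ hK (hK₀ w hwU).continuousAt ?_
  filter_upwards [self_mem_nhdsWithin, mem_nhdsWithin_of_mem_nhds (hU.mem_nhds hwU)] with z hz hzU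
  exact h z hzU hz

lemma not_isPoleAt_zero (hQ : Q.IsPositive) (hK : IsResponse K W' Q W) : ¬ IsPoleAt K 0 := by
  rintro ⟨R, hR⟩
  refine hR.1 ?_
  have hR' : SimplePoleAt K ((0 : ℝ) : ℂ) R := by simpa using hR
  simpa using simplePoleAt_residue_eq hQ hK hR'

lemma poleRank_eq_finrank (hQ : Q.IsPositive) (hK : IsResponse K W' Q W)
    (hvis : ∀ x, W' x = 0 → ∀ f, ⟪W f, x⟫_ℂ = 0) {w : ℝ} (hw : w ≠ 0)
    (h : AnalyticAt ℂ K w ∨ IsPoleAt K w) :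
    poleRank K w = Module.finrank ℂ (visSpace Q W w) ∧
      FiniteDimensional ℂ (visSpace Q W w) := by
  obtain ⟨h1, h2⟩ := finrank_range_eq_visSpace (Q := Q) hvis hw
  by_cases hp : ∃ R, SimplePoleAt K w R
  · have hR := simplePoleAt_residue_eq hQ hK hp.choose_spec
    have hfin := hp.choose_spec.2.1
    rw [poleRank, dif_pos hp]
    rw [hR] at hfin ⊢
    exact ⟨h1, h2 hfin⟩
  · have han : AnalyticAt ℂ K w := h.resolve_right hp
    have h0 := residue_eq (w := w) (R := 0) hQ hK han.continuousAt (by simp)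
    have hbot : LinearMap.range ((0 : E →L[ℂ] F) : E →ₗ[ℂ] F) = ⊥ := LinearMap.range_zero
    have hfin : FiniteRankOp (0 : E →L[ℂ] F) := by
      rw [FiniteRankOp, hbot]; infer_instance
    rw [poleRank, dif_neg hp, ← h1, ← h0, hbot, finrank_bot]
    exact ⟨rfl, h2 (h0 ▸ hfin)⟩

end Residue

end RPAShift

namespace RPAShift

/-! ### Comparison of visible eigenspaces -/

section Counting

/-- Eigenvectors of a symmetric operator for distinct eigenvalues are orthogonal. -/
lemma inner_eq_zero_of_mem_eigK {Q : 𝓗 →L[ℂ] 𝓗} (hQ : (Q : 𝓗 →ₗ[ℂ] 𝓗).IsSymmetric)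
    {w w' : ℝ} (hw : 0 < w) (hw' : 0 < w') (hne : w ≠ w') {x y : 𝓗} (hx : x ∈ eigK Q w)
    (hy : y ∈ eigK Q w') : ⟪x, y⟫_ℂ = 0 := by
  rw [mem_eigK] at hx hy
  have h1 : ⟪Q x, y⟫_ℂ = ⟪x, Q y⟫_ℂ := hQ x y
  have h2 : ⟪x, y⟫_ℂ = (w : ℂ) ^ 2 * ⟪Q x, y⟫_ℂ := by
    conv_lhs => rw [← hx]
    rw [inner_smul_left]; simp
  have h3 : ⟪x, y⟫_ℂ = (w' : ℂ) ^ 2 * ⟪x, Q y⟫_ℂ := by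
    conv_lhs => rw [← hy]
    rw [inner_smul_right]
  have h4 : ((w : ℂ) ^ 2 - (w' : ℂ) ^ 2) * ⟪Q x, y⟫_ℂ = 0 := by
    rw [sub_mul, ← h2, h1, ← h3, sub_self]
  have h5 : ((w : ℂ) ^ 2 - (w' : ℂ) ^ 2) ≠ 0 := by
    have : w ^ 2 - w' ^ 2 ≠ 0 := by
      rw [sq_sub_sq]
      exact mul_ne_zero (by positivity) (sub_ne_zero.2 hne)
    exact_mod_cast this
  rw [h2, (mul_eq_zero.1 h4).resolve_left h5, mul_zero]

lemma inner_starProjection_of_mem {K : Submodule ℂ 𝓗} [K.HasOrthogonalProjection] {x y : 𝓗}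
    (hy : y ∈ K) : ⟪K.starProjection x, y⟫_ℂ = ⟪x, y⟫_ℂ := by
  rw [K.inner_starProjection_left_eq_right, Submodule.starProjection_eq_self_iff.2 hy]

lemma norm_sq_sum_of_orthogonal {ι : Type*} [Fintype ι] (u : ι → 𝓗) (c : ι → ℂ)
    (h : ∀ i j, i ≠ j → ⟪u i, u j⟫_ℂ = 0) :
    ⟪∑ i, c i • u i, ∑ i, u i⟫_ℂ = ∑ i, (starRingEnd ℂ) (c i) * ((‖u i‖ ^ 2 : ℝ) : ℂ) := by
  rw [sum_inner]
  refine Finset.sum_congr rfl fun i _ => ?_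
  rw [inner_sum, Finset.sum_eq_single i, inner_smul_left, inner_self_eq_norm_sq_to_K]
  · simp
  · intro j _ hj
    rw [inner_smul_left, h i j hj.symm, mul_zero]
  · simp

variable {E : Type*} [NormedAddCommGroup E] [NormedSpace ℂ E]
variable {D A r b : 𝓗 →L[ℂ] 𝓗} {S : E →L[ℂ] 𝓗} {M : 𝓗 →L[ℂ] E}

/-- The part of an eigenspace of `D` which is invisible from `r S` is unaffected by the
perturbation. -/
lemma invisible_eigenvector (hr : (r : 𝓗 →ₗ[ℂ] 𝓗).IsSymmetric) (hA : (A : 𝓗 →ₗ[ℂ] 𝓗).IsSymmetric)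
    (hAS : A = S ∘L M) (hb : b.IsPositive) (hbB : ∀ x, b (b (x + (2 : ℂ) • r (A (r x)))) = x)
    {w : ℝ} {η : 𝓗} (hη : η ∈ eigK D w) (hvis : ∀ f, ⟪r (S f), η⟫_ℂ = 0) :
    b η = η ∧ η ∈ eigK (b ∘L D ∘L b) w := by
  have h0 : r (A (r η)) = 0 := by
    refine ext_inner_right ℂ fun y => ?_
    have h1 : ⟪r (A (r η)), y⟫_ℂ = ⟪η, r (A (r y))⟫_ℂ := by
      rw [show ⟪r (A (r η)), y⟫_ℂ = ⟪A (r η), r y⟫_ℂ from hr _ _,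
        show ⟪A (r η), r y⟫_ℂ = ⟪r η, A (r y)⟫_ℂ from hA _ _]
      exact hr _ _
    rw [h1, inner_zero_left, ← inner_conj_symm, hAS]
    simp only [ContinuousLinearMap.comp_apply]
    rw [hvis, map_zero]
  have h1 : b (b η) = η := by simpa [h0] using hbB η
  have h2 : b η = η := by
    have h3 : b (b η - η) = -(b η - η) := by rw [map_sub, h1]; abel
    have h4 := hb.inner_nonneg_left (b η - η)
    rw [h3, inner_neg_left, inner_self_eq_norm_sq_to_K] at h4
    have h5 := (Complex.nonneg_iff.1 h4).1
    have h6 : ‖b η - η‖ ^ 2 ≤ 0 := by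
      have h7 : (-(((‖b η - η‖ : ℝ) : ℂ)) ^ 2).re = - ‖b η - η‖ ^ 2 := by
        rw [← Complex.ofReal_pow, ← Complex.ofReal_neg, Complex.ofReal_re]
      have h8 : (0 : ℝ) ≤ (-(((‖b η - η‖ : ℝ) : ℂ)) ^ 2).re := h5
      linarith
    have h7 : ‖b η - η‖ = 0 := by
      have := sq_nonneg ‖b η - η‖
      exact pow_eq_zero_iff (two_ne_zero) |>.1 (le_antisymm h6 this)
    exact sub_eq_zero.1 (norm_eq_zero.1 h7)
  refine ⟨h2, ?_⟩
  rw [mem_eigK] at hη ⊢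
  simp only [ContinuousLinearMap.comp_apply]
  rw [h2, ← map_smul, hη, h2]

variable [CompleteSpace 𝓗]

lemma visSpace_le_eigK (Q : 𝓗 →L[ℂ] 𝓗) (W : E →L[ℂ] 𝓗) (w : ℝ) : visSpace Q W w ≤ eigK Q w := by
  rintro _ ⟨f, rfl⟩
  exact (eigK Q w).starProjection_apply_mem _

/-- The projections of `b ψ`, `ψ` visible for the perturbed operator, are visible for the
unperturbed operator. -/
lemma starProjection_mem_visSpace (hr : (r : 𝓗 →ₗ[ℂ] 𝓗).IsSymmetric)
    (hD : (D : 𝓗 →ₗ[ℂ] 𝓗).IsSymmetric)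
    (hA : (A : 𝓗 →ₗ[ℂ] 𝓗).IsSymmetric)
    (hAS : A = S ∘L M) (hb : b.IsPositive) (hbB : ∀ x, b (b (x + (2 : ℂ) • r (A (r x)))) = x)
    {w w' : ℝ} (hw : 0 < w) (hw' : 0 < w') [FiniteDimensional ℂ (visSpace D (r ∘L S) w')] {ψ : 𝓗}
    (hψ : ψ ∈ visSpace (b ∘L D ∘L b) (b ∘L r ∘L S) w) :
    (eigK D w').starProjection (b ψ) ∈ visSpace D (r ∘L S) w' := by
  have hbs : ∀ x y, ⟪b x, y⟫_ℂ = ⟪x, b y⟫_ℂ := hb.isSymmetric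
  set N := visSpace D (r ∘L S) w'
  set x := (eigK D w').starProjection (b ψ) with hx
  set η := x - N.starProjection x with hη
  have hηN : η ∈ Nᗮ := N.sub_starProjection_mem_orthogonal x
  have hηE : η ∈ eigK D w' :=
    Submodule.sub_mem _ ((eigK D w').starProjection_apply_mem _)
      (visSpace_le_eigK D (r ∘L S) w' (N.starProjection_apply_mem _))
  have hvis : ∀ f, ⟪r (S f), η⟫_ℂ = 0 := by
    intro f
    have h1 : (eigK D w').starProjection (r (S f)) ∈ N := ⟨f, rfl⟩
    rw [← inner_starProjection_of_mem hηE]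
    exact (Submodule.mem_orthogonal _ _).1 hηN _ h1
  obtain ⟨h1, h2⟩ := invisible_eigenvector hr hA hAS hb hbB hηE hvis
  have h3 : ⟪ψ, η⟫_ℂ = 0 := by
    by_cases hww : w = w'
    · subst hww
      obtain ⟨f, rfl⟩ := hψ
      have h4 : ⟪(eigK (b ∘L D ∘L b) w).starProjection (b (r (S f))), η⟫_ℂ = 0 := by
        rw [inner_starProjection_of_mem h2, hbs, h1]
        exact hvis f
      exact h4
    · refine inner_eq_zero_of_mem_eigK (Q := b ∘L D ∘L b) ?_ hw hw' hww
        (visSpace_le_eigK _ _ _ hψ) h2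
      intro x y
      have h4 : ⟪b (D (b x)), y⟫_ℂ = ⟪x, b (D (b y))⟫_ℂ := by
        rw [hbs, show ⟪D (b x), b y⟫_ℂ = ⟪b x, D (b y)⟫_ℂ from hD _ _, hbs]
      exact h4
  have h4 : ⟪x, η⟫_ℂ = 0 := by
    rw [hx, inner_starProjection_of_mem hηE, hbs, h1, h3]
  have h5 : ⟪η, η⟫_ℂ = 0 := by
    conv_lhs => rw [hη]
    rw [inner_sub_left, h4,
      (Submodule.mem_orthogonal _ _).1 hηN _ (N.starProjection_apply_mem x), sub_zero]
  have h6 : x = N.starProjection x := sub_eq_zero.1 (inner_self_eq_zero.1 h5)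
  rw [h6]
  exact N.starProjection_apply_mem x

lemma sum_finrank_visSpace_le (hr : (r : 𝓗 →ₗ[ℂ] 𝓗).IsSymmetric)
    (hD : (D : 𝓗 →ₗ[ℂ] 𝓗).IsSymmetric) (hA : A.IsPositive)
    (hAS : A = S ∘L M) (hb : b.IsPositive) (hbB : ∀ x, b (b (x + (2 : ℂ) • r (A (r x)))) = x)
    (hBb : ∀ x, b (b x + (2 : ℂ) • r (A (r (b x)))) = x)
    {ω : ℝ} (s T : Finset ℝ) (hs : ∀ w ∈ s, 0 < w ∧ w < ω) (hT : ∀ w ∈ T, 0 < w)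
    (hfin1 : ∀ w ∈ s, FiniteDimensional ℂ (visSpace (b ∘L D ∘L b) (b ∘L r ∘L S) w))
    (hfin0 : ∀ w ∈ T, FiniteDimensional ℂ (visSpace D (r ∘L S) w))
    (hgap : ∀ ξ, (∀ w ∈ T, (eigK D w).starProjection ξ = 0) →
      (⟪D ξ, ξ⟫_ℂ).re ≤ (ω ^ 2)⁻¹ * ‖ξ‖ ^ 2) :
    ∑ w ∈ s, Module.finrank ℂ (visSpace (b ∘L D ∘L b) (b ∘L r ∘L S) w) ≤
      ∑ w ∈ T, Module.finrank ℂ (visSpace D (r ∘L S) w) := by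
  have hbs : ∀ x y, ⟪b x, y⟫_ℂ = ⟪x, b y⟫_ℂ := hb.isSymmetric
  set N1 : s → Submodule ℂ 𝓗 := fun w => visSpace (b ∘L D ∘L b) (b ∘L r ∘L S) w with hN1
  set N0 : T → Submodule ℂ 𝓗 := fun w => visSpace D (r ∘L S) w with hN0
  have i1 : ∀ w, FiniteDimensional ℂ (N1 w) := fun w => hfin1 w w.2
  have i0 : ∀ w, FiniteDimensional ℂ (N0 w) := fun w => hfin0 w w.2
  rw [← Finset.sum_coe_sort s, ← Finset.sum_coe_sort T]
  change ∑ w, Module.finrank ℂ (N1 w) ≤ ∑ w, Module.finrank ℂ (N0 w)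
  rw [← Module.finrank_pi_fintype, ← Module.finrank_pi_fintype]
  set J : (∀ w, N1 w) →ₗ[ℂ] 𝓗 := ∑ w, (N1 w).subtype ∘ₗ LinearMap.proj w with hJ
  have hJ_apply : ∀ ψ, J ψ = ∑ w, (ψ w : 𝓗) := by
    intro ψ; simp [hJ]
  have hmem : ∀ (w' : T) (ψ : ∀ w, N1 w),
      (((eigK D w').starProjection ∘L b : 𝓗 →L[ℂ] 𝓗) : 𝓗 →ₗ[ℂ] 𝓗) (J ψ) ∈ N0 w' := by
    intro w' ψ
    rw [hJ_apply, map_sum]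
    refine Submodule.sum_mem _ fun w _ => ?_
    have := i0 w'
    exact starProjection_mem_visSpace hr hD hA.isSymmetric hAS hb hbB (hs w w.2).1 (hT w' w'.2)
      (ψ w).2
  let Λ : (∀ w, N1 w) →ₗ[ℂ] (∀ w, N0 w) := LinearMap.pi fun w' =>
    LinearMap.codRestrict (N0 w')
      ((((eigK D w').starProjection ∘L b : 𝓗 →L[ℂ] 𝓗) : 𝓗 →ₗ[ℂ] 𝓗) ∘ₗ J) (hmem w')
  refine LinearMap.finrank_le_finrank_of_injective (f := Λ) ?_
  rw [← LinearMap.ker_eq_bot, LinearMap.ker_eq_bot']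
  intro ψ hψ
  have hproj : ∀ w ∈ T, (eigK D w).starProjection (b (J ψ)) = 0 := by
    intro w hw
    have := congrArg Subtype.val (congrFun hψ ⟨w, hw⟩)
    exact this
  have h1 := hgap _ hproj
  have horth : ∀ i j, i ≠ j → ⟪(ψ i : 𝓗), (ψ j : 𝓗)⟫_ℂ = 0 := by
    intro i j hij
    refine inner_eq_zero_of_mem_eigK (Q := b ∘L D ∘L b) ?_ (hs i i.2).1 (hs j j.2).1
      (fun h => hij (Subtype.ext h)) (visSpace_le_eigK _ _ _ (ψ i).2)
        (visSpace_le_eigK _ _ _ (ψ j).2)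
    intro x y
    have h4 : ⟪b (D (b x)), y⟫_ℂ = ⟪x, b (D (b y))⟫_ℂ := by
      rw [hbs, show ⟪D (b x), b y⟫_ℂ = ⟪b x, D (b y)⟫_ℂ from hD _ _, hbs]
    exact h4
  have h2 : ⟪D (b (J ψ)), b (J ψ)⟫_ℂ = ((∑ w : s, ((w : ℝ) ^ 2)⁻¹ * ‖ψ w‖ ^ 2 : ℝ) : ℂ) := by
    rw [← hbs]
    have h3 : b (D (b (J ψ))) = ∑ w : s, ((((w : ℝ) ^ 2)⁻¹ : ℝ) : ℂ) • (ψ w : 𝓗) := by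
      rw [hJ_apply, map_sum, map_sum, map_sum]
      refine Finset.sum_congr rfl fun w _ => ?_
      have h4 := mem_eigK.1 (visSpace_le_eigK _ _ _ (ψ w).2)
      have h5 : ((w : ℝ) : ℂ) ^ 2 ≠ 0 := by
        have := (hs w w.2).1.ne'
        exact pow_ne_zero _ (by exact_mod_cast this)
      simp only [Complex.ofReal_inv, Complex.ofReal_pow]
      rw [eq_inv_smul_iff₀ h5]
      exact h4
    rw [h3, hJ_apply, norm_sq_sum_of_orthogonal _ _ horth]
    push_cast
    refine Finset.sum_congr rfl fun w _ => ?_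
    simp
  rw [h2, Complex.ofReal_re] at h1
  have h3 : ‖J ψ‖ ^ 2 = ∑ w, ‖ψ w‖ ^ 2 := by
    have h4 := norm_sq_sum_of_orthogonal (fun w => (ψ w : 𝓗)) (fun _ => 1) horth
    simp only [one_smul, map_one, one_mul] at h4
    rw [← hJ_apply, inner_self_eq_norm_sq_to_K] at h4
    apply Complex.ofReal_injective
    push_cast at h4 ⊢
    exact h4
  have h4 : ‖b (J ψ)‖ ^ 2 ≤ ‖J ψ‖ ^ 2 := by
    have h5 := congrArg (fun x => (⟪x, J ψ⟫_ℂ).re) (hBb (J ψ))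
    simp only [hbs] at h5
    rw [inner_add_left, inner_smul_left, show ∀ x y, ⟪r x, y⟫_ℂ = ⟪x, r y⟫_ℂ from hr] at h5
    have h6 := (Complex.nonneg_iff.1 (hA.inner_nonneg_left (r (b (J ψ))))).1
    rw [inner_self_eq_norm_sq_to_K, inner_self_eq_norm_sq_to_K] at h5
    have h7 : ∀ x : ℝ, (((x : ℂ)) ^ 2).re = x ^ 2 := fun x => by
      rw [← Complex.ofReal_pow, Complex.ofReal_re]
    have h8 : ‖b (J ψ)‖ ^ 2 + 2 * (⟪A (r (b (J ψ))), r (b (J ψ))⟫_ℂ).re = ‖J ψ‖ ^ 2 := by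
      rw [← h7, ← h7]
      refine Eq.trans ?_ h5
      simp
    linarith
  have h5 : ∑ w : s, (((w : ℝ) ^ 2)⁻¹ - (ω ^ 2)⁻¹) * ‖ψ w‖ ^ 2 ≤ 0 := by
    simp only [sub_mul, Finset.sum_sub_distrib, ← Finset.mul_sum]
    rw [← h3]
    have : (ω ^ 2)⁻¹ * ‖b (J ψ)‖ ^ 2 ≤ (ω ^ 2)⁻¹ * ‖J ψ‖ ^ 2 := by gcongr
    linarith
  have hpos : ∀ w : s, 0 < ((w : ℝ) ^ 2)⁻¹ - (ω ^ 2)⁻¹ := by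
    intro w
    obtain ⟨h6, h7⟩ := hs w w.2
    rw [sub_pos]
    gcongr
  have h6 := (Finset.sum_eq_zero_iff_of_nonneg fun w _ =>
    mul_nonneg (hpos w).le (sq_nonneg ‖ψ w‖)).1
    (le_antisymm h5 (Finset.sum_nonneg fun w _ => mul_nonneg (hpos w).le (sq_nonneg ‖ψ w‖)))
  ext w
  have h7 := (mul_eq_zero.1 (h6 w (Finset.mem_univ w))).resolve_left (hpos w).ne'
  have h8 : ψ w = 0 := norm_eq_zero.1 (pow_eq_zero_iff two_ne_zero |>.1 h7)
  rw [h8]; rfl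

end Counting

section Gap

variable [CompleteSpace 𝓗]

/-- Finitely many eigenspaces of `q²` exhaust the part of `q²` above `ω⁻²`, when this is so
outside the finite-dimensional range of a projection commuting with `q`. -/
lemma exists_finset_gap {q p : 𝓗 →L[ℂ] 𝓗} (hq : q.IsPositive)
    (hp : (p : 𝓗 →ₗ[ℂ] 𝓗).IsSymmetric) (hpp : p ∘L p = p) (hqp : q ∘L p = p ∘L q)
    (hfin : FiniteDimensional ℂ (LinearMap.range (p : 𝓗 →ₗ[ℂ] 𝓗))) {ω : ℝ} (hω : 0 < ω)
    (hgap : ∀ x, p x = 0 → ‖q x‖ ≤ ω⁻¹ * ‖x‖) :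
    ∃ T : Finset ℝ, (∀ w ∈ T, 0 < w ∧ w < ω) ∧
      ∀ ξ, (∀ w ∈ T, (eigK (q ∘L q) w).starProjection ξ = 0) →
        (⟪q (q ξ), ξ⟫_ℂ).re ≤ (ω ^ 2)⁻¹ * ‖ξ‖ ^ 2 := by
  classical
  have hqs : ∀ x y, ⟪q x, y⟫_ℂ = ⟪x, q y⟫_ℂ := hq.isSymmetric
  set V := LinearMap.range (p : 𝓗 →ₗ[ℂ] 𝓗) with hV
  have hpV : ∀ v ∈ V, p v = v := by
    rintro _ ⟨x, rfl⟩
    exact congrArg (fun T : 𝓗 →L[ℂ] 𝓗 => T x) hpp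
  have hqp' : ∀ x, q (p x) = p (q x) := fun x => congrArg (fun T : 𝓗 →L[ℂ] 𝓗 => T x) hqp
  have hqV : ∀ v ∈ V, (q : 𝓗 →ₗ[ℂ] 𝓗) v ∈ V := by
    intro v hv
    refine ⟨q v, ?_⟩
    rw [ContinuousLinearMap.coe_coe, ContinuousLinearMap.coe_coe, ← hqp', hpV v hv]
  have hsym := LinearMap.IsSymmetric.restrict_invariant (T := (q : 𝓗 →ₗ[ℂ] 𝓗)) hq.isSymmetric hqV
  set e := hsym.eigenvectorBasis rfl with he
  set ν := hsym.eigenvalues rfl with hν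
  have hqe : ∀ i, q (e i : 𝓗) = ((ν i : ℝ) : ℂ) • (e i : 𝓗) := fun i =>
    congrArg Subtype.val (hsym.apply_eigenvectorBasis rfl i)
  have hνnn : ∀ i, 0 ≤ ν i := by
    intro i
    have h1 := (Complex.nonneg_iff.1 (hq.inner_nonneg_left (e i : 𝓗))).1
    rw [hqe, inner_smul_left] at h1
    have h2 : ‖(e i : 𝓗)‖ = 1 := e.norm_eq_one i
    rw [inner_self_eq_norm_sq_to_K, h2] at h1
    simpa using h1
  refine ⟨(Finset.univ.filter fun i => ω⁻¹ < ν i).image fun i => (ν i)⁻¹, ?_, ?_⟩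
  · intro w hw
    obtain ⟨i, hi, rfl⟩ := Finset.mem_image.1 hw
    have h1 : ω⁻¹ < ν i := (Finset.mem_filter.1 hi).2
    have h2 : 0 < ω⁻¹ := inv_pos.2 hω
    exact ⟨inv_pos.2 (h2.trans h1), inv_lt_of_inv_lt₀ hω h1⟩
  · intro ξ hξ
    set v : V := ⟨p ξ, ξ, rfl⟩ with hv
    set y := ξ - p ξ with hy
    have hpy : p y = 0 := by
      rw [hy, map_sub, hpV (p ξ) ⟨ξ, rfl⟩, sub_self]
    have horth : ⟪p ξ, y⟫_ℂ = 0 := by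
      rw [show ⟪p ξ, y⟫_ℂ = ⟪ξ, p y⟫_ℂ from hp _ _, hpy, inner_zero_right]
    have horthq : ⟪q (p ξ), q y⟫_ℂ = 0 := by
      rw [hqp', show ⟪p (q ξ), q y⟫_ℂ = ⟪q ξ, p (q y)⟫_ℂ from hp _ _, ← hqp', hpy, map_zero,
        inner_zero_right]
    have hsq : (⟪q (q ξ), ξ⟫_ℂ).re = ‖q ξ‖ ^ 2 := by
      rw [hqs, inner_self_eq_norm_sq_to_K]
      simp [← Complex.ofReal_pow]
    have hξs : ξ = p ξ + y := by rw [hy]; abel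
    have h1 : ‖ξ‖ ^ 2 = ‖p ξ‖ ^ 2 + ‖y‖ ^ 2 := by
      conv_lhs => rw [hξs]
      rw [pow_two, norm_add_sq_eq_norm_sq_add_norm_sq_of_inner_eq_zero _ _ horth]; ring
    have h2 : ‖q ξ‖ ^ 2 = ‖q (p ξ)‖ ^ 2 + ‖q y‖ ^ 2 := by
      conv_lhs => rw [hξs]
      rw [map_add, pow_two, norm_add_sq_eq_norm_sq_add_norm_sq_of_inner_eq_zero _ _ horthq]; ring
    have h3 : ‖q y‖ ^ 2 ≤ (ω ^ 2)⁻¹ * ‖y‖ ^ 2 := by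
      rw [← inv_pow, ← mul_pow]
      exact pow_le_pow_left₀ (norm_nonneg _) (hgap y hpy) 2
    have h4 : ‖q (p ξ)‖ ^ 2 ≤ (ω ^ 2)⁻¹ * ‖p ξ‖ ^ 2 := by
      have h5 : ‖p ξ‖ ^ 2 = ∑ i, ‖⟪e i, v⟫_ℂ‖ ^ 2 := (e.sum_sq_norm_inner_right v).symm
      set u : V := ⟨q (p ξ), hqV _ ⟨ξ, rfl⟩⟩ with hu
      have h6 : ‖q (p ξ)‖ ^ 2 = ∑ i, ‖⟪e i, u⟫_ℂ‖ ^ 2 := (e.sum_sq_norm_inner_right u).symm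
      have h7 : ∀ i, ⟪e i, u⟫_ℂ = (ν i : ℂ) * ⟪e i, v⟫_ℂ := by
        intro i
        have h8 : ⟪(e i : 𝓗), q (p ξ)⟫_ℂ = (ν i : ℂ) * ⟪(e i : 𝓗), p ξ⟫_ℂ := by
          rw [← hqs, hqe, inner_smul_left]; simp
        exact h8
      rw [h5, h6, Finset.mul_sum]
      refine Finset.sum_le_sum fun i _ => ?_
      rw [h7, norm_mul, mul_pow, Complex.norm_real, Real.norm_of_nonneg (hνnn i)]
      by_cases hi : ω⁻¹ < ν i
      · have h8 : ⟪e i, v⟫_ℂ = 0 := by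
          have hw := hξ (ν i)⁻¹ (Finset.mem_image.2 ⟨i, by simpa using hi, rfl⟩)
          have hν0 : ((ν i : ℝ) : ℂ) ≠ 0 := by
            exact_mod_cast ((inv_pos.2 hω).trans hi).ne'
          have hmem : (e i : 𝓗) ∈ eigK (q ∘L q) (ν i)⁻¹ := by
            rw [mem_eigK]
            simp only [ContinuousLinearMap.comp_apply, hqe, map_smul, smul_smul]
            push_cast
            convert one_smul ℂ (e i : 𝓗) using 2
            field_simp
          have h9 : ⟪ξ, (e i : 𝓗)⟫_ℂ = 0 := by
            rw [← inner_starProjection_of_mem hmem, hw, inner_zero_left]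
          have h10 : ⟪p ξ, (e i : 𝓗)⟫_ℂ = 0 := by
            rw [show ⟪p ξ, (e i : 𝓗)⟫_ℂ = ⟪ξ, p (e i)⟫_ℂ from hp _ _, hpV _ (e i).2, h9]
          have h11 : ⟪(e i : 𝓗), p ξ⟫_ℂ = 0 := by
            rw [← inner_conj_symm, h10, map_zero]
          exact h11
        simp [h8]
      · rw [← inv_pow]
        have := hνnn i
        push Not at hi
        gcongr
    rw [hsq, h1, h2]
    linarith

end Gap

end RPAShift

namespace RPAShift

/-! ### Bounded functional calculus of a projection-valued measure -/

section FunctionalCalculus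

variable (P : SpectralData 𝓗)

instance isFiniteMeasure_diag (x : 𝓗) : IsFiniteMeasure (P.diag x) := by
  refine ⟨?_⟩
  rw [P.diag_apply x _ MeasurableSet.univ]
  exact ENNReal.pow_lt_top ENNReal.coe_lt_top

lemma diag_real_apply (x : 𝓗) {A : Set ℝ} (hA : MeasurableSet A) :
    (P.diag x).real A = ‖P.proj A x‖ ^ 2 := by
  rw [Measure.real, P.diag_apply x A hA]; simp

lemma diag_real_univ (x : 𝓗) : (P.diag x).real Set.univ = ‖x‖ ^ 2 := by
  rw [diag_real_apply P x MeasurableSet.univ, P.proj_univ]; rfl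

lemma proj_proj {A B : Set ℝ} (hA : MeasurableSet A) (hB : MeasurableSet B) (x : 𝓗) :
    P.proj A (P.proj B x) = P.proj (A ∩ B) x :=
  congrArg (fun T : 𝓗 →L[ℂ] 𝓗 => T x) (P.proj_comp A B hA hB)

lemma inner_proj_self (x : 𝓗) {A : Set ℝ} (hA : MeasurableSet A) :
    ⟪x, P.proj A x⟫_ℂ = (((P.diag x).real A : ℝ) : ℂ) := by
  have h1 : P.proj A x = P.proj A (P.proj A x) := by rw [proj_proj P hA hA, Set.inter_self]
  rw [h1, ← P.proj_symm A hA, inner_self_eq_norm_sq_to_K, diag_real_apply P x hA]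
  simp

lemma integrable_diag {f : ℝ → ℝ} (hf : Measurable f) {C : ℝ} (hC : ∀ a, |f a| ≤ C) (x : 𝓗) :
    Integrable f (P.diag x) :=
  Integrable.of_bound hf.aestronglyMeasurable C (Filter.Eventually.of_forall hC)

/-- `T` is the operator `f(H)`. -/
def IsFC (f : ℝ → ℝ) (T : 𝓗 →L[ℂ] 𝓗) : Prop :=
  ∀ (x : 𝓗) (A : Set ℝ), MeasurableSet A →
    ⟪x, P.proj A (T x)⟫_ℂ = ((∫ a in A, f a ∂(P.diag x) : ℝ) : ℂ)

variable {P}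

lemma isSymmetric_of_inner_real {T : 𝓗 →L[ℂ] 𝓗} (h : ∀ x, ∃ a : ℝ, ⟪x, T x⟫_ℂ = (a : ℂ)) :
    (T : 𝓗 →ₗ[ℂ] 𝓗).IsSymmetric := by
  rw [LinearMap.isSymmetric_iff_inner_map_self_real]
  intro x
  obtain ⟨a, ha⟩ := h x
  rw [ContinuousLinearMap.coe_coe, ← inner_conj_symm, ha]
  simp

lemma IsFC.inner_self {f : ℝ → ℝ} {T : 𝓗 →L[ℂ] 𝓗} (h : IsFC P f T) (x : 𝓗) :
    ⟪x, T x⟫_ℂ = ((∫ a, f a ∂(P.diag x) : ℝ) : ℂ) := by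
  have := h x Set.univ MeasurableSet.univ
  rwa [P.proj_univ, Measure.restrict_univ] at this

lemma IsFC.isSymmetric {f : ℝ → ℝ} {T : 𝓗 →L[ℂ] 𝓗} (h : IsFC P f T) :
    (T : 𝓗 →ₗ[ℂ] 𝓗).IsSymmetric :=
  isSymmetric_of_inner_real fun x => ⟨_, h.inner_self x⟩

lemma eq_of_inner_right {S T : 𝓗 →L[ℂ] 𝓗} (h : ∀ x, ⟪x, S x⟫_ℂ = ⟪x, T x⟫_ℂ) : S = T := by
  refine ContinuousLinearMap.coe_injective ((ext_inner_map _ _).1 fun x => ?_)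
  rw [ContinuousLinearMap.coe_coe, ContinuousLinearMap.coe_coe, ← inner_conj_symm, h,
    inner_conj_symm]

lemma IsFC.unique {f : ℝ → ℝ} {S T : 𝓗 →L[ℂ] 𝓗} (hS : IsFC P f S) (hT : IsFC P f T) : S = T :=
  eq_of_inner_right fun x => by rw [hS.inner_self, hT.inner_self]

lemma IsFC.commute {f : ℝ → ℝ} {T : 𝓗 →L[ℂ] 𝓗} (h : IsFC P f T) {A : Set ℝ}
    (hA : MeasurableSet A) (x : 𝓗) : P.proj A (T x) = T (P.proj A x) := by
  have h1 : ((P.proj A ∘L T : 𝓗 →L[ℂ] 𝓗) : 𝓗 →ₗ[ℂ] 𝓗).IsSymmetric :=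
    isSymmetric_of_inner_real fun x => ⟨_, h x A hA⟩
  refine ext_inner_right ℂ fun y => ?_
  have h2 : ⟪P.proj A (T x), y⟫_ℂ = ⟪x, P.proj A (T y)⟫_ℂ := h1 x y
  have h3 : ⟪T (P.proj A x), y⟫_ℂ = ⟪P.proj A x, T y⟫_ℂ := h.isSymmetric _ _
  rw [h2, h3, P.proj_symm A hA]

lemma IsFC.congr {f g : ℝ → ℝ} {T : 𝓗 →L[ℂ] 𝓗} (h : IsFC P f T)
    (hfg : ∀ x, f =ᵐ[P.diag x] g) : IsFC P g T := fun x A hA => by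
  rw [h x A hA, integral_congr_ae (ae_restrict_of_ae (hfg x))]

lemma IsFC.add {f g : ℝ → ℝ} {S T : 𝓗 →L[ℂ] 𝓗} (hf : ∀ x, Integrable f (P.diag x))
    (hg : ∀ x, Integrable g (P.diag x)) (hS : IsFC P f S) (hT : IsFC P g T) :
    IsFC P (fun a => f a + g a) (S + T) := fun x A hA => by
  rw [integral_add (hf x).integrableOn (hg x).integrableOn, add_apply, map_add, inner_add_right,
    hS x A hA, hT x A hA, Complex.ofReal_add]

lemma IsFC.const_mul {f : ℝ → ℝ} {T : 𝓗 →L[ℂ] 𝓗} (hT : IsFC P f T) (c : ℝ) :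
    IsFC P (fun a => c * f a) ((c : ℂ) • T) := fun x A hA => by
  rw [integral_const_mul, smul_apply, map_smul, inner_smul_right, hT x A hA, Complex.ofReal_mul]

lemma IsFC.sub {f g : ℝ → ℝ} {S T : 𝓗 →L[ℂ] 𝓗} (hf : ∀ x, Integrable f (P.diag x))
    (hg : ∀ x, Integrable g (P.diag x)) (hS : IsFC P f S) (hT : IsFC P g T) :
    IsFC P (fun a => f a - g a) (S - T) := fun x A hA => by
  rw [integral_sub (hf x).integrableOn (hg x).integrableOn, sub_apply, map_sub, inner_sub_right,
    hS x A hA, hT x A hA, Complex.ofReal_sub]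

lemma IsFC.indicator_mul {f : ℝ → ℝ} {T : 𝓗 →L[ℂ] 𝓗} (hT : IsFC P f T) {B : Set ℝ}
    (hB : MeasurableSet B) : IsFC P (B.indicator f) (P.proj B ∘L T) := fun x A hA => by
  rw [ContinuousLinearMap.comp_apply, proj_proj P hA hB, hT x _ (hA.inter hB),
    setIntegral_indicator hB]

variable (P) in
lemma isFC_one : IsFC P (fun _ => 1) (ContinuousLinearMap.id ℂ 𝓗) := fun x A hA => by
  rw [ContinuousLinearMap.id_apply, inner_proj_self P x hA]; simp

variable (P) in
lemma isFC_proj {B : Set ℝ} (hB : MeasurableSet B) :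
    IsFC P (B.indicator fun _ => 1) (P.proj B) :=
  (isFC_one P).indicator_mul hB

variable (P) in
/-- The functional calculus for simple functions is multiplicative. -/
lemma exists_isFC_simpleFunc (f : SimpleFunc ℝ ℝ) : ∃ T : 𝓗 →L[ℂ] 𝓗, IsFC P f T ∧
    ∀ (g : ℝ → ℝ) (S : 𝓗 →L[ℂ] 𝓗), (∀ x, Integrable g (P.diag x)) → IsFC P g S →
      IsFC P (fun a => f a * g a) (T ∘L S) := by
  have key : ∀ (f : SimpleFunc ℝ ℝ) (g : ℝ → ℝ), (∀ x, Integrable g (P.diag x)) →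
      ∀ x, Integrable (fun a => f a * g a) (P.diag x) := by
    intro f g hg x
    obtain ⟨C, hC⟩ := f.exists_forall_norm_le
    exact (hg x).bdd_mul f.measurable.aestronglyMeasurable (Filter.Eventually.of_forall hC)
  have key1 : ∀ (f : SimpleFunc ℝ ℝ) (x : 𝓗), Integrable f (P.diag x) := fun f x =>
    SimpleFunc.integrable_of_isFiniteMeasure f
  induction f using SimpleFunc.induction with
  | const c hs =>
    rename_i s
    have hcoe : ∀ a, (SimpleFunc.piecewise s hs (SimpleFunc.const ℝ c) (SimpleFunc.const ℝ 0)) a =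
        c * s.indicator (fun _ => 1) a := by
      intro a
      by_cases ha : a ∈ s <;> simp [ha]
    refine ⟨(c : ℂ) • P.proj s, ?_, fun g S hg hS => ?_⟩
    · exact ((isFC_proj P hs).const_mul c).congr fun x => Filter.Eventually.of_forall fun a =>
        (hcoe a).symm
    · refine IsFC.congr (f := fun a => c * s.indicator g a) ((hS.indicator_mul hs).const_mul c)
        fun x => Filter.Eventually.of_forall fun a => ?_
      by_cases ha : a ∈ s <;> simp [ha]
  | add hfg hf hg =>
    rename_i f g
    obtain ⟨S, hS, hS'⟩ := hf
    obtain ⟨T, hT, hT'⟩ := hg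
    refine ⟨S + T, hS.add (key1 f) (key1 g) hT, fun k R hk hR => ?_⟩
    have h1 := (hS' k R hk hR).add (key f k hk) (key g k hk) (hT' k R hk hR)
    rw [ContinuousLinearMap.add_comp]
    refine h1.congr fun x => Filter.Eventually.of_forall fun a => ?_
    simp [add_mul]

lemma IsFC.norm_le_simpleFunc {f : SimpleFunc ℝ ℝ} {T : 𝓗 →L[ℂ] 𝓗} (hT : IsFC P f T) {C : ℝ}
    (hC0 : 0 ≤ C) (hC : ∀ a, |f a| ≤ C) : ‖T‖ ≤ C := by
  obtain ⟨T', hT', hmul⟩ := exists_isFC_simpleFunc P f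
  obtain rfl := hT.unique hT'
  refine T.opNorm_le_bound hC0 fun x => ?_
  have h1 := (hmul f T (fun x => SimpleFunc.integrable_of_isFiniteMeasure f) hT).inner_self x
  rw [ContinuousLinearMap.comp_apply, show ⟪x, T (T x)⟫_ℂ = ⟪T x, T x⟫_ℂ from
    (hT.isSymmetric _ _).symm,
    inner_self_eq_norm_sq_to_K] at h1
  have h2 : ‖T x‖ ^ 2 = ∫ a, f a * f a ∂(P.diag x) := by
    apply Complex.ofReal_injective
    rw [← h1]; simp
  have h3 : ∫ a, f a * f a ∂(P.diag x) ≤ ∫ _, C ^ 2 ∂(P.diag x) := by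
    refine integral_mono_of_nonneg (Filter.Eventually.of_forall fun a => mul_self_nonneg _)
      (integrable_const _) (Filter.Eventually.of_forall fun a => ?_)
    change f a * f a ≤ C ^ 2
    rw [← pow_two, ← sq_abs]
    exact pow_le_pow_left₀ (abs_nonneg _) (hC a) 2
  rw [integral_const, diag_real_univ, smul_eq_mul, ← h2, mul_comm, ← mul_pow] at h3
  exact le_of_sq_le_sq h3 (by positivity)

lemma exists_simpleFunc_near {f : ℝ → ℝ} (hf : Measurable f) {C : ℝ} (hC : ∀ a, |f a| ≤ C)
    {δ : ℝ} (hδ : 0 < δ) : ∃ g : SimpleFunc ℝ ℝ, ∀ a, |g a - f a| ≤ δ := by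
  refine ⟨⟨fun a => (⌊f a / δ⌋ : ℝ) * δ, fun c => ?_, ?_⟩, fun a => ?_⟩
  · have : Measurable fun a => (⌊f a / δ⌋ : ℝ) * δ := by
      have h1 : Measurable fun a => ⌊f a / δ⌋ := (hf.div_const δ).floor
      exact (measurable_from_top.comp h1).mul_const δ
    exact this (measurableSet_singleton c)
  · refine ((Set.finite_Icc ⌊-C / δ⌋ ⌊C / δ⌋).image fun n : ℤ => (n : ℝ) * δ).subset ?_
    rintro _ ⟨a, rfl⟩
    obtain ⟨h1, h2⟩ := abs_le.1 (hC a)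
    refine ⟨⌊f a / δ⌋, ⟨Int.floor_mono ?_, Int.floor_mono ?_⟩, rfl⟩ <;> gcongr
  · change |(⌊f a / δ⌋ : ℝ) * δ - f a| ≤ δ
    have h1 := Int.floor_le (f a / δ)
    have h2 := Int.lt_floor_add_one (f a / δ)
    rw [le_div_iff₀ hδ] at h1
    rw [div_lt_iff₀ hδ] at h2
    rw [abs_le]; constructor <;> linarith

lemma IsFC.of_tendsto {f : ℝ → ℝ} {fn : ℕ → ℝ → ℝ} {Tn : ℕ → (𝓗 →L[ℂ] 𝓗)} {T : 𝓗 →L[ℂ] 𝓗}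
    (hf : ∀ x, Integrable f (P.diag x)) (hfn : ∀ n x, Integrable (fn n) (P.diag x))
    (h : ∀ n, IsFC P (fn n) (Tn n))
        (hT : ∀ x, Filter.Tendsto (fun n => Tn n x) Filter.atTop (nhds (T x)))
    (hlim : ∀ x, Filter.Tendsto (fun n => ∫ a, |fn n a - f a| ∂(P.diag x)) Filter.atTop (nhds 0)) :
    IsFC P f T := fun x A hA => by
  have h1 : Filter.Tendsto (fun n => ⟪x, P.proj A (Tn n x)⟫_ℂ) Filter.atTop
      (nhds ⟪x, P.proj A (T x)⟫_ℂ) :=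
    tendsto_const_nhds.inner (((P.proj A).continuous.tendsto _).comp (hT x))
  have h2 : Filter.Tendsto (fun n => ∫ a in A, fn n a ∂(P.diag x)) Filter.atTop
      (nhds (∫ a in A, f a ∂(P.diag x))) := by
    rw [tendsto_iff_norm_sub_tendsto_zero]
    refine squeeze_zero (fun _ => norm_nonneg _) (fun n => ?_) (hlim x)
    rw [← integral_sub (hfn n x).integrableOn (hf x).integrableOn]
    refine (norm_integral_le_integral_norm _).trans ?_
    exact setIntegral_le_integral ((hfn n x).sub (hf x)).norm
      (Filter.Eventually.of_forall fun a => norm_nonneg _)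
  refine tendsto_nhds_unique h1 ?_
  simp only [fun n => h n x A hA]
  exact (Complex.continuous_ofReal.tendsto _).comp h2

variable [CompleteSpace 𝓗]

/-- Bounded measurable functions have a functional calculus, which is moreover a norm limit of the
functional calculus of uniformly close simple functions. -/
lemma exists_isFC_approx {f : ℝ → ℝ} (hf : Measurable f) {C : ℝ} (hC : ∀ a, |f a| ≤ C) :
    ∃ (T : 𝓗 →L[ℂ] 𝓗) (fn : ℕ → SimpleFunc ℝ ℝ) (Tn : ℕ → (𝓗 →L[ℂ] 𝓗)), IsFC P f T ∧
      (∀ n a, |fn n a - f a| ≤ ((n : ℝ) + 1)⁻¹) ∧ (∀ n, IsFC P (fn n) (Tn n)) ∧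
      Filter.Tendsto Tn Filter.atTop (nhds T) := by
  have h1 : ∀ n : ℕ, ∃ g : SimpleFunc ℝ ℝ, ∀ a, |g a - f a| ≤ ((n : ℝ) + 1)⁻¹ := fun n =>
    exists_simpleFunc_near hf hC (by positivity)
  choose fn hfn using h1
  choose Tn hTn _ using fun n => exists_isFC_simpleFunc P (fn n)
  have hInt : ∀ (g : SimpleFunc ℝ ℝ) (x : 𝓗), Integrable g (P.diag x) := fun g x =>
    SimpleFunc.integrable_of_isFiniteMeasure g
  have hlim0 : Filter.Tendsto (fun n : ℕ => ((n : ℝ) + 1)⁻¹) Filter.atTop (nhds 0) := by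
    simpa using tendsto_one_div_add_atTop_nhds_zero_nat (𝕜 := ℝ)
  have hcauchy : CauchySeq Tn := by
    refine cauchySeq_of_le_tendsto_0 (fun n => 2 * ((n : ℝ) + 1)⁻¹) (fun n m N hn hm => ?_)
      (by simpa using hlim0.const_mul 2)
    rw [dist_eq_norm]
    have h2 : IsFC P (fn n - fn m : SimpleFunc ℝ ℝ) (Tn n - Tn m) :=
      (hTn n).sub (hInt _) (hInt _) (hTn m)
    refine h2.norm_le_simpleFunc (by positivity) fun a => ?_
    have h3 := abs_le.1 (hfn n a)
    have h4 := abs_le.1 (hfn m a)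
    have h5 : ((n : ℝ) + 1)⁻¹ ≤ ((N : ℝ) + 1)⁻¹ := by gcongr
    have h6 : ((m : ℝ) + 1)⁻¹ ≤ ((N : ℝ) + 1)⁻¹ := by gcongr
    change |fn n a - fn m a| ≤ _
    rw [abs_le]; constructor <;> linarith [h3.1, h3.2, h4.1, h4.2]
  obtain ⟨T, hT⟩ := cauchySeq_tendsto_of_complete hcauchy
  refine ⟨T, fn, Tn, ?_, hfn, hTn, hT⟩
  refine IsFC.of_tendsto (fun x => integrable_diag P hf hC x) (fun n x => hInt (fn n) x) hTn
    (fun x => ((ContinuousLinearMap.apply ℂ 𝓗 x).continuous.tendsto T).comp hT) fun x => ?_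
  have h7 : Filter.Tendsto (fun n : ℕ => ((n : ℝ) + 1)⁻¹ * (P.diag x).real Set.univ) Filter.atTop
      (nhds 0) := by
    simpa using hlim0.mul_const ((P.diag x).real Set.univ)
  refine squeeze_zero (fun n => integral_nonneg fun a => abs_nonneg _) (fun n => ?_) h7
  have h8 : ∫ a, |fn n a - f a| ∂(P.diag x) ≤ ∫ _, ((n : ℝ) + 1)⁻¹ ∂(P.diag x) :=
    integral_mono_of_nonneg (Filter.Eventually.of_forall fun a => abs_nonneg _)
      (integrable_const _) (Filter.Eventually.of_forall (hfn n))
  rwa [integral_const, smul_eq_mul, mul_comm] at h8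

lemma exists_isFC {f : ℝ → ℝ} (hf : Measurable f) {C : ℝ} (hC : ∀ a, |f a| ≤ C) :
    ∃ T : 𝓗 →L[ℂ] 𝓗, IsFC P f T :=
  let ⟨T, _, _, h, _⟩ := exists_isFC_approx (P := P) hf hC
  ⟨T, h⟩

lemma IsFC.mul {f g : ℝ → ℝ} {S T : 𝓗 →L[ℂ] 𝓗} (hf : Measurable f) {C C' : ℝ}
    (hC : ∀ a, |f a| ≤ C) (hg : Measurable g) (hC' : ∀ a, |g a| ≤ C')
    (hT : IsFC P f T) (hS : IsFC P g S) : IsFC P (fun a => f a * g a) (T ∘L S) := by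
  obtain ⟨T', fn, Tn, hT', hfn, hTn, hlim⟩ := exists_isFC_approx (P := P) hf hC
  obtain rfl := hT.unique hT'
  have hgi : ∀ x, Integrable g (P.diag x) := fun x => integrable_diag P hg hC' x
  have h1 : ∀ n, IsFC P (fun a => fn n a * g a) (Tn n ∘L S) := by
    intro n
    obtain ⟨R, hR, hmul⟩ := exists_isFC_simpleFunc P (fn n)
    obtain rfl := (hTn n).unique hR
    exact hmul g S hgi hS
  have hfb : ∀ n a, |fn n a| ≤ C + 1 := by
    intro n a
    have h2 := abs_le.1 (hfn n a)
    have h3 := abs_le.1 (hC a)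
    have h4 : ((n : ℝ) + 1)⁻¹ ≤ 1 := inv_le_one_of_one_le₀
        (by linarith [(Nat.cast_nonneg n : (0 : ℝ) ≤ n)])
    rw [abs_le]; constructor <;> linarith [h2.1, h2.2, h3.1, h3.2]
  have hlim0 : Filter.Tendsto (fun n : ℕ => ((n : ℝ) + 1)⁻¹) Filter.atTop (nhds 0) := by
    simpa using tendsto_one_div_add_atTop_nhds_zero_nat (𝕜 := ℝ)
  refine IsFC.of_tendsto (fun x =>
    (hgi x).bdd_mul hf.aestronglyMeasurable (Filter.Eventually.of_forall hC))
    (fun n x => (hgi x).bdd_mul (fn n).measurable.aestronglyMeasurable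
      (Filter.Eventually.of_forall (hfb n))) h1
    (fun x => ((ContinuousLinearMap.apply ℂ 𝓗 (S x)).continuous.tendsto T).comp hlim) fun x => ?_
  have h7 : Filter.Tendsto (fun n : ℕ => ((n : ℝ) + 1)⁻¹ * ∫ a, |g a| ∂(P.diag x)) Filter.atTop
      (nhds 0) := by
    simpa using hlim0.mul_const (∫ a, |g a| ∂(P.diag x))
  refine squeeze_zero (fun n => integral_nonneg fun a => abs_nonneg _) (fun n => ?_) h7
  rw [← integral_const_mul]
  refine integral_mono_of_nonneg (Filter.Eventually.of_forall fun a => abs_nonneg _)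
      ((hgi x).abs.const_mul _) (Filter.Eventually.of_forall fun a => ?_)
  change |fn n a * g a - f a * g a| ≤ _
  rw [← sub_mul, abs_mul]
  exact mul_le_mul_of_nonneg_right (hfn n a) (abs_nonneg _)

lemma IsFC.norm_sq {f : ℝ → ℝ} {T : 𝓗 →L[ℂ] 𝓗} (hf : Measurable f) {C : ℝ}
    (hC : ∀ a, |f a| ≤ C) (hT : IsFC P f T) (x : 𝓗) :
    ‖T x‖ ^ 2 = ∫ a, f a * f a ∂(P.diag x) := by
  have h1 := (hT.mul hf hC hf hC hT).inner_self x
  rw [ContinuousLinearMap.comp_apply, show ⟪x, T (T x)⟫_ℂ = ⟪T x, T x⟫_ℂ from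
    (hT.isSymmetric _ _).symm,
    inner_self_eq_norm_sq_to_K] at h1
  apply Complex.ofReal_injective
  rw [← h1]; simp

lemma IsFC.norm_le {f : ℝ → ℝ} {T : 𝓗 →L[ℂ] 𝓗} (hf : Measurable f) {C : ℝ}
    (hC : ∀ a, |f a| ≤ C) (hT : IsFC P f T) {x : 𝓗} {C' : ℝ} (hC0 : 0 ≤ C')
    (hx : ∀ᵐ a ∂(P.diag x), |f a| ≤ C') : ‖T x‖ ≤ C' * ‖x‖ := by
  have h3 : ∫ a, f a * f a ∂(P.diag x) ≤ ∫ _, C' ^ 2 ∂(P.diag x) := by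
    refine integral_mono_of_nonneg (Filter.Eventually.of_forall fun a => mul_self_nonneg _)
      (integrable_const _) ?_
    filter_upwards [hx] with a ha
    rw [← pow_two, ← sq_abs]
    exact pow_le_pow_left₀ (abs_nonneg _) ha 2
  rw [integral_const, diag_real_univ, smul_eq_mul, ← hT.norm_sq hf hC, mul_comm, ← mul_pow] at h3
  exact le_of_sq_le_sq h3 (by positivity)

lemma IsFC.isPositive {f : ℝ → ℝ} {T : 𝓗 →L[ℂ] 𝓗} (hT : IsFC P f T) (hf : ∀ a, 0 ≤ f a) :
    T.IsPositive := by
  rw [ContinuousLinearMap.isPositive_def']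
  refine ⟨hT.isSymmetric.isSelfAdjoint, fun x => ?_⟩
  rw [ContinuousLinearMap.reApplyInnerSelf_apply, show ⟪T x, x⟫_ℂ = ⟪x, T x⟫_ℂ from hT.isSymmetric _
    _,
    hT.inner_self]
  simpa using integral_nonneg hf

end FunctionalCalculus

end RPAShift

namespace RPAShift

/-! ### The Hamiltonian below its essential spectrum, and the sine propagator -/

section Spectral

variable {P : SpectralData 𝓗}

lemma proj_empty : P.proj ∅ = 0 := by
  ext x
  have h := diag_real_apply P x MeasurableSet.empty
  rw [measureReal_empty] at h
  exact norm_eq_zero.1 (pow_eq_zero_iff two_ne_zero |>.1 h.symm)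

lemma proj_union {A B : Set ℝ} (hA : MeasurableSet A) (hB : MeasurableSet B) (x : 𝓗) :
    P.proj (A ∪ B) x = P.proj A x + P.proj B (P.proj (B \ A) x) := by
  have h1 : P.proj (A ∪ B) = P.proj A + P.proj (B \ A) := by
    refine (isFC_proj P (hA.union hB)).unique ?_
    refine ((isFC_proj P hA).add (fun x => ?_) (fun x => ?_) (isFC_proj P (hB.diff hA))).congr
      fun x => Filter.Eventually.of_forall fun a => ?_
    · exact (integrable_const (1 : ℝ)).indicator hA
    · exact (integrable_const (1 : ℝ)).indicator (hB.diff hA)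
    · by_cases h : a ∈ A <;> by_cases h' : a ∈ B <;> simp [h, h']
  rw [h1, proj_proj P hB (hB.diff hA), Set.inter_eq_right.2 Set.sdiff_subset]
  rfl

lemma finiteRank_proj_mono {A B : Set ℝ} (hA : MeasurableSet A) (hB : MeasurableSet B)
    (hAB : A ⊆ B) (h : FiniteRankOp (P.proj B)) : FiniteRankOp (P.proj A) := by
  have h' : FiniteDimensional ℂ (LinearMap.range (P.proj B : 𝓗 →ₗ[ℂ] 𝓗)) := h
  refine Submodule.finiteDimensional_of_le (S₂ := LinearMap.range (P.proj B : 𝓗 →ₗ[ℂ] 𝓗)) ?_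
  rintro _ ⟨x, rfl⟩
  refine ⟨P.proj A x, ?_⟩
  rw [ContinuousLinearMap.coe_coe, ContinuousLinearMap.coe_coe, proj_proj P hB hA,
    Set.inter_eq_right.2 hAB]

lemma finiteRank_proj_union {A B : Set ℝ} (hA : MeasurableSet A) (hB : MeasurableSet B)
    (h : FiniteRankOp (P.proj A)) (h' : FiniteRankOp (P.proj B)) :
    FiniteRankOp (P.proj (A ∪ B)) := by
  have i1 : FiniteDimensional ℂ (LinearMap.range (P.proj A : 𝓗 →ₗ[ℂ] 𝓗)) := h
  have i2 : FiniteDimensional ℂ (LinearMap.range (P.proj B : 𝓗 →ₗ[ℂ] 𝓗)) := h'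
  refine Submodule.finiteDimensional_of_le (S₂ := LinearMap.range (P.proj A : 𝓗 →ₗ[ℂ] 𝓗) ⊔
    LinearMap.range (P.proj B : 𝓗 →ₗ[ℂ] 𝓗)) ?_
  rintro _ ⟨x, rfl⟩
  rw [ContinuousLinearMap.coe_coe, proj_union hA hB]
  exact Submodule.add_mem_sup ⟨x, rfl⟩ ⟨_, rfl⟩

/-- Below the essential spectrum, the spectral projections have finite rank. -/
lemma finiteRank_proj_Iio {E₀ ω : ℝ} (hbot : P.proj (Set.Iio E₀) = 0)
    (hω : ω < sInf P.essSpec - E₀) : FiniteRankOp (P.proj (Set.Iio (E₀ + ω))) := by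
  have hzero : FiniteRankOp (P.proj (Set.Iio E₀)) := by
    rw [hbot, FiniteRankOp, show ((0 : 𝓗 →L[ℂ] 𝓗) : 𝓗 →ₗ[ℂ] 𝓗) = 0 from rfl, LinearMap.range_zero]
    infer_instance
  have hbdd : BddBelow P.essSpec := by
    refine ⟨E₀, fun a ha => ?_⟩
    by_contra! hlt
    refine ha (E₀ - a) (by linarith)
      (finiteRank_proj_mono measurableSet_Ioo measurableSet_Iio ?_ hzero)
    intro b hb
    have := hb.2
    simp only [Set.mem_Iio]; linarith
  have hcov : ∃ U, MeasurableSet U ∧ Set.Icc E₀ (E₀ + ω) ⊆ U ∧ FiniteRankOp (P.proj U) := by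
    refine IsCompact.induction_on (isCompact_Icc (a := E₀) (b := E₀ + ω))
      (p := fun s => ∃ U, MeasurableSet U ∧ s ⊆ U ∧ FiniteRankOp (P.proj U)) ?_ ?_ ?_ ?_
    · exact ⟨_, measurableSet_Iio, Set.empty_subset _, hzero⟩
    · rintro s t hst ⟨U, hU, htU, h⟩
      exact ⟨U, hU, hst.trans htU, h⟩
    · rintro s t ⟨U, hU, hsU, h⟩ ⟨V, hV, htV, h'⟩
      exact ⟨U ∪ V, hU.union hV, Set.union_subset_union hsU htV, finiteRank_proj_union hU hV h h'⟩
    · intro a ha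
      have h1 : a ∉ P.essSpec := notMem_of_lt_csInf (by linarith [ha.2]) hbdd
      simp only [SpectralData.essSpec, Set.mem_ofPred_eq, not_forall, not_not] at h1
      obtain ⟨ε, hε, h⟩ := h1
      exact ⟨Set.Ioo (a - ε) (a + ε), mem_nhdsWithin_of_mem_nhds
        (Ioo_mem_nhds (by linarith) (by linarith)), _, measurableSet_Ioo, subset_rfl, h⟩
  obtain ⟨U, hU, hsub, h⟩ := hcov
  refine finiteRank_proj_mono measurableSet_Iio (measurableSet_Iio.union hU) ?_
    (finiteRank_proj_union measurableSet_Iio hU hzero h)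
  intro a ha
  rcases lt_or_ge a E₀ with h1 | h1
  · exact Or.inl h1
  · exact Or.inr (hsub ⟨h1, le_of_lt ha⟩)

lemma diag_ae_spectrum {E₀ : ℝ} {Ψ₀ : 𝓗} (h : IsGroundState P E₀ Ψ₀) :
    ∃ ε > 0, ∀ x, ∀ᵐ a ∂(P.diag x), a = E₀ ∨ E₀ + ε ≤ a := by
  obtain ⟨ε, hε, hiso⟩ := h.isolated
  have h1 : P.proj (Set.Ioo E₀ (E₀ + ε)) = 0 := by
    have h2 : Set.Ioo E₀ (E₀ + ε) ∩ Set.Ioo (E₀ - ε) (E₀ + ε) = Set.Ioo E₀ (E₀ + ε) := by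
      rw [Set.inter_eq_left]
      exact Set.Ioo_subset_Ioo_left (by linarith)
    have h3 : Set.Ioo E₀ (E₀ + ε) ∩ {E₀} = ∅ := by
      ext a; simp only [Set.mem_inter_iff, Set.mem_Ioo, Set.mem_singleton_iff,
        Set.mem_empty_iff_false]
      constructor
      · rintro ⟨⟨h4, -⟩, rfl⟩; exact lt_irrefl _ h4
      · exact False.elim
    rw [← h2, ← P.proj_comp _ _ measurableSet_Ioo measurableSet_Ioo, hiso,
      P.proj_comp _ _ measurableSet_Ioo (measurableSet_singleton _), h3, proj_empty]
  refine ⟨ε, hε, fun x => ?_⟩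
  have h2 : P.diag x (Set.Iio E₀ ∪ Set.Ioo E₀ (E₀ + ε)) = 0 := by
    rw [measure_union_null_iff, P.diag_apply _ _ measurableSet_Iio, P.diag_apply _ _
      measurableSet_Ioo,
      h.bottom, h1]
    simp
  refine measure_mono_null ?_ h2
  intro a ha
  simp only [Set.mem_compl_iff, Set.mem_ofPred_eq, not_or, not_le] at ha
  rcases lt_or_gt_of_ne ha.1 with h3 | h3
  · exact Or.inl h3
  · exact Or.inr ⟨h3, ha.2⟩

/-- The inverse excitation energy. -/
def invExc (E₀ ε a : ℝ) : ℝ := if E₀ + ε ≤ a then (a - E₀)⁻¹ else 0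

lemma measurable_invExc (E₀ ε : ℝ) : Measurable (invExc E₀ ε) :=
  Measurable.ite measurableSet_Ici (by fun_prop) measurable_const

lemma invExc_nonneg (E₀ : ℝ) {ε : ℝ} (hε : 0 < ε) (a : ℝ) : 0 ≤ invExc E₀ ε a := by
  rw [invExc]; split_ifs with h
  · exact inv_nonneg.2 (by linarith)
  · exact le_rfl

lemma invExc_le (E₀ : ℝ) {ε : ℝ} (hε : 0 < ε) (a : ℝ) : invExc E₀ ε a ≤ ε⁻¹ := by
  rw [invExc]; split_ifs with h
  · exact inv_anti₀ hε (by linarith)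
  · exact (inv_pos.2 hε).le

lemma abs_invExc_le (E₀ : ℝ) {ε : ℝ} (hε : 0 < ε) (a : ℝ) : |invExc E₀ ε a| ≤ ε⁻¹ := by
  rw [abs_of_nonneg (invExc_nonneg E₀ hε a)]; exact invExc_le E₀ hε a

lemma abs_sqrt_invExc_le (E₀ : ℝ) {ε : ℝ} (hε : 0 < ε) (a : ℝ) :
    |√(invExc E₀ ε a)| ≤ √ε⁻¹ := by
  rw [abs_of_nonneg (Real.sqrt_nonneg _)]; exact Real.sqrt_le_sqrt (invExc_le E₀ hε a)

variable [CompleteSpace 𝓗]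

variable (P) in
lemma exists_invExc_sqrt (E₀ : ℝ) {ε : ℝ} (hε : 0 < ε) : ∃ q r : 𝓗 →L[ℂ] 𝓗,
    IsFC P (invExc E₀ ε) q ∧ (r : 𝓗 →ₗ[ℂ] 𝓗).IsSymmetric ∧ r ∘L r = q := by
  have hm : Measurable fun a => √(invExc E₀ ε a) := (measurable_invExc E₀ ε).sqrt
  obtain ⟨q, hq⟩ := exists_isFC (P := P) (measurable_invExc E₀ ε) (abs_invExc_le E₀ hε)
  obtain ⟨r, hr⟩ := exists_isFC (P := P) hm (abs_sqrt_invExc_le E₀ hε)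
  refine ⟨q, r, hq, hr.isSymmetric, ?_⟩
  refine ((hr.mul hm (abs_sqrt_invExc_le E₀ hε) hm (abs_sqrt_invExc_le E₀ hε) hr).congr
    fun x => Filter.Eventually.of_forall fun a => ?_).unique hq
  exact Real.mul_self_sqrt (invExc_nonneg E₀ hε a)

lemma norm_invExc_le {E₀ ε ω : ℝ} (hε : 0 < ε) (hω : 0 < ω) {q : 𝓗 →L[ℂ] 𝓗}
    (hq : IsFC P (invExc E₀ ε) q) {x : 𝓗} (hx : P.proj (Set.Iio (E₀ + ω)) x = 0) :
    ‖q x‖ ≤ ω⁻¹ * ‖x‖ := by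
  refine hq.norm_le (measurable_invExc E₀ ε) (abs_invExc_le E₀ hε) (inv_pos.2 hω).le ?_
  have h0 : P.diag x (Set.Iio (E₀ + ω)) = 0 := by
    rw [P.diag_apply _ _ measurableSet_Iio, hx]; simp
  refine measure_mono_null ?_ h0
  intro a ha
  by_contra h1
  apply ha
  simp only [Set.mem_Iio, not_lt] at h1
  change |invExc E₀ ε a| ≤ ω⁻¹
  rw [abs_of_nonneg (invExc_nonneg E₀ hε a), invExc]
  split_ifs with h
  · exact inv_anti₀ hω (by linarith)
  · exact (inv_pos.2 hω).le

/-- The Laplace transform of the sine propagator, as a function of the energy. -/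
def sinLaplace (E₀ y a : ℝ) : ℝ := -((a - E₀) / (y ^ 2 + (a - E₀) ^ 2))

lemma measurable_sinLaplace (E₀ y : ℝ) : Measurable (sinLaplace E₀ y) := by
  unfold sinLaplace; fun_prop

lemma abs_sinLaplace_le (E₀ : ℝ) {y : ℝ} (hy : 0 < y) (a : ℝ) : |sinLaplace E₀ y a| ≤ y⁻¹ := by
  rw [sinLaplace, abs_neg, abs_div, abs_of_pos (by positivity : 0 < y ^ 2 + (a - E₀) ^ 2),
    inv_eq_one_div, div_le_div_iff₀ (by positivity) hy, ← sq_abs (a - E₀)]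
  nlinarith [sq_nonneg (y - |a - E₀|), sq_nonneg y, sq_nonneg |a - E₀|]

/-- The Laplace transform of the sine propagator is a quadratic resolvent of `q²`. -/
lemma sinLaplace_pencil {E₀ ε y : ℝ} (hε : 0 < ε) (hy : 0 < y)
    (hspec : ∀ x, ∀ᵐ a ∂(P.diag x), a = E₀ ∨ E₀ + ε ≤ a) {q G : 𝓗 →L[ℂ] 𝓗}
    (hq : IsFC P (invExc E₀ ε) q) (hG : IsFC P (sinLaplace E₀ y) G) (x : 𝓗) :
    G (x + (y : ℂ) ^ 2 • q (q x)) = -q x := by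
  have hqq := hq.mul (measurable_invExc E₀ ε) (abs_invExc_le E₀ hε) (measurable_invExc E₀ ε)
    (abs_invExc_le E₀ hε) hq
  have hmm : Measurable fun a => invExc E₀ ε a * invExc E₀ ε a :=
    (measurable_invExc E₀ ε).mul (measurable_invExc E₀ ε)
  have hbb : ∀ a, |invExc E₀ ε a * invExc E₀ ε a| ≤ ε⁻¹ * ε⁻¹ := fun a => by
    rw [abs_mul]
    exact mul_le_mul (abs_invExc_le E₀ hε a) (abs_invExc_le E₀ hε a) (abs_nonneg _)
      (inv_pos.2 hε).le
  have h1 := hG.mul (measurable_sinLaplace E₀ y) (abs_sinLaplace_le E₀ hy) hmm hbb hqq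
  have h2 : IsFC P (fun a => sinLaplace E₀ y a + y ^ 2 *
      (sinLaplace E₀ y a * (invExc E₀ ε a * invExc E₀ ε a)))
        (G + ((y ^ 2 : ℝ) : ℂ) • (G ∘L (q ∘L q))) := by
    refine hG.add (fun x => integrable_diag P (measurable_sinLaplace E₀ y) (abs_sinLaplace_le E₀ hy)
      x)
      (fun x => ?_) (h1.const_mul _)
    exact ((integrable_diag P hmm hbb x).bdd_mul (measurable_sinLaplace E₀ y).aestronglyMeasurable
      (Filter.Eventually.of_forall (abs_sinLaplace_le E₀ hy))).const_mul _
  have h3 : IsFC P (fun a => -1 * invExc E₀ ε a) (G + ((y ^ 2 : ℝ) : ℂ) • (G ∘L (q ∘L q))) := by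
    refine h2.congr fun x => ?_
    filter_upwards [hspec x] with a ha
    rcases ha with rfl | ha
    · simp [sinLaplace, invExc, hε.not_ge]
    · have h4 : 0 < a - E₀ := by linarith
      rw [sinLaplace, invExc, if_pos ha]
      field_simp
      ring
  have h5 := congrArg (fun T : 𝓗 →L[ℂ] 𝓗 => T x) (h3.unique (hq.const_mul (-1)))
  simpa using h5

variable {E₀ : ℝ} {sinOp : ℝ → (𝓗 →L[ℂ] 𝓗)}

lemma measurable_sin_exc (E₀ t : ℝ) : Measurable fun a => Real.sin (t * (E₀ - a)) := by fun_prop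

lemma isFC_sinOp (hsin : ∀ (t : ℝ) (x : 𝓗),
      ⟪x, sinOp t x⟫_ℂ = ∫ lam : ℝ, ((Real.sin (t * (E₀ - lam)) : ℝ) : ℂ) ∂(P.diag x)) (t : ℝ) :
    IsFC P (fun a => Real.sin (t * (E₀ - a))) (sinOp t) := by
  obtain ⟨T, hT⟩ := exists_isFC (P := P) (measurable_sin_exc E₀ t) fun a => Real.abs_sin_le_one _
  have : sinOp t = T := eq_of_inner_right fun x => by
    rw [hsin, hT.inner_self, integral_complex_ofReal]
  rwa [this]

lemma norm_sinOp_le (hsin : ∀ t, IsFC P (fun a => Real.sin (t * (E₀ - a))) (sinOp t)) (t : ℝ)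
    (x : 𝓗) :
    ‖sinOp t x‖ ≤ ‖x‖ := by
  simpa using (hsin t).norm_le (measurable_sin_exc E₀ t) (fun a => Real.abs_sin_le_one _)
    zero_le_one (Filter.Eventually.of_forall fun a => Real.abs_sin_le_one _)

lemma continuous_sinOp (hsin : ∀ t, IsFC P (fun a => Real.sin (t * (E₀ - a))) (sinOp t)) (x : 𝓗) :
    Continuous fun t => sinOp t x := by
  rw [continuous_iff_continuousAt]
  intro s
  rw [ContinuousAt, tendsto_iff_norm_sub_tendsto_zero]
  have hi : ∀ t x, Integrable (fun a => Real.sin (t * (E₀ - a))) (P.diag x) := fun t x =>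
    integrable_diag P (measurable_sin_exc E₀ t) (fun a => Real.abs_sin_le_one _) x
  have h1 : ∀ t, ‖sinOp t x - sinOp s x‖ ^ 2 =
      ∫ a, (Real.sin (t * (E₀ - a)) - Real.sin (s * (E₀ - a))) *
        (Real.sin (t * (E₀ - a)) - Real.sin (s * (E₀ - a))) ∂(P.diag x) := by
    intro t
    have h2 := (hsin t).sub (hi t) (hi s) (hsin s)
    refine h2.norm_sq (C := 2) ((measurable_sin_exc E₀ t).sub (measurable_sin_exc E₀ s))
      (fun a => ?_) x
    have h3 := abs_le.1 (Real.abs_sin_le_one (t * (E₀ - a)))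
    have h4 := abs_le.1 (Real.abs_sin_le_one (s * (E₀ - a)))
    change |Real.sin (t * (E₀ - a)) - Real.sin (s * (E₀ - a))| ≤ 2
    rw [abs_le]; constructor <;> linarith [h3.1, h3.2, h4.1, h4.2]
  have h5 : Filter.Tendsto (fun t => ‖sinOp t x - sinOp s x‖ ^ 2) (nhds s) (nhds 0) := by
    simp only [h1]
    have h6 : (0 : ℝ) = ∫ a, (0 : ℝ) ∂(P.diag x) := by simp
    rw [h6]
    refine tendsto_integral_filter_of_dominated_convergence (fun _ => 4) ?_ ?_ (integrable_const _)
      ?_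
    · refine Filter.Eventually.of_forall fun t => Measurable.aestronglyMeasurable ?_
      exact ((measurable_sin_exc E₀ t).sub (measurable_sin_exc E₀ s)).mul
        ((measurable_sin_exc E₀ t).sub (measurable_sin_exc E₀ s))
    · refine Filter.Eventually.of_forall fun t => Filter.Eventually.of_forall fun a => ?_
      have h3 := abs_le.1 (Real.abs_sin_le_one (t * (E₀ - a)))
      have h4 := abs_le.1 (Real.abs_sin_le_one (s * (E₀ - a)))
      rw [Real.norm_of_nonneg (mul_self_nonneg _)]
      nlinarith [h3.1, h3.2, h4.1, h4.2]
    · refine Filter.Eventually.of_forall fun a => ?_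
      have hc : Continuous fun t => (Real.sin (t * (E₀ - a)) - Real.sin (s * (E₀ - a))) *
        (Real.sin (t * (E₀ - a)) - Real.sin (s * (E₀ - a))) := by fun_prop
      simpa using hc.tendsto s
  have h6 := h5.sqrt
  simpa [Real.sqrt_sq] using h6

lemma integrableOn_exp_sinOp (hsin : ∀ t, IsFC P (fun a => Real.sin (t * (E₀ - a))) (sinOp t))
    {y : ℝ} (hy : 0 < y) (x : 𝓗) :
    IntegrableOn (fun t => (Real.exp (-y * t) : ℂ) • sinOp t x) (Set.Ioi 0) := by
  refine Integrable.mono' (g := fun t => Real.exp (-y * t) * ‖x‖) ?_ ?_ ?_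
  · exact (exp_neg_integrableOn_Ioi 0 hy).mul_const _
  · refine Continuous.aestronglyMeasurable ?_
    have := continuous_sinOp hsin x
    fun_prop
  · refine Filter.Eventually.of_forall fun t => ?_
    rw [norm_smul, Complex.norm_real, Real.norm_of_nonneg (Real.exp_pos _).le]
    gcongr
    exact norm_sinOp_le hsin t x

lemma integral_exp_mul_sin {y : ℝ} (hy : 0 < y) (b : ℝ) :
    ∫ t in Set.Ioi (0 : ℝ), Real.exp (-y * t) * Real.sin (t * b) = b / (y ^ 2 + b ^ 2) := by
  have h1 := integral_exp_mul_complex_Ioi (a := (-y : ℂ) + b * I) (by simpa using hy) 0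
  have hInt : IntegrableOn (fun t : ℝ => Complex.exp (((-y : ℂ) + b * I) * t)) (Set.Ioi 0) :=
    integrableOn_exp_mul_complex_Ioi (by simpa using hy) 0
  have h2 := congrArg Complex.im h1
  have h3 := Complex.imCLM.integral_comp_comm hInt
  simp only [Complex.imCLM_apply] at h3
  rw [← h3] at h2
  have h4 : ∀ t : ℝ, (Complex.exp (((-y : ℂ) + b * I) * t)).im = Real.exp (-y * t) * Real.sin
      (t * b) := by
    intro t
    rw [Complex.exp_im]
    simp [mul_comm]
  simp only [h4] at h2
  rw [h2]
  simp only [Complex.ofReal_zero, mul_zero, Complex.exp_zero]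
  rw [Complex.div_im]
  simp [Complex.normSq_apply]
  ring

/-- The Laplace transform of the sine propagator. -/
lemma integral_exp_sinOp (hsin : ∀ t, IsFC P (fun a => Real.sin (t * (E₀ - a))) (sinOp t))
    {y : ℝ} (hy : 0 < y) {G : 𝓗 →L[ℂ] 𝓗} (hG : IsFC P (sinLaplace E₀ y) G) (x : 𝓗) :
    ∫ t in Set.Ioi (0 : ℝ), (Real.exp (-y * t) : ℂ) • sinOp t x = G x := by
  let L : 𝓗 →ₗ[ℂ] 𝓗 :=
    { toFun := fun x => ∫ t in Set.Ioi (0 : ℝ), (Real.exp (-y * t) : ℂ) • sinOp t x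
      map_add' := fun a b => by
        rw [← integral_add (integrableOn_exp_sinOp hsin hy a) (integrableOn_exp_sinOp hsin hy b)]
        simp
      map_smul' := fun c a => by
        rw [RingHom.id_apply, ← integral_smul]
        simp [smul_comm c] }
  suffices h : L = (G : 𝓗 →ₗ[ℂ] 𝓗) from congrArg (fun T : 𝓗 →ₗ[ℂ] 𝓗 => T x) h
  refine (ext_inner_map _ _).1 fun x => ?_
  have hdiag : ⟪x, L x⟫_ℂ = ⟪x, G x⟫_ℂ := by
    change ⟪x, ∫ t in Set.Ioi (0 : ℝ), (Real.exp (-y * t) : ℂ) • sinOp t x⟫_ℂ = _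
    rw [← integral_inner (integrableOn_exp_sinOp hsin hy x), hG.inner_self]
    simp only [inner_smul_right, (hsin _).inner_self]
    simp only [← Complex.ofReal_mul, ← integral_const_mul]
    rw [integral_complex_ofReal]
    congr 1
    rw [integral_integral_swap]
    · refine integral_congr_ae (Filter.Eventually.of_forall fun a => ?_)
      change ∫ t in Set.Ioi (0 : ℝ), Real.exp (-y * t) * Real.sin (t * (E₀ - a)) = _
      rw [integral_exp_mul_sin hy, sinLaplace, ← neg_div, neg_sub, ← neg_sub E₀ a, neg_sq]
    · have h1 : Integrable (fun z : ℝ × ℝ => Real.exp (-y * z.1) * 1)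
          ((volume.restrict (Set.Ioi 0)).prod (P.diag x)) :=
        (exp_neg_integrableOn_Ioi 0 hy).mul_prod (integrable_const 1)
      refine h1.mono' (Continuous.aestronglyMeasurable (by fun_prop))
        (Filter.Eventually.of_forall fun z => ?_)
      change ‖Real.exp (-y * z.1) * Real.sin (z.1 * (E₀ - z.2))‖ ≤ _
      rw [norm_mul, Real.norm_of_nonneg (Real.exp_pos _).le]
      gcongr
      exact Real.abs_sin_le_one _
  rw [← inner_conj_symm, hdiag, inner_conj_symm]
  rfl

end Spectral

end RPAShift

namespace RPAShift

/-! ### Positivity of the Hartree kernel -/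

section Kernel

variable {α β : Type*} [MeasurableSpace α] [MeasurableSpace β]

/-- A kernel of the form `k(x, y) = ∫ φ(p, x) φ(p, y) dp` is positive semidefinite. -/
lemma integral_conj_kernel_nonneg {μ : Measure α} {ν : Measure β} [SFinite μ] [SFinite ν]
    {φ : β → α → ℝ} (hφm : Measurable (Function.uncurry φ)) (hφ : ∀ p x, 0 ≤ φ p x)
    {k : α → α → ℝ} {u : α → ℂ} (hu : AEStronglyMeasurable u μ)
    (hk : ∀ᵐ z : α × α ∂μ.prod μ, Integrable (fun p => φ p z.1 * φ p z.2) ν ∧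
      ∫ p, φ p z.1 * φ p z.2 ∂ν = k z.1 z.2)
    (hInt : Integrable (fun z : α × α => k z.1 z.2 * (‖u z.1‖ * ‖u z.2‖)) (μ.prod μ)) :
    ∃ c : ℝ, 0 ≤ c ∧
      ∫ x, (starRingEnd ℂ) (∫ y, (k x y : ℂ) * u y ∂μ) * u x ∂μ = (c : ℂ) := by
  set F : (α × α) × β → ℂ := fun q =>
    ((φ q.2 q.1.1 * φ q.2 q.1.2 : ℝ) : ℂ) * (u q.1.1 * (starRingEnd ℂ) (u q.1.2)) with hF
  have huu : AEStronglyMeasurable (fun z : α × α => u z.1 * (starRingEnd ℂ) (u z.2)) (μ.prod μ) :=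
    hu.comp_fst.mul ((Complex.continuous_conj.comp_aestronglyMeasurable hu).comp_snd)
  have hFm : AEStronglyMeasurable F ((μ.prod μ).prod ν) := by
    refine AEStronglyMeasurable.mul (β := ℂ) ?_ huu.comp_fst
    have h1 : Measurable fun q : (α × α) × β => φ q.2 q.1.1 :=
      hφm.comp (measurable_snd.prodMk (measurable_fst.comp measurable_fst))
    have h2 : Measurable fun q : (α × α) × β => φ q.2 q.1.2 :=
      hφm.comp (measurable_snd.prodMk (measurable_snd.comp measurable_fst))
    exact (Complex.measurable_ofReal.comp (h1.mul h2)).aestronglyMeasurable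
  have hFi : Integrable F ((μ.prod μ).prod ν) := by
    refine (integrable_prod_iff hFm).2 ⟨?_, ?_⟩
    · filter_upwards [hk] with z hz
      exact (hz.1.ofReal (𝕜 := ℂ)).mul_const (u z.1 * (starRingEnd ℂ) (u z.2))
    · refine hInt.congr ?_
      filter_upwards [hk] with z hz
      have : ∀ p, ‖F (z, p)‖ = φ p z.1 * φ p z.2 * (‖u z.1‖ * ‖u z.2‖) := by
        intro p
        simp only [hF, norm_mul, RCLike.norm_conj, Complex.norm_real,
          Real.norm_of_nonneg (hφ _ _)]
      simp only [this]
      rw [integral_mul_const, hz.2]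
  have hinner : ∀ᵐ z : α × α ∂μ.prod μ,
      ∫ p, F (z, p) ∂ν = (k z.1 z.2 : ℂ) * (u z.1 * (starRingEnd ℂ) (u z.2)) := by
    filter_upwards [hk] with z hz
    simp only [hF]
    rw [integral_mul_const, integral_complex_ofReal, hz.2]
  have hG : Integrable (fun z : α × α => (k z.1 z.2 : ℂ) * (u z.1 * (starRingEnd ℂ) (u z.2)))
      (μ.prod μ) := hFi.integral_prod_left.congr hinner
  refine ⟨∫ p, Complex.normSq (∫ x, (φ p x : ℂ) * u x ∂μ) ∂ν,
    integral_nonneg fun p => Complex.normSq_nonneg _, ?_⟩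
  calc ∫ x, (starRingEnd ℂ) (∫ y, (k x y : ℂ) * u y ∂μ) * u x ∂μ
      = ∫ x, ∫ y, (k x y : ℂ) * (u x * (starRingEnd ℂ) (u y)) ∂μ ∂μ := by
        congr 1; ext x
        rw [← integral_conj, ← integral_mul_const]
        congr 1; ext y
        simp only [map_mul, Complex.conj_ofReal]
        ring
    _ = ∫ z : α × α, ∫ p, F (z, p) ∂ν ∂μ.prod μ := by
        rw [integral_congr_ae hinner, integral_prod _ hG]
    _ = ∫ p, ∫ z : α × α, F (z, p) ∂μ.prod μ ∂ν := integral_integral_swap hFi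
    _ = _ := by
        rw [← integral_complex_ofReal]
        congr 1; ext p
        have : ∀ z : α × α, F (z, p) = ((φ p z.1 : ℂ) * u z.1) *
            (starRingEnd ℂ) ((φ p z.2 : ℂ) * u z.2) := by
          intro z
          simp only [hF, map_mul, Complex.conj_ofReal, Complex.ofReal_mul]
          ring
        simp only [this]
        rw [integral_prod_mul (fun x => (φ p x : ℂ) * u x)
          (fun x => (starRingEnd ℂ) ((φ p x : ℂ) * u x)), integral_conj, Complex.mul_conj]

end Kernel

/-- The constant in the Gaussian subordination of the Coulomb kernel. -/
def coulombConst : ℝ := (Real.pi / 2) ^ (3 / 2 : ℝ) *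
  ((1 / 2 : ℝ)⁻¹ ^ (1 / 2 : ℝ) * Real.Gamma (1 / 2))

lemma coulombConst_pos : 0 < coulombConst := by
  unfold coulombConst
  have := Real.Gamma_pos_of_pos (s := 1 / 2) (by norm_num)
  positivity

/-- Gaussian factors of the Coulomb kernel. -/
def gaussFactor (p : ℝ × R3) (x : R3) : ℝ := √p.1 * Real.exp (-p.1 * ‖x - p.2‖ ^ 2)

lemma gaussFactor_mul {s : ℝ} (hs : 0 < s) (x y z : R3) :
    gaussFactor (s, z) x * gaussFactor (s, z) y =
      s * Real.exp (-(s / 2) * ‖x - y‖ ^ 2) *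
        Real.exp (-(2 * s) * ‖z - (1 / 2 : ℝ) • (x + y)‖ ^ 2) := by
  have h := parallelogram_law_with_norm_mul (𝕜 := ℝ) (x - z) (y - z)
  have h1 : x - z + (y - z) = (-2 : ℝ) • (z - (1 / 2 : ℝ) • (x + y)) := by module
  have h2 : x - z - (y - z) = x - y := by abel
  rw [h1, h2, norm_smul, Real.norm_eq_abs, abs_neg, abs_two] at h
  simp only [gaussFactor]
  rw [mul_mul_mul_comm, Real.mul_self_sqrt hs.le, mul_assoc s, ← Real.exp_add, ← Real.exp_add]
  congr 2
  linear_combination (s / 2) * h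

lemma integral_gaussFactor_mul {s : ℝ} (hs : 0 < s) (x y : R3) :
    Integrable (fun z => gaussFactor (s, z) x * gaussFactor (s, z) y) ∧
    ∫ z, gaussFactor (s, z) x * gaussFactor (s, z) y =
      (Real.pi / 2) ^ (3 / 2 : ℝ) *
        (s ^ (1 / 2 - 1 : ℝ) * Real.exp (-(1 / 2 * ‖x - y‖ ^ 2 * s))) := by
  have hG := GaussianFourier.integral_rexp_neg_mul_sq_norm (V := R3) (b := 2 * s) (by positivity)
  simp only [gaussFactor_mul hs]
  have hI : Integrable (fun z : R3 => Real.exp (-(2 * s) * ‖z‖ ^ 2)) := by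
    refine Integrable.of_integral_ne_zero ?_
    rw [hG]
    positivity
  refine ⟨(hI.comp_sub_right ((1 / 2 : ℝ) • (x + y))).const_mul _, ?_⟩
  rw [integral_const_mul, integral_sub_right_eq_self (fun z : R3 => Real.exp (-(2 * s) * ‖z‖ ^ 2)),
    hG]
  have h3 : ((Module.finrank ℝ R3 : ℕ) : ℝ) = 3 := by simp
  rw [h3]
  have h4 : Real.pi / (2 * s) = (Real.pi / 2) * s⁻¹ := by field_simp
  rw [h4, Real.mul_rpow (by positivity) (by positivity), Real.inv_rpow hs.le, ← Real.rpow_neg hs.le]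
  have h5 : s ^ (1 / 2 - 1 : ℝ) = s * s ^ (-(3 / 2) : ℝ) := by
    rw [← Real.rpow_one_add' hs.le (by norm_num)]; norm_num
  rw [h5]
  have h6 : -(s / 2) * ‖x - y‖ ^ 2 = -(1 / 2 * ‖x - y‖ ^ 2 * s) := by ring
  rw [h6]
  ring

lemma measurable_gaussFactor : Measurable (Function.uncurry gaussFactor) := by
  have : Continuous (Function.uncurry gaussFactor) := by
    unfold gaussFactor Function.uncurry
    fun_prop
  exact this.measurable

lemma gaussFactor_nonneg (p : ℝ × R3) (x : R3) : 0 ≤ gaussFactor p x := by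
  unfold gaussFactor; positivity

/-- Gaussian subordination of the Coulomb kernel. -/
lemma integral_gaussFactor_mul_prod {x y : R3} (hxy : x ≠ y) :
    Integrable (fun p => gaussFactor p x * gaussFactor p y)
      ((volume.restrict (Set.Ioi (0 : ℝ))).prod (volume : Measure R3)) ∧
    ∫ p, gaussFactor p x * gaussFactor p y
      ∂((volume.restrict (Set.Ioi (0 : ℝ))).prod (volume : Measure R3)) =
      coulombConst * ‖x - y‖⁻¹ := by
  have hd : 0 < ‖x - y‖ := norm_pos_iff.2 (sub_ne_zero.2 hxy)
  have hr : 0 < 1 / 2 * ‖x - y‖ ^ 2 := by positivity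
  have hS := Real.integral_rpow_mul_exp_neg_mul_Ioi (a := 1 / 2) (by norm_num) hr
  have hΓ := Real.Gamma_pos_of_pos (s := 1 / 2) (by norm_num)
  have hSi : IntegrableOn (fun s : ℝ => s ^ (1 / 2 - 1 : ℝ) *
      Real.exp (-(1 / 2 * ‖x - y‖ ^ 2 * s))) (Set.Ioi 0) := by
    refine Integrable.of_integral_ne_zero ?_
    rw [hS]
    positivity
  have hae : ∀ᵐ s ∂volume.restrict (Set.Ioi (0 : ℝ)), 0 < s := ae_restrict_mem measurableSet_Ioi
  have hm : Measurable fun p : ℝ × R3 => gaussFactor p x * gaussFactor p y :=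
    (measurable_gaussFactor.comp (measurable_id.prodMk measurable_const)).mul
      (measurable_gaussFactor.comp (measurable_id.prodMk measurable_const))
  have hInt : Integrable (fun p => gaussFactor p x * gaussFactor p y)
      ((volume.restrict (Set.Ioi (0 : ℝ))).prod (volume : Measure R3)) := by
    refine (integrable_prod_iff hm.aestronglyMeasurable).2 ⟨?_, ?_⟩
    · filter_upwards [hae] with s hs
      exact (integral_gaussFactor_mul hs x y).1
    · refine (hSi.const_mul ((Real.pi / 2) ^ (3 / 2 : ℝ))).congr ?_
      filter_upwards [hae] with s hs
      simp only [norm_mul, Real.norm_of_nonneg (gaussFactor_nonneg _ _)]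
      exact (integral_gaussFactor_mul hs x y).2.symm
  refine ⟨hInt, ?_⟩
  rw [integral_prod _ hInt, integral_congr_ae (g := fun s : ℝ => (Real.pi / 2) ^ (3 / 2 : ℝ) *
        (s ^ (1 / 2 - 1 : ℝ) * Real.exp (-(1 / 2 * ‖x - y‖ ^ 2 * s))))
      (by filter_upwards [hae] with s hs using (integral_gaussFactor_mul hs x y).2),
    integral_const_mul, hS, coulombConst, one_div (1 / 2 * ‖x - y‖ ^ 2), mul_inv,
    Real.mul_rpow (by positivity) (by positivity)]
  have : ((‖x - y‖ ^ 2)⁻¹ : ℝ) ^ (1 / 2 : ℝ) = ‖x - y‖⁻¹ := by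
    rw [← inv_pow, ← Real.sqrt_eq_rpow, Real.sqrt_sq (by positivity)]
  rw [this]
  ring

lemma integrable_indicator_norm_inv_sq :
    Integrable ((Metric.ball (0 : R3) 1).indicator fun x => (‖x‖ ^ 2)⁻¹) := by
  rw [integrable_indicator_iff measurableSet_ball]
  refine (integrableOn_fun_norm_addHaar (volume : Measure R3) (f := fun t : ℝ => (t ^ 2)⁻¹)).2 ?_
  have h : IntegrableOn (fun _ : ℝ => (1 : ℝ)) (Set.Ioo 0 1) := by simp
  refine h.congr_fun (fun t ht => ?_) measurableSet_Ioo
  have : t ≠ 0 := ht.1.ne'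
  simp [this]

lemma integrable_coulomb {u : R3 → ℂ} (h1 : Integrable u) (h2 : MemLp u 2) :
    Integrable (fun z : R3 × R3 => ‖z.1 - z.2‖⁻¹ * (‖u z.1‖ * ‖u z.2‖))
      ((volume : Measure R3).prod volume) := by
  set h : R3 → ℝ := (Metric.ball (0 : R3) 1).indicator fun x => (‖x‖ ^ 2)⁻¹ with hh
  have i1 := h1.norm.mul_prod h1.norm
  have i2 := ((memLp_two_iff_integrable_sq_norm h1.1).1 h2).mul_prod h1.norm
  have i3 := h1.norm.convolution_integrand (ContinuousLinearMap.mul ℝ ℝ)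
    (integrable_indicator_norm_inv_sq)
  refine ((i1.add i2).add i3).mono' ?_ (Filter.Eventually.of_forall fun z => ?_)
  · refine AEStronglyMeasurable.mul ?_ (h1.norm.1.comp_fst.mul h1.norm.1.comp_snd)
    exact ((measurable_fst.sub measurable_snd).norm.inv).aestronglyMeasurable
  · simp only [norm_mul, norm_inv, norm_norm, Pi.add_apply, ContinuousLinearMap.mul_apply']
    have hb : ‖z.1 - z.2‖⁻¹ * ‖u z.1‖ ≤ ‖u z.1‖ + ‖u z.1‖ ^ 2 + h (z.1 - z.2) := by
      by_cases hz : z.1 - z.2 ∈ Metric.ball (0 : R3) 1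
      · rw [hh, Set.indicator_of_mem hz, ← inv_pow]
        nlinarith [sq_nonneg (‖z.1 - z.2‖⁻¹ - ‖u z.1‖), norm_nonneg (u z.1),
          sq_nonneg ‖z.1 - z.2‖⁻¹, sq_nonneg ‖u z.1‖]
      · rw [hh, Set.indicator_of_notMem hz]
        have hge : 1 ≤ ‖z.1 - z.2‖ := by simpa using hz
        have := mul_le_mul_of_nonneg_right (inv_le_one_of_one_le₀ hge) (norm_nonneg (u z.1))
        nlinarith [sq_nonneg ‖u z.1‖]
    have := mul_le_mul_of_nonneg_right hb (norm_nonneg (u z.2))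
    linarith

/-- The Coulomb energy of a function in `L¹ ∩ L²` is nonnegative. -/
lemma coulomb_energy_nonneg {u : R3 → ℂ} (h1 : Integrable u) (h2 : MemLp u 2) :
    ∃ c : ℝ, 0 ≤ c ∧
      ∫ x : R3, (starRingEnd ℂ) (∫ y : R3, ((‖x - y‖ : ℂ))⁻¹ * u y) * u x = (c : ℂ) := by
  have hne : ∀ᵐ z : R3 × R3 ∂(volume : Measure R3).prod volume, z.1 ≠ z.2 := by
    have hm : MeasurableSet {z : R3 × R3 | z.1 ≠ z.2} :=
      (isClosed_eq continuous_fst continuous_snd).isOpen_compl.measurableSet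
    refine (Measure.ae_prod_iff_ae_ae hm).2 (Filter.Eventually.of_forall fun x => ?_)
    filter_upwards [(Set.countable_singleton x).ae_notMem (volume : Measure R3)] with y hy
    exact fun h => hy h.symm
  obtain ⟨c, hc, h⟩ := integral_conj_kernel_nonneg (μ := (volume : Measure R3))
    (k := fun x y => coulombConst * ‖x - y‖⁻¹) (u := u) measurable_gaussFactor gaussFactor_nonneg
      h1.1
    (hne.mono fun z hz => integral_gaussFactor_mul_prod hz)
    (((integrable_coulomb h1 h2).const_mul coulombConst).congr
      (Filter.Eventually.of_forall fun z => (mul_assoc _ _ _).symm))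
  have hC : (coulombConst : ℂ) ≠ 0 := by exact_mod_cast coulombConst_pos.ne'
  refine ⟨coulombConst⁻¹ * c, by have := coulombConst_pos; positivity, ?_⟩
  push_cast
  rw [← h, ← integral_const_mul]
  congr 1; ext x
  simp only [Complex.ofReal_mul, mul_assoc, integral_const_mul, map_mul, Complex.conj_ofReal,
    Complex.ofReal_inv]
  rw [inv_mul_cancel_left₀ hC]

section Hartree

variable {Smap : 𝓗 →L[ℂ] L1capL2} {Sadj : L2plusLinf →L[ℂ] 𝓗}

/-- The Hartree operator is positive. -/
lemma isPositive_hartree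
    (hSadj : ∀ (g : Lsp 2 × Lsp ∞) (x : 𝓗),
      ⟪Sadj (Submodule.Quotient.mk g : L2plusLinf), x⟫_ℂ =
        ∫ y : R3, (starRingEnd ℂ) ((g.1 : R3 → ℂ) y + (g.2 : R3 → ℂ) y) *
          (((Smap x).1.1 : R3 → ℂ) y))
    {FH : L1capL2 →L[ℂ] L2plusLinf} (hFH : IsHartree FH) :
    ((Sadj ∘L FH) ∘L Smap).IsPositive := by
  rw [ContinuousLinearMap.isPositive_iff_complex]
  intro x
  obtain ⟨g, hg, hgu⟩ := hFH (Smap x)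
  have h1 : Integrable ((Smap x).1.1 : R3 → ℂ) := L1.integrable_coeFn _
  have h2 : MemLp ((Smap x).1.1 : R3 → ℂ) 2 :=
    (memLp_congr_ae (Smap x).2).2 (Lp.memLp (Smap x).1.2)
  obtain ⟨c, hc, h⟩ := coulomb_energy_nonneg h1 h2
  have : ⟪((Sadj ∘L FH) ∘L Smap) x, x⟫_ℂ = (c : ℂ) := by
    rw [← h]
    change ⟪Sadj (FH (Smap x)), x⟫_ℂ = _
    rw [← hg, hSadj]
    refine integral_congr_ae ?_
    filter_upwards [hgu] with y hy
    rw [hy]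
  rw [this]
  exact ⟨by simp, by simpa using hc⟩

lemma inner_eq_zero_of_map_eq_zero
    (hSadj : ∀ (g : Lsp 2 × Lsp ∞) (x : 𝓗),
      ⟪Sadj (Submodule.Quotient.mk g : L2plusLinf), x⟫_ℂ =
        ∫ y : R3, (starRingEnd ℂ) ((g.1 : R3 → ℂ) y + (g.2 : R3 → ℂ) y) *
          (((Smap x).1.1 : R3 → ℂ) y))
    {x : 𝓗} (hx : Smap x = 0) (f : L2plusLinf) : ⟪Sadj f, x⟫_ℂ = 0 := by
  obtain ⟨g, rfl⟩ := Submodule.Quotient.mk_surjective _ f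
  rw [hSadj, hx]
  have h0 : ((0 : L1capL2).1.1 : R3 → ℂ) =ᵐ[volume] 0 := Lp.coeFn_zero ℂ 1 volume
  rw [integral_congr_ae (g := fun _ => (0 : ℂ))
    (by filter_upwards [h0] with y hy; rw [hy, Pi.zero_apply, mul_zero])]
  simp

end Hartree

end RPAShift

namespace RPAShift

/-! ### The interacting response function on the imaginary axis -/

section Symmetrization

variable [CompleteSpace 𝓗] {r A : 𝓗 →L[ℂ] 𝓗}

/-- The inverse square root of `1 + 2 • r A r`. -/
lemma exists_inv_sqrt (hr : (r : 𝓗 →ₗ[ℂ] 𝓗).IsSymmetric) (hA : A.IsPositive) :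
    ∃ b : 𝓗 →L[ℂ] 𝓗, b.IsPositive ∧
      (∀ x, b (b (x + (2 : ℂ) • r (A (r x)))) = x) ∧
      ∀ x, b (b x + (2 : ℂ) • r (A (r (b x)))) = x := by
  set C : 𝓗 →L[ℂ] 𝓗 := (2 : ℂ) • (r * A * r) with hC
  have hCpos : 0 ≤ C := by
    rw [ContinuousLinearMap.nonneg_iff_isPositive]
    have h1 := hA.conj_adjoint r
    have h2 : ContinuousLinearMap.adjoint r = r :=
      (ContinuousLinearMap.isSelfAdjoint_iff_isSymmetric.2 hr).adjoint_eq
    rw [h2] at h1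
    rw [hC, two_smul]
    exact h1.add h1
  have hB : IsStrictlyPositive (1 + C) := by
    have : IsStrictlyPositive (1 : 𝓗 →L[ℂ] 𝓗) := by
      refine ⟨?_, isUnit_one⟩
      rw [ContinuousLinearMap.nonneg_iff_isPositive]
      exact ContinuousLinearMap.isPositive_one
    exact this.add_nonneg hCpos
  set b : 𝓗 →L[ℂ] 𝓗 := (1 + C) ^ (-(1 / 2) : ℝ) with hb
  have h1 : b * (1 + C) * b = 1 := CFC.conjugate_rpow_neg_one_half (1 + C)
  have hbp : b.IsPositive := by
    rw [← ContinuousLinearMap.nonneg_iff_isPositive]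
    exact CFC.rpow_nonneg
  have h2 : b * (1 + C) = (1 + C) * b := left_inv_eq_right_inv h1 (by rw [← mul_assoc, h1])
  have h3 : b * (b * (1 + C)) = 1 := by rw [h2, ← mul_assoc, h1]
  refine ⟨b, hbp, fun x => ?_, fun x => ?_⟩
  · exact congrArg (fun T : 𝓗 →L[ℂ] 𝓗 => T x) h3
  · exact congrArg (fun T : 𝓗 →L[ℂ] 𝓗 => T x)
      (by rw [← mul_assoc]; exact h1 : b * ((1 + C) * b) = 1)

/-- Solving the interacting pencil equation with the symmetrized resolvent. -/
lemma eq_resolv_of_pencil {Q b : 𝓗 →L[ℂ] 𝓗} (hQ : Q.IsPositive) (hb : b.IsPositive)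
    (hbB : ∀ x, b (b (x + (2 : ℂ) • r (A (r x)))) = x) {z : ℂ} (hz : 0 < z.im) {m h : 𝓗}
    (hm : m + (2 : ℂ) • r (A (r m)) - z ^ 2 • Q m = h) :
    m = b (resolv (b ∘L Q ∘L b) z (b h)) := by
  have hQ1 : (b ∘L Q ∘L b).IsPositive := by
    have h1 := hQ.conj_adjoint b
    rwa [hb.isSelfAdjoint.adjoint_eq] at h1
  have h1 : (1 - z ^ 2 • (b ∘L Q ∘L b)) (b (m + (2 : ℂ) • r (A (r m)))) = b h := by
    rw [← hm]
    simp only [sub_apply, smul_apply, ContinuousLinearMap.comp_apply, hbB, map_sub, map_smul]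
    rfl
  rw [← h1, resolv_pencil hQ1 hz, hbB]

lemma resolv_comm {Q : 𝓗 →L[ℂ] 𝓗} (hQ : Q.IsPositive) (hrQ : ∀ x, r (Q x) = Q (r x)) {z : ℂ}
    (hz : 0 < z.im) (x : 𝓗) : r (resolv Q z x) = resolv Q z (r x) := by
  conv_rhs => rw [← pencil_resolv hQ hz x]
  have : r ((1 - z ^ 2 • Q) (resolv Q z x)) = (1 - z ^ 2 • Q) (r (resolv Q z x)) := by
    simp [hrQ]
  rw [this, resolv_pencil hQ hz]

end Symmetrization

section Laplace

variable [CompleteSpace 𝓗] {P : SpectralData 𝓗} {E₀ : ℝ} {sinOp : ℝ → (𝓗 →L[ℂ] 𝓗)}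
  {Smap : 𝓗 →L[ℂ] L1capL2} {Sadj : L2plusLinf →L[ℂ] 𝓗} {FH : L1capL2 →L[ℂ] L2plusLinf}
  {χ₀ χ : ℝ≥0 → (L2plusLinf →L[ℂ] L1capL2)}

lemma exp_I_mul_mul (y t : ℝ) :
    Complex.exp (Complex.I * ((y : ℂ) * Complex.I) * t) = (Real.exp (-y * t) : ℂ) := by
  rw [Complex.ofReal_exp]
  congr 1
  push_cast
  linear_combination ((y : ℂ) * t) * Complex.I_mul_I

/-- The reference response function on the imaginary axis. -/
lemma fourierTransform_reference
    (hsin : ∀ t, IsFC P (fun a => Real.sin (t * (E₀ - a))) (sinOp t))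
    (hχ₀ : ∀ t : ℝ≥0, χ₀ t = (2 : ℂ) • (Smap ∘L sinOp (t : ℝ) ∘L Sadj))
    {K0 : ℂ → (L2plusLinf →L[ℂ] L1capL2)} {D0 : ℝ} (hK0 : IsFourierTransformOf χ₀ K0 D0)
    {y : ℝ} (hy : 0 < y) (hyD : D0 < y) {G : 𝓗 →L[ℂ] 𝓗} (hG : IsFC P (sinLaplace E₀ y) G)
    (f : L2plusLinf) :
    K0 ((y : ℂ) * Complex.I) f = (2 : ℂ) • Smap (G (Sadj f)) := by
  refine Subtype.ext ?_
  have h := (hK0 ((y : ℂ) * Complex.I) (by simpa using hyD) f).2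
  change inclι (K0 ((y : ℂ) * Complex.I) f) = inclι ((2 : ℂ) • Smap (G (Sadj f)))
  rw [h, ← integral_exp_sinOp hsin hy hG (Sadj f)]
  have h2 := ((inclι ∘L ((2 : ℂ) • Smap)).integral_comp_comm
    (integrableOn_exp_sinOp hsin hy (Sadj f))).symm
  refine Eq.trans ?_ h2.symm
  refine setIntegral_congr_fun measurableSet_Ioi fun t ht => ?_
  simp only [exp_I_mul_mul, hχ₀, Real.coe_toNNReal _ (le_of_lt (Set.mem_Ioi.1 ht)), map_smul]
  rfl

/-- Boundedness transfers the Laplace transform of `χ(t)f` through operators into `𝓗`. -/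
lemma fourierTransform_map (hsc : SCont χ)
    {KR : ℂ → (L2plusLinf →L[ℂ] L1capL2)} {DR : ℝ} (hKR : IsFourierTransformOf χ KR DR)
    (T : L1capL2 →L[ℂ] 𝓗) {y : ℝ} (hyD : DR < y) (f : L2plusLinf) :
    IntegrableOn (fun t : ℝ => (Real.exp (-y * t) : ℂ) • T (χ t.toNNReal f)) (Set.Ioi 0) ∧
    ∫ t in Set.Ioi (0 : ℝ), (Real.exp (-y * t) : ℂ) • T (χ t.toNNReal f) =
      T (KR ((y : ℂ) * Complex.I) f) := by
  obtain ⟨hi, he⟩ := hKR ((y : ℂ) * Complex.I) (by simpa using hyD) f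
  simp only [exp_I_mul_mul] at hi he
  have hcont : Continuous fun t : ℝ => (Real.exp (-y * t) : ℂ) • T (χ t.toNNReal f) := by
    have h1 : Continuous fun t : ℝ => χ t.toNNReal f := (hsc f).comp continuous_real_toNNReal
    have h2 : Continuous fun t : ℝ => (Real.exp (-y * t) : ℂ) := by fun_prop
    exact h2.smul (T.continuous.comp h1)
  have hInt : IntegrableOn (fun t : ℝ => (Real.exp (-y * t) : ℂ) • T (χ t.toNNReal f))
      (Set.Ioi 0) := by
    refine (hi.norm.const_mul ‖T‖).mono' hcont.aestronglyMeasurable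
      (Filter.Eventually.of_forall fun t => ?_)
    rw [norm_smul, norm_smul]
    have : ‖T (χ t.toNNReal f)‖ ≤ ‖T‖ * ‖inclι (χ t.toNNReal f)‖ := T.le_opNorm _
    calc _ ≤ ‖(Real.exp (-y * t) : ℂ)‖ * (‖T‖ * ‖inclι (χ t.toNNReal f)‖) := by gcongr
      _ = _ := by ring
  refine ⟨hInt, ext_inner_left ℂ fun v => ?_⟩
  rw [← integral_inner hInt]
  obtain ⟨ℓ, hℓ, -⟩ := exists_extension_norm_eq interSub ((innerSL ℂ v) ∘L T)
  have h1 : ∀ u : L1capL2, ⟪v, T u⟫_ℂ = ℓ (inclι u) := fun u => (hℓ u).symm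
  rw [h1, he, ← ℓ.integral_comp_comm hi]
  refine integral_congr_ae (Filter.Eventually.of_forall fun t => ?_)
  simp only [inner_smul_right, h1, map_smul, smul_eq_mul]

/-- The Dyson equation on the imaginary axis. -/
lemma fourierTransform_dyson
    (hsin : ∀ t, IsFC P (fun a => Real.sin (t * (E₀ - a))) (sinOp t))
    (hχ₀ : ∀ t : ℝ≥0, χ₀ t = (2 : ℂ) • (Smap ∘L sinOp (t : ℝ) ∘L Sadj))
    (hsc : SCont χ) (hdy : SolvesDyson FH χ₀ χ)
    {K0 KR : ℂ → (L2plusLinf →L[ℂ] L1capL2)} {D0 DR : ℝ} (hK0 : IsFourierTransformOf χ₀ K0 D0)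
    (hKR : IsFourierTransformOf χ KR DR)
    {y : ℝ} (hy : 0 < y) (hyD0 : D0 < y) (hyDR : DR < y) (f : L2plusLinf) :
    KR ((y : ℂ) * Complex.I) f = K0 ((y : ℂ) * Complex.I)
      (f + FH (KR ((y : ℂ) * Complex.I) f)) := by
  obtain ⟨G, hG⟩ := exists_isFC (P := P) (measurable_sinLaplace E₀ y)
    (fun a => abs_sinLaplace_le E₀ hy a)
  obtain ⟨hi, he⟩ := fourierTransform_map hsc hKR (Sadj ∘L FH) hyDR f
  refine Subtype.ext ?_
  change inclι _ = inclι _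
  rw [map_add, fourierTransform_reference hsin hχ₀ hK0 hy hyD0 hG (FH _), map_add]
  refine (SeparatingDual.eq_iff_forall_dual_eq (R := ℂ)).2 fun ℓ => ?_
  obtain ⟨a, ha⟩ : ∃ a : 𝓗, ∀ x, ℓ (inclι ((2 : ℂ) • Smap x)) = ⟪a, x⟫_ℂ :=
    ⟨(InnerProductSpace.toDual ℂ 𝓗).symm (ℓ ∘L inclι ∘L ((2 : ℂ) • Smap)), fun x => by
      rw [InnerProductSpace.toDual_symm_apply]; rfl⟩
  rw [map_add, ha]
  let _ : NormedSpace ℝ 𝓗 := NormedSpace.restrictScalars ℝ ℂ 𝓗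
  have : IsScalarTower ℝ ℂ 𝓗 := IsScalarTower.restrictScalars ℝ ℂ 𝓗
  set g : ℝ → 𝓗 := fun t => (Real.exp (-y * t) : ℂ) • sinOp t a with hg
  set h : ℝ → 𝓗 := fun s => (Real.exp (-y * s) : ℂ) • (Sadj ∘L FH) (χ s.toNNReal f) with hh
  have hconv := integral_posConvolution (μ := volume) (ν := volume) hi
    (integrableOn_exp_sinOp hsin hy a)
    ((isBoundedBilinearMap_inner (𝕜 := ℂ) (E := 𝓗)).toContinuousLinearMap.flip)
  change ∫ t in Set.Ioi (0 : ℝ), ∫ s in (0 : ℝ)..t, ⟪g (t - s), h s⟫_ℂ =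
    ⟪∫ t in Set.Ioi (0 : ℝ), g t, ∫ s in Set.Ioi (0 : ℝ), h s⟫_ℂ at hconv
  rw [he, integral_exp_sinOp hsin hy hG] at hconv
  have hGs : ⟪G a, (Sadj ∘L FH) (KR ((y : ℂ) * Complex.I) f)⟫_ℂ =
      ⟪a, G (Sadj (FH (KR ((y : ℂ) * Complex.I) f)))⟫_ℂ := hG.isSymmetric a _
  rw [← hGs, ← hconv]
  obtain ⟨hi0, he0⟩ := hK0 ((y : ℂ) * Complex.I) (by simpa using hyD0) f
  obtain ⟨hiR, heR⟩ := hKR ((y : ℂ) * Complex.I) (by simpa using hyDR) f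
  rw [he0, heR, ← ℓ.integral_comp_comm hi0, ← ℓ.integral_comp_comm hiR, ← sub_eq_iff_eq_add',
    ← integral_sub (ℓ.integrable_comp hiR) (ℓ.integrable_comp hi0)]
  refine setIntegral_congr_fun measurableSet_Ioi fun t ht => ?_
  have ht' : 0 ≤ t := le_of_lt (Set.mem_Ioi.1 ht)
  obtain ⟨hdi, hde⟩ := hdy t.toNNReal f
  rw [Real.coe_toNNReal _ ht'] at hdi hde
  simp only [exp_I_mul_mul, hde, smul_add, map_add, add_sub_cancel_left, map_smul]
  rw [← ℓ.intervalIntegral_comp_comm hdi, ← intervalIntegral.integral_smul]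
  refine intervalIntegral.integral_congr fun s hs => ?_
  rw [Set.uIcc_of_le ht'] at hs
  have hs' : ((t.toNNReal - s.toNNReal : ℝ≥0) : ℝ) = t - s := by
    rw [NNReal.coe_sub (Real.toNNReal_le_toNNReal hs.2), Real.coe_toNNReal _ ht',
      Real.coe_toNNReal _ hs.1]
  have h1 : ℓ (inclι (χ₀ (t.toNNReal - s.toNNReal) (FH (χ s.toNNReal f)))) =
      ⟪sinOp (t - s) a, (Sadj ∘L FH) (χ s.toNNReal f)⟫_ℂ := by
    rw [hχ₀, hs']
    have := (hsin (t - s)).isSymmetric a ((Sadj ∘L FH) (χ s.toNNReal f))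
    refine Eq.trans ?_ this.symm
    exact ha _
  simp only [hg, hh]
  rw [h1, inner_smul_left, inner_smul_right, Complex.conj_ofReal, smul_eq_mul, ← mul_assoc,
    ← Complex.ofReal_mul, ← Real.exp_add]
  congr 4
  ring

end Laplace

end RPAShift

namespace RPAShift

/-! ### Comparison of the poles -/

section Identity

variable [CompleteSpace 𝓗] {E F : Type*} [NormedAddCommGroup E] [NormedSpace ℂ E]
  [NormedAddCommGroup F] [NormedSpace ℂ F] {K : ℂ → (E →L[ℂ] F)}
  {W' : 𝓗 →L[ℂ] F} {Q : 𝓗 →L[ℂ] 𝓗} {W : E →L[ℂ] 𝓗}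

/-- Analytic continuation of a response function from the imaginary axis. -/
lemma isResponse_of_imag (hQ : Q.IsPositive) (hK : ∀ z : ℂ, 0 < z.im → AnalyticAt ℂ K z) (D : ℝ)
    (h : ∀ y : ℝ, 0 < y → D < y → ∀ f,
      K ((y : ℂ) * I) f = (-2 : ℂ) • W' (resolv Q ((y : ℂ) * I) (W f))) :
    IsResponse K W' Q W := by
  set U : Set ℂ := {z | 0 < z.im} with hU
  have h2 : AnalyticOnNhd ℂ (fun z => (-2 : ℂ) • (W' ∘L resolv Q z ∘L W)) U := by
    intro z hz
    have h3 : AnalyticAt ℂ (fun A : 𝓗 →L[ℂ] 𝓗 => ((ContinuousLinearMap.compL ℂ E 𝓗 F W') ∘L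
      ((ContinuousLinearMap.compL ℂ E 𝓗 𝓗).flip W)) A) (resolv Q z) :=
      ContinuousLinearMap.analyticAt _ _
    have h4 : AnalyticAt ℂ (fun z => W' ∘L resolv Q z ∘L W) z :=
      AnalyticAt.fun_comp (f := resolv Q) h3 (analyticAt_resolv hQ hz)
    exact AnalyticAt.smul (f := fun _ => (-2 : ℂ)) analyticAt_const h4
  set y₀ : ℝ := max D 0 + 1 with hy₀
  have hy₀pos : 0 < y₀ := by positivity
  have hmem : ((y₀ : ℂ) * I) ∈ U := by simpa [hU] using hy₀pos
  have hfreq : ∃ᶠ z in nhdsWithin ((y₀ : ℂ) * I) {(y₀ : ℂ) * I}ᶜ,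
      K z = (-2 : ℂ) • (W' ∘L resolv Q z ∘L W) := by
    have ht : Filter.Tendsto (fun y : ℝ => (y : ℂ) * I) (nhdsWithin y₀ (Set.Ioi y₀))
        (nhdsWithin ((y₀ : ℂ) * I) {(y₀ : ℂ) * I}ᶜ) := by
      refine tendsto_nhdsWithin_iff.2 ⟨?_, ?_⟩
      · have hc : Continuous (fun y : ℝ => (y : ℂ) * I) := by fun_prop
        exact (hc.tendsto y₀).mono_left nhdsWithin_le_nhds
      · filter_upwards [self_mem_nhdsWithin] with y hy
        simpa using (Set.mem_Ioi.1 hy).ne'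
    refine ht.frequently (Filter.Eventually.frequently ?_)
    filter_upwards [self_mem_nhdsWithin] with y hy
    have hy' : max D 0 < y := by linarith [Set.mem_Ioi.1 hy]
    ext f
    exact h y ((le_max_right _ _).trans_lt hy') ((le_max_left _ _).trans_lt hy') f
  have hconn : IsPreconnected U := (convex_halfSpace_im_gt 0).isPreconnected
  exact fun z hz =>
    AnalyticOnNhd.eqOn_of_preconnected_of_frequently_eq (fun z hz => hK z hz) h2 hconn hmem hfreq hz

end Identity

section Poles

variable {K : ℂ → (L2plusLinf →L[ℂ] L1capL2)} {Ω : ℝ}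

lemma analyticAt_of_im_pos (hK : MeromWithSimpleRealPoles K Ω) {z : ℂ} (hz : 0 < z.im) :
    AnalyticAt ℂ K z := by
  by_contra h
  exact hz.ne' (hK.2 z (Or.inl hz.ne') h).2.1

lemma analyticAt_or_isPoleAt (hK : MeromWithSimpleRealPoles K Ω) {w : ℝ} (hw : |w| < Ω) :
    AnalyticAt ℂ K w ∨ IsPoleAt K w := by
  by_cases h : AnalyticAt ℂ K w
  · exact Or.inl h
  · exact Or.inr (hK.2 w (Or.inr (by simpa using hw)) h).1

lemma not_analyticAt_of_isPoleAt {E F : Type*} [NormedAddCommGroup E] [NormedSpace ℂ E]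
    [NormedAddCommGroup F] [NormedSpace ℂ F] {K : ℂ → (E →L[ℂ] F)} {z₀ : ℂ}
    (h : IsPoleAt K z₀) : ¬ AnalyticAt ℂ K z₀ := by
  obtain ⟨R, hR, -, K₀, U, hU, hzU, hK₀, h⟩ := h
  intro hK
  refine hR ?_
  have h1 : Filter.Tendsto (fun z => (z - z₀) • (K z - K₀ z)) (nhdsWithin z₀ {z₀}ᶜ) (nhds 0) := by
    have hc : ContinuousAt (fun z => (z - z₀) • (K z - K₀ z)) z₀ :=
      (continuousAt_id.sub continuousAt_const).smul (hK.continuousAt.sub (hK₀ z₀ hzU).continuousAt)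
    simpa using hc.tendsto.mono_left (nhdsWithin_le_nhds (s := {z₀}ᶜ))
  have h2 : Filter.Tendsto (fun z => (z - z₀) • (K z - K₀ z)) (nhdsWithin z₀ {z₀}ᶜ) (nhds R) := by
    refine tendsto_const_nhds.congr' ?_
    filter_upwards [self_mem_nhdsWithin, mem_nhdsWithin_of_mem_nhds (hU.mem_nhds hzU)] with z hz hzU
    rw [h z hzU hz, add_sub_cancel_left, smul_smul, mul_inv_cancel₀ (sub_ne_zero.2 hz), one_smul]
  exact tendsto_nhds_unique h2 h1

lemma im_eq_zero_of_isPoleAt (hK : MeromWithSimpleRealPoles K Ω) {z : ℂ} (hz : IsPoleAt K z)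
    (hzΩ : ‖z‖ < Ω) : z.im = 0 :=
  (hK.2 z (Or.inr ((Complex.abs_re_le_norm z).trans_lt hzΩ)) (not_analyticAt_of_isPoleAt hz)).2.1

end Poles

section Counting

variable {E F : Type*} [NormedAddCommGroup E] [NormedSpace ℂ E]
  [NormedAddCommGroup F] [NormedSpace ℂ F] {K : ℂ → (E →L[ℂ] F)} {ω : ℝ}

lemma tsum_poleRank_le {N : ℝ≥0∞}
    (h : ∀ s : Finset ℂ, (∀ z ∈ s, IsPoleAt K z ∧ ‖z‖ < ω) → ∑ z ∈ s, (poleRank K z : ℝ≥0∞) ≤ N) :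
    ∑' x : {z : ℂ | IsPoleAt K z ∧ ‖z‖ < ω}, (poleRank K (x : ℂ) : ℝ≥0∞) ≤ N := by
  classical
  rw [ENNReal.tsum_eq_iSup_sum]
  refine iSup_le fun s => ?_
  refine le_trans (le_of_eq ?_) (h (s.map (Function.Embedding.subtype _)) ?_)
  · rw [Finset.sum_map]; rfl
  · intro z hz
    obtain ⟨x, -, rfl⟩ := Finset.mem_map.1 hz
    exact x.2

lemma sum_poleRank_le_tsum (s : Finset ℂ) (hs : ∀ z ∈ s, ‖z‖ < ω) :
    ∑ z ∈ s, (poleRank K z : ℝ≥0∞) ≤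
      ∑' x : {z : ℂ | IsPoleAt K z ∧ ‖z‖ < ω}, (poleRank K (x : ℂ) : ℝ≥0∞) := by
  classical
  rw [tsum_subtype {z : ℂ | IsPoleAt K z ∧ ‖z‖ < ω} fun z => (poleRank K z : ℝ≥0∞)]
  refine le_trans (Finset.sum_le_sum fun z hz => ?_) (ENNReal.sum_le_tsum s)
  by_cases h : IsPoleAt K z
  · rw [Set.indicator_of_mem (by exact ⟨h, hs z hz⟩)]
  · have h0 : poleRank K z = 0 := dif_neg h
    simp [h0]

/-- Splitting a sum over finitely many nonzero real points by the sign of the points. -/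
lemma sum_re_le_add {g : ℝ → ℕ} (hg : ∀ w, g (-w) = g w) {N : ℕ}
    (h : ∀ s : Finset ℝ, (∀ w ∈ s, 0 < w ∧ w < ω) → ∑ w ∈ s, g w ≤ N) (s : Finset ℂ)
    (hs : ∀ z ∈ s, z.im = 0 ∧ z ≠ 0 ∧ ‖z‖ < ω) : ∑ z ∈ s, g z.re ≤ N + N := by
  classical
  have hinj : ∀ z ∈ s, ∀ z' ∈ s, z.re = z'.re → z = z' := fun z hz z' hz' hre =>
    Complex.ext hre ((hs z hz).1.trans (hs z' hz').1.symm)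
  rw [← Finset.sum_filter_add_sum_filter_not s fun z => 0 < z.re]
  refine add_le_add ?_ ?_
  · rw [← Finset.sum_image (f := g) (g := fun z : ℂ => z.re) fun z hz z' hz' =>
      hinj z (Finset.mem_filter.1 hz).1 z' (Finset.mem_filter.1 hz').1]
    refine h _ fun w hw => ?_
    obtain ⟨z, hz, rfl⟩ := Finset.mem_image.1 hw
    obtain ⟨hzs, hpos⟩ := Finset.mem_filter.1 hz
    exact ⟨hpos, ((le_abs_self _).trans (Complex.abs_re_le_norm z)).trans_lt (hs z hzs).2.2⟩
  · rw [Finset.sum_congr rfl fun z _ => (hg z.re).symm,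
      ← Finset.sum_image (f := g) (g := fun z : ℂ => -z.re) fun z hz z' hz' hre =>
      hinj z (Finset.mem_filter.1 hz).1 z' (Finset.mem_filter.1 hz').1 (neg_injective hre)]
    refine h _ fun w hw => ?_
    obtain ⟨z, hz, rfl⟩ := Finset.mem_image.1 hw
    obtain ⟨hzs, hpos⟩ := Finset.mem_filter.1 hz
    obtain ⟨him, hz0, hlt⟩ := hs z hzs
    refine ⟨?_, ((neg_le_abs _).trans (Complex.abs_re_le_norm z)).trans_lt hlt⟩
    refine neg_pos.2 (lt_of_le_of_ne (not_lt.1 hpos) fun h0 => hz0 (Complex.ext h0 him))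

end Counting

section Compare

variable [CompleteSpace 𝓗] {K0 KR : ℂ → (L2plusLinf →L[ℂ] L1capL2)} {Ω ω : ℝ}
  {W0' WR' : 𝓗 →L[ℂ] L1capL2} {Q0 QR : 𝓗 →L[ℂ] 𝓗} {W0 WR : L2plusLinf →L[ℂ] 𝓗}

lemma tsum_poleRank_le_tsum (hK0m : MeromWithSimpleRealPoles K0 Ω)
    (hKRm : MeromWithSimpleRealPoles KR Ω) (hQ0 : Q0.IsPositive) (hQR : QR.IsPositive)
    (hK0 : IsResponse K0 W0' Q0 W0) (hKR : IsResponse KR WR' QR WR)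
    (hvis0 : ∀ x, W0' x = 0 → ∀ f, ⟪W0 f, x⟫_ℂ = 0)
    (hvisR : ∀ x, WR' x = 0 → ∀ f, ⟪WR f, x⟫_ℂ = 0) (hωΩ : ω < Ω) (T : Finset ℝ)
    (hT : ∀ w ∈ T, 0 < w ∧ w < ω)
    (hcount : ∀ s : Finset ℝ, (∀ w ∈ s, 0 < w ∧ w < ω) →
      (∀ w ∈ s, FiniteDimensional ℂ (visSpace QR WR w)) →
      (∀ w ∈ T, FiniteDimensional ℂ (visSpace Q0 W0 w)) →
      ∑ w ∈ s, Module.finrank ℂ (visSpace QR WR w) ≤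
        ∑ w ∈ T, Module.finrank ℂ (visSpace Q0 W0 w)) :
    ∑' x : {z : ℂ | IsPoleAt KR z ∧ ‖z‖ < ω}, (poleRank KR (x : ℂ) : ℝ≥0∞) ≤
      ∑' x : {z : ℂ | IsPoleAt K0 z ∧ ‖z‖ < ω}, (poleRank K0 (x : ℂ) : ℝ≥0∞) := by
  classical
  have rankR : ∀ w : ℝ, w ≠ 0 → |w| < ω →
      poleRank KR w = Module.finrank ℂ (visSpace QR WR w) ∧
        FiniteDimensional ℂ (visSpace QR WR w) := fun w hw hwω =>
    poleRank_eq_finrank hQR hKR hvisR hw (analyticAt_or_isPoleAt hKRm (hwω.trans hωΩ))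
  have rank0 : ∀ w : ℝ, w ≠ 0 → |w| < ω →
      poleRank K0 w = Module.finrank ℂ (visSpace Q0 W0 w) ∧
        FiniteDimensional ℂ (visSpace Q0 W0 w) := fun w hw hwω =>
    poleRank_eq_finrank hQ0 hK0 hvis0 hw (analyticAt_or_isPoleAt hK0m (hwω.trans hωΩ))
  have habs : ∀ w : ℝ, 0 < w ∧ w < ω → |w| < ω := fun w hw => by rw [abs_of_pos hw.1]; exact hw.2
  have hcount' : ∀ s : Finset ℝ, (∀ w ∈ s, 0 < w ∧ w < ω) →
      ∑ w ∈ s, Module.finrank ℂ (visSpace QR WR w) ≤ ∑ w ∈ T, poleRank K0 w := fun s hs => by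
    refine (hcount s hs (fun w hw => (rankR w (hs w hw).1.ne' (habs w (hs w hw))).2)
      fun w hw => (rank0 w (hT w hw).1.ne' (habs w (hT w hw))).2).trans (le_of_eq ?_)
    exact Finset.sum_congr rfl fun w hw => (rank0 w (hT w hw).1.ne' (habs w (hT w hw))).1.symm
  refine tsum_poleRank_le fun s hs => ?_
  have hs' : ∀ z ∈ s, z.im = 0 ∧ z ≠ 0 ∧ ‖z‖ < ω := fun z hz =>
    ⟨im_eq_zero_of_isPoleAt hKRm (hs z hz).1 ((hs z hz).2.trans hωΩ),
      fun h0 => not_isPoleAt_zero hQR hKR (h0 ▸ (hs z hz).1), (hs z hz).2⟩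
  have h1 := sum_re_le_add (fun w => by rw [visSpace_neg]) hcount' s hs'
  have h2 : ∑ z ∈ s, poleRank KR z = ∑ z ∈ s, Module.finrank ℂ (visSpace QR WR z.re) := by
    refine Finset.sum_congr rfl fun z hz => ?_
    obtain ⟨him, hz0, hlt⟩ := hs' z hz
    have hzre : z = (z.re : ℂ) := Complex.ext rfl (by simpa using him)
    rw [← (rankR z.re (fun h0 => hz0 (by rw [hzre, h0, Complex.ofReal_zero]))
      ((Complex.abs_re_le_norm z).trans_lt hlt)).1, ← hzre]
  have h3 : ∑ w ∈ T, poleRank K0 w = ∑ w ∈ T, poleRank K0 ((-w : ℝ) : ℂ) := by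
    refine Finset.sum_congr rfl fun w hw => ?_
    rw [(rank0 w (hT w hw).1.ne' (habs w (hT w hw))).1,
      (rank0 (-w) (neg_ne_zero.2 (hT w hw).1.ne') (by rw [abs_neg]; exact habs w (hT w hw))).1,
      visSpace_neg]
  set Tp : Finset ℂ := T.image fun w : ℝ => (w : ℂ) with hTp
  set Tm : Finset ℂ := T.image fun w : ℝ => ((-w : ℝ) : ℂ) with hTm
  have hdisj : Disjoint Tp Tm := by
    rw [Finset.disjoint_left]
    intro z hz hz'
    obtain ⟨w, hw, rfl⟩ := Finset.mem_image.1 hz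
    obtain ⟨w', hw', he⟩ := Finset.mem_image.1 hz'
    have := Complex.ofReal_injective he
    linarith [(hT w hw).1, (hT w' hw').1]
  have h4 : ∑ z ∈ Tp ∪ Tm, poleRank K0 z =
      ∑ w ∈ T, poleRank K0 w + ∑ w ∈ T, poleRank K0 ((-w : ℝ) : ℂ) := by
    rw [Finset.sum_union hdisj, hTp, hTm,
      Finset.sum_image fun a _ b _ hab => Complex.ofReal_injective hab,
      Finset.sum_image fun a _ b _ hab => neg_injective (Complex.ofReal_injective hab)]
  have h5 : ∑ z ∈ s, poleRank KR z ≤ ∑ z ∈ Tp ∪ Tm, poleRank K0 z := by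
    rw [h2, h4, ← h3]; exact h1
  refine le_trans ?_ (sum_poleRank_le_tsum (K := K0) (Tp ∪ Tm) fun z hz => ?_)
  · exact_mod_cast h5
  · rcases Finset.mem_union.1 hz with hz | hz
    · obtain ⟨w, hw, rfl⟩ := Finset.mem_image.1 hz
      simpa using habs w (hT w hw)
    · obtain ⟨w, hw, rfl⟩ := Finset.mem_image.1 hz
      simpa using habs w (hT w hw)

end Compare

end RPAShift

namespace RPAShift

/-! ### The two response functions -/

section Response

variable [CompleteSpace 𝓗] {P : SpectralData 𝓗} {E₀ ε y : ℝ} {sinOp : ℝ → (𝓗 →L[ℂ] 𝓗)}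
  {Smap : 𝓗 →L[ℂ] L1capL2} {Sadj : L2plusLinf →L[ℂ] 𝓗} {FH : L1capL2 →L[ℂ] L2plusLinf}
  {χ₀ χ : ℝ≥0 → (L2plusLinf →L[ℂ] L1capL2)} {K0 KR : ℂ → (L2plusLinf →L[ℂ] L1capL2)}
  {D0 DR : ℝ} {q r b : 𝓗 →L[ℂ] 𝓗}

lemma reference_eq_resolv (hε : 0 < ε) (hy : 0 < y)
    (hspec : ∀ x, ∀ᵐ a ∂P.diag x, a = E₀ ∨ E₀ + ε ≤ a)
    (hsin' : ∀ t : ℝ, IsFC P (fun a => Real.sin (t * (E₀ - a))) (sinOp t))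
    (hχ₀ : ∀ t : ℝ≥0, χ₀ t = (2 : ℂ) • (Smap ∘L sinOp (t : ℝ) ∘L Sadj))
    (hK0 : IsFourierTransformOf χ₀ K0 D0) (hyD : D0 < y) (hq : IsFC P (invExc E₀ ε) q)
    (hrr : r ∘L r = q) (hQ : (q ∘L q).IsPositive) (f : L2plusLinf) :
    K0 ((y : ℂ) * I) f =
      (-2 : ℂ) • Smap (r (resolv (q ∘L q) ((y : ℂ) * I) (r (Sadj f)))) := by
  have hz : 0 < ((y : ℂ) * I).im := by simpa using hy
  obtain ⟨G, hG⟩ := exists_isFC (P := P) (measurable_sinLaplace E₀ y) (abs_sinLaplace_le E₀ hy)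
  have hrq : ∀ x, r ((q ∘L q) x) = (q ∘L q) (r x) := fun x => by subst hrr; rfl
  have hGx : G (Sadj f) = -r (resolv (q ∘L q) ((y : ℂ) * I) (r (Sadj f))) := by
    rw [← resolv_comm hQ hrq hz (Sadj f)]
    set x := resolv (q ∘L q) ((y : ℂ) * I) (Sadj f) with hx
    have h1 : x + (y : ℂ) ^ 2 • q (q x) = Sadj f := by
      have h2 := pencil_resolv hQ hz (Sadj f)
      rw [← hx] at h2
      rw [← h2]
      simp [mul_pow, sub_eq_add_neg]
    rw [← h1, sinLaplace_pencil hε hy hspec hq hG x, ← hrr]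
    rfl
  rw [fourierTransform_reference hsin' hχ₀ hK0 hy hyD hG f, hGx, map_neg, smul_neg]
  exact (neg_smul (2 : ℂ) _).symm

lemma isResponse_reference (hε : 0 < ε)
    (hspec : ∀ x, ∀ᵐ a ∂P.diag x, a = E₀ ∨ E₀ + ε ≤ a)
    (hsin' : ∀ t : ℝ, IsFC P (fun a => Real.sin (t * (E₀ - a))) (sinOp t))
    (hχ₀ : ∀ t : ℝ≥0, χ₀ t = (2 : ℂ) • (Smap ∘L sinOp (t : ℝ) ∘L Sadj))
    (hK0 : IsFourierTransformOf χ₀ K0 D0) (hK0a : ∀ z : ℂ, 0 < z.im → AnalyticAt ℂ K0 z)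
    (hq : IsFC P (invExc E₀ ε) q) (hrr : r ∘L r = q) (hQ : (q ∘L q).IsPositive) :
    IsResponse K0 (Smap ∘L r) (q ∘L q) (r ∘L Sadj) :=
  isResponse_of_imag hQ hK0a D0 fun _ hy hyD f =>
    reference_eq_resolv hε hy hspec hsin' hχ₀ hK0 hyD hq hrr hQ f

lemma isResponse_dyson (hε : 0 < ε)
    (hspec : ∀ x, ∀ᵐ a ∂P.diag x, a = E₀ ∨ E₀ + ε ≤ a)
    (hsin' : ∀ t : ℝ, IsFC P (fun a => Real.sin (t * (E₀ - a))) (sinOp t))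
    (hχ₀ : ∀ t : ℝ≥0, χ₀ t = (2 : ℂ) • (Smap ∘L sinOp (t : ℝ) ∘L Sadj))
    (hsc : SCont χ) (hdy : SolvesDyson FH χ₀ χ)
    (hK0 : IsFourierTransformOf χ₀ K0 D0) (hKR : IsFourierTransformOf χ KR DR)
    (hKRa : ∀ z : ℂ, 0 < z.im → AnalyticAt ℂ KR z)
    (hq : IsFC P (invExc E₀ ε) q) (hrr : r ∘L r = q) (hQ : (q ∘L q).IsPositive)
    (hb : b.IsPositive)
    (hbB : ∀ x, b (b (x + (2 : ℂ) • r (((Sadj ∘L FH) ∘L Smap) (r x)))) = x) :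
    IsResponse KR (Smap ∘L r ∘L b) (b ∘L (q ∘L q) ∘L b) (b ∘L r ∘L Sadj) := by
  have hbQb : (b ∘L (q ∘L q) ∘L b).IsPositive := by
    simpa [hb.isSelfAdjoint.adjoint_eq] using hQ.conj_adjoint b
  refine isResponse_of_imag hbQb hKRa (max D0 DR) fun y hy hyD f => ?_
  have hz : 0 < ((y : ℂ) * I).im := by simpa using hy
  have hyD0 := (le_max_left _ _).trans_lt hyD
  have hyDR := (le_max_right _ _).trans_lt hyD
  set z := (y : ℂ) * I with hzdef
  set m := resolv (q ∘L q) z (r (Sadj (f + FH (KR z f)))) with hm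
  have hKRm : KR z f = (-2 : ℂ) • Smap (r m) :=
    (fourierTransform_dyson hsin' hχ₀ hsc hdy hK0 hKR hy hyD0 hyDR f).trans
      (reference_eq_resolv hε hy hspec hsin' hχ₀ hK0 hyD0 hq hrr hQ _)
  have hpencil : m - z ^ 2 • (q ∘L q) m = r (Sadj f) + r (Sadj (FH (KR z f))) := by
    rw [← map_add, ← map_add]
    exact pencil_resolv hQ hz _
  have heq : m + (2 : ℂ) • r (((Sadj ∘L FH) ∘L Smap) (r m)) - z ^ 2 • (q ∘L q) m = r (Sadj f) := by
    rw [add_sub_right_comm, hpencil, hKRm]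
    simp
  rw [hKRm, eq_resolv_of_pencil hQ hb hbB hz heq]
  rfl

end Response

end RPAShift

/-- Theorem 1.2 (ii), forward shift of poles: under Assumption 1 on `H`,
with `χ₀` the density-density response function of `H` and `χ^RPA` the solution of the RPA
Dyson equation, and with `χ̂₀`, `χ̂^RPA` the meromorphic extensions to `D_Ω` of their Fourier
transforms, for every `0 < ω < Ω`,
`Σ_{ω̃ ∈ P(χ̂^RPA), |ω̃|<ω} rank_{ω̃}(χ̂^RPA) ≤ Σ_{ω̃ ∈ P(χ̂₀), |ω̃|<ω} rank_{ω̃}(χ̂₀)`. -/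
theorem rpa_poles_forward_shift
    {𝓗N : Type*} [NormedAddCommGroup 𝓗N] [InnerProductSpace ℂ 𝓗N] [CompleteSpace 𝓗N]
    (P : SpectralData 𝓗N) (E₀ : ℝ) (Ψ₀ : 𝓗N) (hgs : IsGroundState P E₀ Ψ₀)
    (Ω : ℝ) (hness : P.essSpec.Nonempty) (hΩ : Ω = sInf P.essSpec - E₀) (hΩpos : 0 < Ω)
    (Smap : 𝓗N →L[ℂ] L1capL2) (Sadj : L2plusLinf →L[ℂ] 𝓗N)
    (hSadj : ∀ (g : Lsp 2 × Lsp ∞) (x : 𝓗N),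
      ⟪Sadj (Submodule.Quotient.mk g : L2plusLinf), x⟫_ℂ =
        ∫ y : R3, (starRingEnd ℂ) ((g.1 : R3 → ℂ) y + (g.2 : R3 → ℂ) y) *
          (((Smap x).1.1 : R3 → ℂ) y))
    (sinOp : ℝ → (𝓗N →L[ℂ] 𝓗N))
    (hsin : ∀ (t : ℝ) (x : 𝓗N),
      ⟪x, sinOp t x⟫_ℂ = ∫ lam : ℝ, ((Real.sin (t * (E₀ - lam)) : ℝ) : ℂ) ∂(P.diag x))
    (χ₀ : ℝ≥0 → (L2plusLinf →L[ℂ] L1capL2))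
    (hχ₀ : ∀ t : ℝ≥0, χ₀ t = (2:ℂ) • (Smap ∘L sinOp (t : ℝ) ∘L Sadj))
    (FH : L1capL2 →L[ℂ] L2plusLinf) (hFH : IsHartree FH)
    (χRPA : ℝ≥0 → (L2plusLinf →L[ℂ] L1capL2))
    (hsc : SCont χRPA) (hdy : SolvesDyson FH χ₀ χRPA)
    -- the meromorphic extensions of the Fourier transforms of `χ₀` and `χ^RPA`
    (K0 KR : ℂ → (L2plusLinf →L[ℂ] L1capL2)) (D0 DR : ℝ)
    (hK0ft : IsFourierTransformOf χ₀ K0 D0) (hK0m : MeromWithSimpleRealPoles K0 Ω)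
    (hKRft : IsFourierTransformOf χRPA KR DR) (hKRm : MeromWithSimpleRealPoles KR Ω) :
    ∀ ω : ℝ, 0 < ω → ω < Ω →
      ∑' x : {z : ℂ | IsPoleAt KR z ∧ ‖z‖ < ω}, (poleRank KR (x : ℂ) : ℝ≥0∞) ≤
      ∑' x : {z : ℂ | IsPoleAt K0 z ∧ ‖z‖ < ω}, (poleRank K0 (x : ℂ) : ℝ≥0∞) := by
  intro ω hω hωΩ
  have hsin' := RPAShift.isFC_sinOp hsin
  obtain ⟨ε, hε, hspec⟩ := RPAShift.diag_ae_spectrum hgs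
  obtain ⟨q, r, hq, hr, hrr⟩ := RPAShift.exists_invExc_sqrt P E₀ hε
  have hqpos : q.IsPositive := hq.isPositive (RPAShift.invExc_nonneg E₀ hε)
  have hQ : (q ∘L q).IsPositive := by
    simpa [hqpos.isSelfAdjoint.adjoint_eq] using
      (ContinuousLinearMap.isPositive_adjoint_comp_self q)
  have hA : ((Sadj ∘L FH) ∘L Smap).IsPositive := RPAShift.isPositive_hartree hSadj hFH
  obtain ⟨b, hb, hbB, hBb⟩ := RPAShift.exists_inv_sqrt hr hA
  have hbQb : (b ∘L (q ∘L q) ∘L b).IsPositive := by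
    simpa [hb.isSelfAdjoint.adjoint_eq] using hQ.conj_adjoint b
  have hinner := @RPAShift.inner_eq_zero_of_map_eq_zero _ _ _ _ _ hSadj
  have hproj : P.proj (Set.Iio (E₀ + ω)) ∘L P.proj (Set.Iio (E₀ + ω)) =
      P.proj (Set.Iio (E₀ + ω)) := by
    rw [P.proj_comp _ _ measurableSet_Iio measurableSet_Iio, Set.inter_self]
  obtain ⟨T, hT, hgap⟩ := RPAShift.exists_finset_gap (p := P.proj (Set.Iio (E₀ + ω))) hqpos
    (P.proj_symm _ measurableSet_Iio) hproj
    (ContinuousLinearMap.ext fun x => (hq.commute measurableSet_Iio x).symm)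
    (RPAShift.finiteRank_proj_Iio hgs.bottom (hΩ ▸ hωΩ)) hω
    fun x hx => RPAShift.norm_invExc_le hε hω hq hx
  exact RPAShift.tsum_poleRank_le_tsum hK0m hKRm hQ hbQb
    (RPAShift.isResponse_reference hε hspec hsin' hχ₀ hK0ft
      (fun z hz => RPAShift.analyticAt_of_im_pos hK0m hz) hq hrr hQ)
    (RPAShift.isResponse_dyson hε hspec hsin' hχ₀ hsc hdy hK0ft hKRft
      (fun z hz => RPAShift.analyticAt_of_im_pos hKRm hz) hq hrr hQ hb hbB)
    (fun x hx f => (hr _ _).trans (hinner hx f))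
    (fun x hx f => (hb.isSymmetric _ _).trans ((hr _ _).trans (hinner hx f)))
    hωΩ T hT fun s hs hfinR hfin0 =>
      RPAShift.sum_finrank_visSpace_le (M := FH ∘L Smap) hr hQ.isSymmetric hA rfl hb hbB hBb s T hs
        (fun w hw => (hT w hw).1) hfinR hfin0 hgap

end
end

section
/- Under the standing assumptions on H (simple isolated ground-state eigenvalue E₀ with ground state Ψ₀ of bounded density), the Fourier transform χ̂(z) of the density-density response function admits for Im(z) > 0 the rigorous Lehmann representation: χ̂(z) = Σ_{E_j ∈ σ_d(H)\{E₀}} S P^H_{E_j} (1/(E₀−z−E_j) + 1/(E₀+z−E_j)) P^H_{E_j} S* + S ∫_{σ_ess(H)} (1/(E₀−z−λ) + 1/(E₀+z−λ)) dP^H_λ S*, where P^H_λ is the projection-valued spectral measure of H, P^H_{E_j} the spectral projection onto the eigenspace at E_j, and σ_d and σ_ess denote the discrete and essential spectrum of H. -/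
/-!
STATEMENT 10: Rigorous Lehmann representation of the Fourier transform of the
density-density response function.
-/

open MeasureTheory ENNReal NNReal Complex
noncomputable section

/-! ### Self-adjoint Hamiltonians, encoded through their projection-valued spectral measure -/

open scoped InnerProductSpace

variable {𝓗 : Type*} [NormedAddCommGroup 𝓗] [InnerProductSpace ℂ 𝓗]

/-- The Heaviside function. -/
def heaviside (t : ℝ) : ℝ := if 0 ≤ t then 1 else 0

/-! ### Auxiliary facts -/

namespace SpectralData

variable (P : SpectralData 𝓗)

/-- The window projection `P^H((a-ε, a+ε))`. -/
abbrev window (a ε : ℝ) : 𝓗 →L[ℂ] 𝓗 := P.proj (Set.Ioo (a - ε) (a + ε))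

lemma proj_proj {A B : Set ℝ} (hA : MeasurableSet A) (hB : MeasurableSet B) (x : 𝓗) :
    P.proj A (P.proj B x) = P.proj (A ∩ B) x := by
  rw [← P.proj_comp A B hA hB]; rfl

lemma isFiniteMeasure_diag (x : 𝓗) : IsFiniteMeasure (P.diag x) :=
  ⟨by rw [P.diag_apply x _ MeasurableSet.univ]; exact ENNReal.pow_lt_top ENNReal.coe_lt_top⟩

lemma diag_eq_zero_iff {A : Set ℝ} (hA : MeasurableSet A) (x : 𝓗) :
    P.diag x A = 0 ↔ P.proj A x = 0 := by
  rw [P.diag_apply x A hA]; simp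

lemma proj_empty : P.proj ∅ = 0 := by
  ext x
  simpa using (P.diag_eq_zero_iff MeasurableSet.empty x).1 measure_empty

lemma proj_eq_zero_of_subset {A B : Set ℝ} (hA : MeasurableSet A) (hB : MeasurableSet B)
    (hAB : A ⊆ B) (h : P.proj B = 0) : P.proj A = 0 := by
  rw [← Set.inter_eq_left.2 hAB, ← P.proj_comp A B hA hB, h]; simp

lemma range_proj_le {A B : Set ℝ} (hA : MeasurableSet A) (hB : MeasurableSet B) (hAB : A ⊆ B) :
    LinearMap.range (P.proj A : 𝓗 →ₗ[ℂ] 𝓗) ≤ LinearMap.range (P.proj B : 𝓗 →ₗ[ℂ] 𝓗) := by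
  rintro _ ⟨x, rfl⟩
  refine ⟨P.proj A x, ?_⟩
  change P.proj B (P.proj A x) = P.proj A x
  rw [P.proj_proj hB hA, Set.inter_eq_right.2 hAB]

lemma proj_eq_of_range_le {A B : Set ℝ} (hA : MeasurableSet A) (hB : MeasurableSet B)
    (hAB : A ⊆ B) (h : LinearMap.range (P.proj B : 𝓗 →ₗ[ℂ] 𝓗) ≤
      LinearMap.range (P.proj A : 𝓗 →ₗ[ℂ] 𝓗)) : P.proj B = P.proj A := by
  ext x
  obtain ⟨y, hy⟩ := h ⟨x, rfl⟩
  change P.proj A y = P.proj B x at hy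
  rw [← hy]
  have := congrArg (P.proj A) hy
  rwa [P.proj_proj hA hA, P.proj_proj hA hB, Set.inter_self, Set.inter_eq_left.2 hAB] at this

lemma inner_proj_self {A : Set ℝ} (hA : MeasurableSet A) (x : 𝓗) :
    ⟪x, P.proj A x⟫_ℂ = ((P.diag x).real A : ℂ) := by
  have h : ⟪x, P.proj A x⟫_ℂ = ⟪P.proj A x, P.proj A x⟫_ℂ := by
    rw [P.proj_symm A hA, P.proj_proj hA hA, Set.inter_self]
  rw [h, inner_self_eq_norm_sq_to_K, measureReal_def, P.diag_apply x A hA]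
  simp

lemma Ioo_subset_Ioo_of_abs_add_le {a b δ ε : ℝ} (h : |b - a| + δ ≤ ε) :
    Set.Ioo (b - δ) (b + δ) ⊆ Set.Ioo (a - ε) (a + ε) := by
  have := abs_le.1 (le_refl |b - a|)
  apply Set.Ioo_subset_Ioo <;> linarith

lemma isClosed_essSpec : IsClosed P.essSpec := by
  rw [← isOpen_compl_iff, Metric.isOpen_iff]
  intro a ha
  simp only [essSpec, Set.mem_compl_iff, Set.mem_ofPred_eq, not_forall, not_not] at ha
  obtain ⟨ε, hε, h0⟩ := ha
  refine ⟨ε, hε, fun b hb => ?_⟩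
  rw [Metric.mem_ball, Real.dist_eq] at hb
  intro hbs
  exact hbs (ε - |b - a|) (by linarith) (Submodule.finiteDimensional_of_le
    (P.range_proj_le measurableSet_Ioo measurableSet_Ioo
      (Ioo_subset_Ioo_of_abs_add_le (a := a) (ε := ε) (by linarith))))

lemma diag_compl_spec (x : 𝓗) : P.diag x P.specᶜ = 0 := by
  refine measure_null_of_locally_null _ fun a ha => ?_
  simp only [spec, Set.mem_compl_iff, Set.mem_ofPred_eq, not_forall, not_not] at ha
  obtain ⟨ε, hε, h0⟩ := ha
  refine ⟨_, mem_nhdsWithin_of_mem_nhds (Ioo_mem_nhds (sub_lt_self a hε) (lt_add_of_pos_right a hε)),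
    ?_⟩
  rw [P.diag_eq_zero_iff measurableSet_Ioo, h0]; rfl

/-- Around a point outside the essential spectrum, some window carries no spectral mass
besides the point itself. -/
lemma exists_window_diff_eq_zero {a : ℝ} (ha : a ∉ P.essSpec) :
    ∃ δ > 0, P.proj (Set.Ioo (a - δ) (a + δ) \ {a}) = 0 := by
  simp only [essSpec, Set.mem_ofPred_eq, not_forall, not_not] at ha
  obtain ⟨ε, hε, hfin⟩ := ha
  obtain ⟨δ, hδ, hmin⟩ := (InvImage.wf (fun δ : ℝ =>
    Module.finrank ℂ (LinearMap.range (P.window a δ : 𝓗 →ₗ[ℂ] 𝓗))) wellFounded_lt).has_min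
      (Set.Ioc 0 ε) ⟨ε, hε, le_rfl⟩
  have hsub {r s : ℝ} (h : r ≤ s) : Set.Ioo (a - r) (a + r) ⊆ Set.Ioo (a - s) (a + s) :=
    Set.Ioo_subset_Ioo (by linarith) (by linarith)
  have hle {r s : ℝ} (h : r ≤ s) : LinearMap.range (P.window a r : 𝓗 →ₗ[ℂ] 𝓗) ≤
      LinearMap.range (P.window a s : 𝓗 →ₗ[ℂ] 𝓗) :=
    P.range_proj_le measurableSet_Ioo measurableSet_Ioo (hsub h)
  have hfinδ : FiniteDimensional ℂ (LinearMap.range (P.window a δ : 𝓗 →ₗ[ℂ] 𝓗)) :=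
    Submodule.finiteDimensional_of_le (hle hδ.2)
  have heq {r : ℝ} (hr : 0 < r) (hrδ : r ≤ δ) : P.window a δ = P.window a r := by
    refine P.proj_eq_of_range_le measurableSet_Ioo measurableSet_Ioo (hsub hrδ) ?_
    refine (Submodule.eq_of_le_of_finrank_le (hle hrδ) ?_).ge
    exact not_lt.1 (hmin r ⟨hr, hrδ.trans hδ.2⟩)
  refine ⟨δ, hδ.1, ?_⟩
  ext x
  refine (P.diag_eq_zero_iff (measurableSet_Ioo.diff (measurableSet_singleton a)) x).1 ?_
  refine measure_mono_null (t := ⋃ n : ℕ, Set.Ioo (a - δ) (a + δ) \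
    Set.Ioo (a - δ / (n + 1)) (a + δ / (n + 1))) ?_ (measure_iUnion_null fun n => ?_)
  · rintro b ⟨hb, hba⟩
    have hpos : 0 < |b - a| := abs_pos.2 (sub_ne_zero.2 hba)
    obtain ⟨n, hn⟩ := exists_nat_gt (δ / |b - a|)
    refine Set.mem_iUnion.2 ⟨n, hb, fun hbn => ?_⟩
    have h1 : |b - a| < δ / (n + 1) := abs_lt.2 ⟨by linarith [hbn.1], by linarith [hbn.2]⟩
    rw [lt_div_iff₀ (by positivity)] at h1
    rw [div_lt_iff₀ hpos] at hn
    nlinarith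
  · have hm := (measurableSet_Ioo (a := a - δ) (b := a + δ)).diff
      (measurableSet_Ioo (a := a - δ / (n + 1)) (b := a + δ / (n + 1)))
    have hp : 0 < δ / ((n : ℝ) + 1) := div_pos hδ.1 (by positivity)
    have hd : δ / ((n : ℝ) + 1) ≤ δ := div_le_self hδ.1.le (by linarith [n.cast_nonneg (α := ℝ)])
    rw [P.diag_eq_zero_iff hm, ← Set.inter_eq_left.2 Set.sdiff_subset,
      ← P.proj_proj hm measurableSet_Ioo]
    have := congrArg (fun T => T x) (heq hp hd)
    simp only [window] at this
    rw [this, P.proj_proj hm measurableSet_Ioo, Set.sdiff_inter_self, P.proj_empty]; rfl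

lemma countable_spec_diff_essSpec : (P.spec \ P.essSpec).Countable := by
  refine (HereditarilyLindelofSpace.isLindelof _).countable_of_isDiscrete
    (isDiscrete_iff_forall_mem_exists_isOpen.2 fun a ha => ?_)
  obtain ⟨δ, hδ, h0⟩ := P.exists_window_diff_eq_zero ha.2
  refine ⟨Set.Ioo (a - δ) (a + δ), isOpen_Ioo, ?_⟩
  ext b
  simp only [Set.mem_inter_iff, Set.mem_singleton_iff]
  constructor
  · rintro ⟨hb, hbs, -⟩
    by_contra hba
    have hopen : IsOpen (Set.Ioo (a - δ) (a + δ) \ {a}) := isOpen_Ioo.sdiff isClosed_singleton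
    obtain ⟨ε, hε, hball⟩ := Metric.isOpen_iff.1 hopen b ⟨hb, hba⟩
    rw [Real.ball_eq_Ioo] at hball
    exact hbs ε hε (P.proj_eq_zero_of_subset measurableSet_Ioo hopen.measurableSet hball h0)
  · rintro rfl
    exact ⟨⟨by linarith, by linarith⟩, ha⟩

/-- The discrete spectrum of `H` without the point `E₀`. -/
abbrev discSpec (E₀ : ℝ) : Set ℝ := {E : ℝ | E ∈ P.spec ∧ E ∉ P.essSpec ∧ E ≠ E₀}

instance countable_discSpec (E₀ : ℝ) : Countable (P.discSpec E₀) :=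
  (P.countable_spec_diff_essSpec.mono (fun _ h => ⟨h.1, h.2.1⟩ :
    P.discSpec E₀ ⊆ P.spec \ P.essSpec)).to_subtype

lemma hasSum_setIntegral_discSpec (E₀ : ℝ) (x : 𝓗) {g : ℝ → ℂ} (hg : Integrable g (P.diag x)) :
    HasSum (fun E : P.discSpec E₀ => g E * ⟪x, P.proj {(E : ℝ)} x⟫_ℂ)
      (∫ lam in P.discSpec E₀, g lam ∂(P.diag x)) := by
  have h := hasSum_integral_iUnion (μ := P.diag x) (f := g)
    (s := fun E : P.discSpec E₀ => {(E : ℝ)}) (fun _ => measurableSet_singleton _)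
    (fun i j hij => Set.disjoint_singleton.2 (Subtype.coe_injective.ne hij)) hg.integrableOn
  rw [Set.iUnion_coe_set, Set.biUnion_of_singleton] at h
  refine h.congr_fun fun E => ?_
  rw [integral_singleton, P.inner_proj_self (measurableSet_singleton _), mul_comm,
    Complex.real_smul]

/-- A spectral integral splits into its discrete and essential parts, provided that the integrand
vanishes at the excluded point `E₀`. -/
lemma integral_eq_discSpec_add_essSpec (E₀ : ℝ) (x : 𝓗) {g : ℝ → ℂ}
    (hg : Integrable g (P.diag x)) (hg0 : g E₀ = 0) :
    ∫ lam, g lam ∂(P.diag x) =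
      ∫ lam in P.discSpec E₀, g lam ∂(P.diag x) + ∫ lam in P.essSpec, g lam ∂(P.diag x) := by
  have hmd : MeasurableSet (P.discSpec E₀) := (Set.to_countable _).measurableSet
  rw [← setIntegral_union (Set.disjoint_left.2 fun _ h h' => h.2.1 h')
    P.isClosed_essSpec.measurableSet hg.integrableOn hg.integrableOn]
  symm
  apply setIntegral_eq_integral_of_ae_compl_eq_zero
  have hs : ∀ᵐ lam ∂(P.diag x), lam ∈ P.spec := by
    rw [ae_iff]; exact P.diag_compl_spec x
  filter_upwards [hs] with lam hlam hn
  by_cases h : lam = E₀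
  · rw [h, hg0]
  · by_cases h' : lam ∈ P.essSpec
    · exact absurd (Or.inr h') hn
    · exact absurd (Or.inl ⟨hlam, h', h⟩) hn

lemma orthogonalFamily_range_proj (s : Set ℝ) : OrthogonalFamily ℂ
    (fun E : s => LinearMap.range (P.proj {(E : ℝ)} : 𝓗 →ₗ[ℂ] 𝓗))
    (fun E => (LinearMap.range (P.proj {(E : ℝ)} : 𝓗 →ₗ[ℂ] 𝓗)).subtypeₗᵢ) := by
  rintro E F hEF ⟨_, x, rfl⟩ ⟨_, y, rfl⟩
  change ⟪P.proj {(E : ℝ)} x, P.proj {(F : ℝ)} y⟫_ℂ = 0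
  rw [P.proj_symm _ (measurableSet_singleton _),
    P.proj_proj (measurableSet_singleton _) (measurableSet_singleton _),
    Set.singleton_inter_eq_empty.2 (by simpa [Subtype.ext_iff] using hEF), P.proj_empty]
  simp

lemma summable_norm_sq_proj (E₀ : ℝ) (v : 𝓗) :
    Summable fun E : P.discSpec E₀ => ‖P.proj {(E : ℝ)} v‖ ^ 2 := by
  have hfin := P.isFiniteMeasure_diag v
  refine (P.hasSum_setIntegral_discSpec E₀ v
    (g := fun _ => 1) (integrable_const _)).summable.norm.congr fun E => ?_
  rw [P.inner_proj_self (measurableSet_singleton _), measureReal_def,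
    P.diag_apply v _ (measurableSet_singleton _)]
  simp

lemma summable_smul_proj [CompleteSpace 𝓗] (E₀ : ℝ) (v : 𝓗) {g : ℝ → ℂ} {C : ℝ}
    (hg : ∀ lam, ‖g lam‖ ≤ C) :
    Summable fun E : P.discSpec E₀ => g E • P.proj {(E : ℝ)} v := by
  let f (E : P.discSpec E₀) : LinearMap.range (P.proj {(E : ℝ)} : 𝓗 →ₗ[ℂ] 𝓗) :=
    ⟨g E • P.proj {(E : ℝ)} v, Submodule.smul_mem _ _ ⟨v, rfl⟩⟩
  refine ((P.orthogonalFamily_range_proj (P.discSpec E₀)).summable_iff_norm_sq_summable f).2 ?_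
  refine Summable.of_nonneg_of_le (fun _ => sq_nonneg _) (fun E => ?_)
    ((P.summable_norm_sq_proj E₀ v).mul_left (C ^ 2))
  change ‖g E • P.proj {(E : ℝ)} v‖ ^ 2 ≤ _
  rw [norm_smul, mul_pow]
  gcongr
  exact hg E

end SpectralData

lemma exists_inner_eq_sum_polarization (w v : 𝓗) : ∃ (c : Fin 4 → ℂ) (u : Fin 4 → 𝓗),
    ∀ T : 𝓗 →L[ℂ] 𝓗, ⟪w, T v⟫_ℂ = ∑ k, c k * ⟪u k, T (u k)⟫_ℂ := by
  refine ⟨![1 / 4, -1 / 4, -I / 4, I / 4], ![w + v, w - v, w + I • v, w - I • v], fun T => ?_⟩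
  simp only [Fin.sum_univ_four, Matrix.cons_val, map_add, map_sub, map_smul, inner_add_left,
    inner_add_right, inner_sub_left, inner_sub_right, inner_smul_left, inner_smul_right, conj_I]
  linear_combination (1 / 2 * ⟪w, T v⟫_ℂ - 1 / 2 * ⟪v, T w⟫_ℂ) * I_sq

section Kernel

variable (E₀ : ℝ) {z : ℂ}

lemma integrable_kernel (hz : 0 < z.im) (μ : Measure ℝ) [IsFiniteMeasure μ] :
    Integrable (fun p : ℝ × ℝ =>
      exp (I * z * p.1) * (2 * ((Real.sin (p.1 * (E₀ - p.2)) : ℝ) : ℂ)))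
      ((volume.restrict (Set.Ioi 0)).prod μ) := by
  have h : Integrable (fun t : ℝ => exp (I * z * t)) (volume.restrict (Set.Ioi 0)) :=
    integrableOn_exp_mul_complex_Ioi (by simpa using hz) 0
  refine (h.mul_prod (integrable_const (μ := μ) (2 : ℂ))).mono ?_ (.of_forall fun p => ?_)
  · exact Continuous.aestronglyMeasurable (by fun_prop)
  · rw [norm_mul, norm_mul, norm_mul, Complex.norm_real, Real.norm_eq_abs]
    have := Real.abs_sin_le_one (p.1 * (E₀ - p.2))
    have h2 : ‖(2 : ℂ)‖ * |Real.sin (p.1 * (E₀ - p.2))| ≤ ‖(2 : ℂ)‖ :=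
      mul_le_of_le_one_right (norm_nonneg _) this
    gcongr

lemma sub_add_ne_zero (hz : z.im ≠ 0) (a : ℝ) : (a : ℂ) - z ≠ 0 ∧ (a : ℂ) + z ≠ 0 :=
  ⟨fun h => hz (by simpa using congrArg im h), fun h => hz (by simpa using congrArg im h)⟩

lemma integral_exp_mul_two_sin (hz : 0 < z.im) (a : ℝ) :
    ∫ t in Set.Ioi (0 : ℝ), exp (I * z * t) * (2 * ((Real.sin (t * a) : ℝ) : ℂ)) =
      ((a : ℂ) - z)⁻¹ + ((a : ℂ) + z)⁻¹ := by
  obtain ⟨hm, hp⟩ := sub_add_ne_zero hz.ne' a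
  have h1 : (I * (z - a)).re < 0 := by simpa using hz
  have h2 : (I * (z + a)).re < 0 := by simpa using hz
  have key : ∀ t : ℝ, exp (I * z * t) * (2 * ((Real.sin (t * a) : ℝ) : ℂ)) =
      I * exp (I * (z - a) * t) - I * exp (I * (z + a) * t) := by
    intro t
    rw [ofReal_sin, two_sin, Complex.ofReal_mul,
      show I * (z - a) * t = I * z * t + -(t * a) * I by ring,
      show I * (z + a) * t = I * z * t + t * a * I by ring, exp_add, exp_add]
    ring
  simp_rw [key]
  rw [integral_sub ((integrableOn_exp_mul_complex_Ioi h1 0).const_mul I)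
    ((integrableOn_exp_mul_complex_Ioi h2 0).const_mul I), integral_const_mul,
    integral_const_mul, integral_exp_mul_complex_Ioi h1, integral_exp_mul_complex_Ioi h2]
  have hm' : z - a ≠ 0 := fun h => hm (by linear_combination -h)
  have hp' : z + a ≠ 0 := fun h => hp (by linear_combination h)
  simp only [Complex.ofReal_zero, mul_zero, exp_zero]
  field_simp [I_ne_zero]
  ring

/-- The resolvent kernel `1/(E₀-z-λ) + 1/(E₀+z-λ)`. -/
def lehmannKernel (E₀ : ℝ) (z : ℂ) (lam : ℝ) : ℂ :=
  ((E₀ : ℂ) - z - (lam : ℂ))⁻¹ + ((E₀ : ℂ) + z - (lam : ℂ))⁻¹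

lemma integral_kernel_eq_lehmannKernel (hz : 0 < z.im) (lam : ℝ) :
    ∫ t in Set.Ioi (0 : ℝ), exp (I * z * t) * (2 * ((Real.sin (t * (E₀ - lam)) : ℝ) : ℂ)) =
      lehmannKernel E₀ z lam := by
  rw [integral_exp_mul_two_sin hz, lehmannKernel]
  push_cast
  congr 2 <;> ring

lemma norm_lehmannKernel_le (hz : 0 < z.im) (lam : ℝ) :
    ‖lehmannKernel E₀ z lam‖ ≤ z.im⁻¹ + z.im⁻¹ := by
  refine (norm_add_le _ _).trans (add_le_add ?_ ?_) <;> rw [norm_inv] <;>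
    refine inv_anti₀ hz ?_
  · simpa [abs_of_pos hz] using abs_im_le_norm ((E₀ : ℂ) - z - lam)
  · simpa [abs_of_pos hz] using abs_im_le_norm ((E₀ : ℂ) + z - lam)

lemma lehmannKernel_self : lehmannKernel E₀ z E₀ = 0 := by
  simp [lehmannKernel, inv_neg]

lemma integrable_lehmannKernel (hz : 0 < z.im) (μ : Measure ℝ) [IsFiniteMeasure μ] :
    Integrable (lehmannKernel E₀ z) μ := by
  simpa only [integral_kernel_eq_lehmannKernel E₀ hz] using
    (integrable_kernel E₀ hz μ).integral_prod_right

end Kernel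

section Lehmann

variable (P : SpectralData 𝓗) (E₀ : ℝ) {z : ℂ} {sinOp : ℝ → (𝓗 →L[ℂ] 𝓗)}

lemma integral_inner_sinOp (hsin : ∀ (t : ℝ) (x : 𝓗),
      ⟪x, sinOp t x⟫_ℂ = ∫ lam : ℝ, ((Real.sin (t * (E₀ - lam)) : ℝ) : ℂ) ∂(P.diag x))
    (hz : 0 < z.im) (x : 𝓗) :
    IntegrableOn (fun t : ℝ => exp (I * z * t) * (2 * ⟪x, sinOp t x⟫_ℂ)) (Set.Ioi 0) ∧
    ∫ t in Set.Ioi (0 : ℝ), exp (I * z * t) * (2 * ⟪x, sinOp t x⟫_ℂ) =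
      ∫ lam, lehmannKernel E₀ z lam ∂(P.diag x) := by
  have := P.isFiniteMeasure_diag x
  have hint := integrable_kernel E₀ hz (P.diag x)
  have heq : ∀ t : ℝ, exp (I * z * t) * (2 * ⟪x, sinOp t x⟫_ℂ) =
      ∫ lam, exp (I * z * t) * (2 * ((Real.sin (t * (E₀ - lam)) : ℝ) : ℂ)) ∂(P.diag x) := by
    intro t
    rw [integral_const_mul, integral_const_mul, hsin]
  simp_rw [heq]
  refine ⟨hint.integral_prod_left, ?_⟩
  rw [integral_integral_swap hint]
  simp_rw [integral_kernel_eq_lehmannKernel E₀ hz]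

/-- The weak Lehmann representation. -/
lemma integral_inner_sinOp_eq_hasSum (hsin : ∀ (t : ℝ) (x : 𝓗),
      ⟪x, sinOp t x⟫_ℂ = ∫ lam : ℝ, ((Real.sin (t * (E₀ - lam)) : ℝ) : ℂ) ∂(P.diag x))
    (hz : 0 < z.im) (ESS : 𝓗 →L[ℂ] 𝓗)
    (hESS : ∀ x : 𝓗, ⟪x, ESS x⟫_ℂ = ∫ lam in P.essSpec, lehmannKernel E₀ z lam ∂(P.diag x))
    (w v : 𝓗) :
    ∫ t in Set.Ioi (0 : ℝ), exp (I * z * t) * (2 * ⟪w, sinOp t v⟫_ℂ) =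
      ∑' E : P.discSpec E₀, lehmannKernel E₀ z E * ⟪w, P.proj {(E : ℝ)} v⟫_ℂ + ⟪w, ESS v⟫_ℂ := by
  obtain ⟨c, u, hcu⟩ := exists_inner_eq_sum_polarization w v
  have hsum : HasSum (fun E : P.discSpec E₀ => lehmannKernel E₀ z E * ⟪w, P.proj {(E : ℝ)} v⟫_ℂ)
      (∑ k, c k * ∫ lam in P.discSpec E₀, lehmannKernel E₀ z lam ∂(P.diag (u k))) := by
    refine (hasSum_sum fun k _ => ((P.hasSum_setIntegral_discSpec E₀ (u k) (by
      have := P.isFiniteMeasure_diag (u k)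
      exact integrable_lehmannKernel E₀ hz _)).mul_left (c k))).congr_fun fun E => ?_
    rw [hcu, Finset.mul_sum]
    exact Finset.sum_congr rfl fun k _ => by ring
  rw [hsum.tsum_eq, hcu ESS, ← Finset.sum_add_distrib]
  have hterm : ∀ t : ℝ, exp (I * z * t) * (2 * ⟪w, sinOp t v⟫_ℂ) =
      ∑ k, c k * (exp (I * z * t) * (2 * ⟪u k, sinOp t (u k)⟫_ℂ)) := by
    intro t
    rw [hcu, Finset.mul_sum, Finset.mul_sum]
    exact Finset.sum_congr rfl fun k _ => by ring
  simp_rw [hterm]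
  rw [integral_finsetSum _ fun k _ =>
    (integral_inner_sinOp P E₀ hsin hz (u k)).1.const_mul (c k)]
  refine Finset.sum_congr rfl fun k _ => ?_
  have := P.isFiniteMeasure_diag (u k)
  rw [integral_const_mul, (integral_inner_sinOp P E₀ hsin hz (u k)).2, hESS,
    P.integral_eq_discSpec_add_essSpec E₀ (u k) (integrable_lehmannKernel E₀ hz _)
      (lehmannKernel_self E₀)]
  ring

/-- The Lehmann representation after applying a bounded operator `L`. -/
lemma integral_comp_sinOp_eq_tsum [CompleteSpace 𝓗] {X : Type*} [NormedAddCommGroup X] [NormedSpace ℂ X]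
    [CompleteSpace X] (hsin : ∀ (t : ℝ) (x : 𝓗),
      ⟪x, sinOp t x⟫_ℂ = ∫ lam : ℝ, ((Real.sin (t * (E₀ - lam)) : ℝ) : ℂ) ∂(P.diag x))
    (hz : 0 < z.im) (ESS : 𝓗 →L[ℂ] 𝓗)
    (hESS : ∀ x : 𝓗, ⟪x, ESS x⟫_ℂ = ∫ lam in P.essSpec, lehmannKernel E₀ z lam ∂(P.diag x))
    (L : 𝓗 →L[ℂ] X) (v : 𝓗)
    (hint : IntegrableOn (fun t : ℝ => exp (I * z * t) • (2 : ℂ) • L (sinOp t v)) (Set.Ioi 0)) :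
    ∫ t in Set.Ioi (0 : ℝ), exp (I * z * t) • (2 : ℂ) • L (sinOp t v) =
      ∑' E : P.discSpec E₀, lehmannKernel E₀ z E • L (P.proj {(E : ℝ)} v) + L (ESS v) := by
  have hsum : Summable fun E : P.discSpec E₀ => lehmannKernel E₀ z E • L (P.proj {(E : ℝ)} v) := by
    simpa using (P.summable_smul_proj E₀ v (norm_lehmannKernel_le E₀ hz)).mapL L
  refine (SeparatingDual.eq_iff_forall_dual_eq (R := ℂ)).2 fun φ => ?_
  have hw : ∀ y, φ (L y) = ⟪(InnerProductSpace.toDual ℂ 𝓗).symm (φ ∘L L), y⟫_ℂ := fun y => by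
    rw [InnerProductSpace.toDual_symm_apply]; rfl
  rw [← φ.integral_comp_comm hint, map_add, φ.map_tsum hsum]
  simp only [map_smul, hw, smul_eq_mul]
  exact integral_inner_sinOp_eq_hasSum P E₀ hsin hz ESS hESS _ v

end Lehmann

lemma integral_clm_apply_of_integrable {F X : Type*} [NormedAddCommGroup F] [NormedSpace ℂ F]
    [NormedAddCommGroup X] [NormedSpace ℂ X] [CompleteSpace X] {μ : Measure ℝ}
    {φ : ℝ → F →L[ℂ] X} (h : Integrable φ μ) (f : F) :
    Integrable (fun t => φ t f) μ ∧ (∫ t, φ t ∂μ) f = ∫ t, φ t f ∂μ :=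
  ⟨(ContinuousLinearMap.apply ℂ X f).integrable_comp h, ContinuousLinearMap.integral_apply h f⟩

/-- Proposition 2.7, rigorous Lehmann representation: for `Im z > 0`,
`χ̂(z) = Σ_{E_j ∈ σ_d(H)\{E₀}} (1/(E₀−z−E_j) + 1/(E₀+z−E_j)) S P^H_{E_j} S*
        + S ∫_{σ_ess(H)} (1/(E₀−z−λ) + 1/(E₀+z−λ)) dP^H_λ S*`. -/
theorem ddrf_lehmann_representation
    {𝓗N : Type*} [NormedAddCommGroup 𝓗N] [InnerProductSpace ℂ 𝓗N] [CompleteSpace 𝓗N]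
    (P : SpectralData 𝓗N) (E₀ : ℝ) (Ψ₀ : 𝓗N) (hgs : IsGroundState P E₀ Ψ₀)
    -- the operator `S` of Proposition 2.2, and its adjoint `S*`
    (Smap : 𝓗N →L[ℂ] L1capL2) (Sadj : L2plusLinf →L[ℂ] 𝓗N)
    (hSadj : ∀ (g : Lsp 2 × Lsp ∞) (x : 𝓗N),
      ⟪Sadj (Submodule.Quotient.mk g : L2plusLinf), x⟫_ℂ =
        ∫ y : R3, (starRingEnd ℂ) ((g.1 : R3 → ℂ) y + (g.2 : R3 → ℂ) y) *
          (((Smap x).1.1 : R3 → ℂ) y))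
    -- the operators `sin(t(E₀−H))`, via the spectral theorem
    (sinOp : ℝ → (𝓗N →L[ℂ] 𝓗N))
    (hsin : ∀ (t : ℝ) (x : 𝓗N),
      ⟪x, sinOp t x⟫_ℂ = ∫ lam : ℝ, ((Real.sin (t * (E₀ - lam)) : ℝ) : ℂ) ∂(P.diag x))
    -- the Fourier transform `χ̂(z) = ∫₀^∞ χ(t) e^{izt} dt` of
    -- `χ(t) = 2θ(t) S sin(t(E₀−H)) S*`, for `Im z > 0`
    (Khat : ℂ → (L2plusLinf →L[ℂ] L1capL2))
    (hKhat : ∀ z : ℂ, 0 < z.im →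
      @MeasureTheory.IntegrableOn _ _ _ _ SeminormedAddGroup.toContinuousENorm
        (fun t : ℝ => Complex.exp (Complex.I * z * t) •
          (inclι ∘L (((2 * heaviside t : ℝ) : ℂ) • (Smap ∘L sinOp t ∘L Sadj))))
        (Set.Ioi 0) volume ∧
      inclι ∘L Khat z = ∫ t in Set.Ioi (0:ℝ), Complex.exp (Complex.I * z * t) •
        (inclι ∘L (((2 * heaviside t : ℝ) : ℂ) • (Smap ∘L sinOp t ∘L Sadj))))
    -- the spectral integral `∫_{σ_ess(H)} (1/(E₀−z−λ) + 1/(E₀+z−λ)) dP^H_λ`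
    (ESS : ℂ → (𝓗N →L[ℂ] 𝓗N))
    (hESS : ∀ z : ℂ, z.im ≠ 0 → ∀ x : 𝓗N,
      ⟪x, ESS z x⟫_ℂ = ∫ lam in P.essSpec,
        (((E₀ : ℂ) - z - (lam : ℂ))⁻¹ + ((E₀ : ℂ) + z - (lam : ℂ))⁻¹) ∂(P.diag x)) :
    -- the Lehmann representation (the sum over the discrete spectrum converging strongly)
    ∀ z : ℂ, 0 < z.im → ∀ f : L2plusLinf,
      inclι (Khat z f) =
        (∑' E : {E : ℝ | E ∈ P.spec ∧ E ∉ P.essSpec ∧ E ≠ E₀},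
          ((((E₀ : ℂ) - z - ((E : ℝ) : ℂ))⁻¹ + ((E₀ : ℂ) + z - ((E : ℝ) : ℂ))⁻¹)) •
            inclι (Smap (P.proj {(E : ℝ)} (Sadj f)))) +
        inclι (Smap (ESS z (Sadj f))) := by
  intro z hz f
  obtain ⟨hint, heq⟩ := hKhat z hz
  have hval : ∀ t ∈ Set.Ioi (0 : ℝ), (Complex.exp (Complex.I * z * t) •
      (inclι ∘L (((2 * heaviside t : ℝ) : ℂ) • (Smap ∘L sinOp t ∘L Sadj)))) f =
      Complex.exp (Complex.I * z * t) • (2 : ℂ) • (inclι ∘L Smap) (sinOp t (Sadj f)) := by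
    intro t ht
    simp [heaviside, (Set.mem_Ioi.1 ht).le]
  obtain ⟨hintf, hf⟩ :=
    integral_clm_apply_of_integrable (F := L2plusLinf) (X := Lsp 1 × Lsp 2) hint f
  refine ((congrArg (fun T => T f) heq).trans hf).trans ?_
  refine (setIntegral_congr_fun measurableSet_Ioi hval).trans ?_
  exact integral_comp_sinOp_eq_tsum P E₀ hsin hz (ESS z) (hESS z hz.ne') (inclι ∘L Smap) (Sadj f)
    ((integrableOn_congr_fun hval measurableSet_Ioi).1 hintf)

end
end
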